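/- arXiv:1106.5337 — 2 statements merged into one kernel-verified Lean document; each statement's English description precedes it below -/
import Mathlib

section
/- Every countable nonamenable discrete group Γ admits uncountably many pairwise non-orbit-equivalent free mixing pmp actions on a nonatomic standard probability space. -/
open MeasureTheory Set BoundedContinuousFunction

noncomputable section

/-- A (discrete) group `G` is amenable if there is a left-invariant mean on `ℓ^∞(G)`:
a positive unital linear functional `φ` with `φ (g · f) = φ f`, where
`(g · f) h = f (g⁻¹ h)`. -/
def IsAmenable (G : Type*) [Group G] : Prop :=
  letI : TopologicalSpace G := ⊥
  haveI : DiscreteTopology G := ⟨rfl⟩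
  ∃ φ : (G →ᵇ ℝ) →ₗ[ℝ] ℝ,
    (∀ f : G →ᵇ ℝ, (∀ x, 0 ≤ f x) → 0 ≤ φ f) ∧
    φ 1 = 1 ∧
    ∀ (g : G) (f : G →ᵇ ℝ),
      φ (f.compContinuous ⟨fun h => g⁻¹ * h, continuous_of_discreteTopology⟩) = φ f

/-- A probability-measure-preserving action of the group `G` on `(X, μ)`. -/
structure PmpAction (G X : Type*) [Group G] [MeasurableSpace X] (μ : Measure X) where
  act : G → X → X
  act_one : ∀ x, act 1 x = x
  act_mul : ∀ g h x, act (g * h) x = act g (act h x)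
  measurable : ∀ g, Measurable (act g)
  measurePreserving : ∀ g, MeasurePreserving (act g) μ μ

variable {G X Y : Type*} [Group G] [MeasurableSpace X] [MeasurableSpace Y]
  {μ : Measure X} {ν : Measure Y}

/-- The action is (essentially) free. -/
def PmpAction.IsFree (A : PmpAction G X μ) : Prop :=
  ∀ᵐ x ∂μ, ∀ g : G, A.act g x = x → g = 1

/-- The action is mixing: for all measurable `s, t`,
`μ (g s ∩ t) → μ s * μ t` as `g → ∞` along the cofinite filter on `G`. -/
def PmpAction.IsMixing (A : PmpAction G X μ) : Prop :=
  ∀ s t : Set X, MeasurableSet s → MeasurableSet t →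
    Filter.Tendsto (fun g : G => μ (A.act g '' s ∩ t)) Filter.cofinite (nhds (μ s * μ t))

/-- The orbit `G x` of a point. -/
def PmpAction.orbit (A : PmpAction G X μ) (x : X) : Set X :=
  {y | ∃ g : G, y = A.act g x}

/-- Two pmp actions are orbit equivalent if there is a measure-preserving Borel isomorphism
`Δ` with `Δ(G x) = H (Δ x)` for almost every `x`. -/
def OrbitEquivalent {H : Type*} [Group H] (A : PmpAction G X μ) (B : PmpAction H Y ν) :
    Prop :=
  ∃ Δ : X ≃ Y, Measurable ⇑Δ ∧ Measurable ⇑Δ.symm ∧ MeasurePreserving ⇑Δ μ ν ∧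
    ∀ᵐ x ∂μ, ⇑Δ '' A.orbit x = B.orbit (Δ x)

namespace OEMixing

open Filter Topology ENNReal

section Amenability

variable {Γ : Type*} [Group Γ]

theorem summable_abs_translate_sub {ξ : Γ → ℝ} (h : Summable ξ) (s : Γ) :
    Summable fun u => |ξ (u * s) - ξ u| :=
  (((Equiv.mulRight s).summable_iff.mpr h).sub h).abs

/-- The mean attached to a probability vector. -/
def vectorMean (ξ : Γ → ℝ) (f : Γ → ℝ) : ℝ := ∑' u, ξ u * f u⁻¹

theorem summable_vectorMean {ξ : Γ → ℝ} (h0 : ∀ u, 0 ≤ ξ u) (h1 : Summable ξ) {f : Γ → ℝ} {C : ℝ}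
    (hf : ∀ u, |f u| ≤ C) : Summable fun u => ξ u * f u⁻¹ := by
  refine Summable.of_norm_bounded (h1.mul_left C) fun u => ?_
  rw [Real.norm_eq_abs, abs_mul, abs_of_nonneg (h0 u), mul_comm]
  exact mul_le_mul_of_nonneg_right (hf _) (h0 u)

theorem abs_vectorMean_le {ξ : Γ → ℝ} (h0 : ∀ u, 0 ≤ ξ u) (h1 : HasSum ξ 1) {f : Γ → ℝ} {C : ℝ}
    (hf : ∀ u, |f u| ≤ C) : |vectorMean ξ f| ≤ C := by
  have h := tsum_of_norm_bounded (f := fun u => ξ u * f u⁻¹) (h1.mul_left C) fun u => by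
    rw [Real.norm_eq_abs, abs_mul, abs_of_nonneg (h0 u), mul_comm]
    exact mul_le_mul_of_nonneg_right (hf _) (h0 u)
  simpa [vectorMean] using h

theorem abs_vectorMean_translate_sub_le {ξ : Γ → ℝ} (h0 : ∀ u, 0 ≤ ξ u) (h1 : Summable ξ)
    {f : Γ → ℝ} {C : ℝ} (hf : ∀ u, |f u| ≤ C) (g : Γ) :
    |vectorMean ξ (fun h => f (g⁻¹ * h)) - vectorMean ξ f| ≤
      C * ∑' u, |ξ (u * g⁻¹) - ξ u| := by
  have e1 : vectorMean ξ (fun h => f (g⁻¹ * h)) = ∑' u, ξ (u * g⁻¹) * f u⁻¹ := by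
    rw [vectorMean, ← (Equiv.mulRight g⁻¹).tsum_eq]
    refine tsum_congr fun u => ?_
    simp [mul_inv_rev]
  have s1 : Summable fun u => ξ (u * g⁻¹) * f u⁻¹ :=
    summable_vectorMean (fun u => h0 _) ((Equiv.mulRight g⁻¹).summable_iff.mpr h1) hf
  rw [e1, vectorMean, ← s1.tsum_sub (summable_vectorMean h0 h1 hf), ← tsum_mul_left]
  rw [← Real.norm_eq_abs]
  refine tsum_of_norm_bounded ((summable_abs_translate_sub h1 g⁻¹).mul_left C).hasSum fun u => ?_
  rw [← sub_mul, Real.norm_eq_abs, abs_mul, mul_comm]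
  exact mul_le_mul_of_nonneg_right (hf _) (abs_nonneg _)

theorem isAmenable_of_almost_invariant
    (h : ∀ (S : Finset Γ) (n : ℕ), ∃ ξ : Γ → ℝ, (∀ u, 0 ≤ ξ u) ∧ HasSum ξ 1 ∧
      ∀ s ∈ S, ∑' u, |ξ (u * s) - ξ u| ≤ 3 / (n + 1)) : IsAmenable Γ := by
  let _ : TopologicalSpace Γ := ⊥
  have _ : DiscreteTopology Γ := ⟨rfl⟩
  classical
  choose ξ h0 h1 hinv using fun i : Finset Γ × ℕ => h i.1 i.2
  let U : Ultrafilter (Finset Γ × ℕ) := Ultrafilter.of atTop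
  have hU : (U : Filter (Finset Γ × ℕ)) ≤ atTop := Ultrafilter.of_le _
  have hb : ∀ (f : Γ →ᵇ ℝ) (u : Γ), |f u| ≤ ‖f‖ := fun f u => f.norm_coe_le_norm u
  have hlim : ∀ f : Γ →ᵇ ℝ, ∃ a, Tendsto (fun i => vectorMean (ξ i) f) U (𝓝 a) := by
    intro f
    have hc : IsCompact (Icc (-‖f‖) ‖f‖) := isCompact_Icc
    obtain ⟨a, -, ha⟩ := hc.ultrafilter_le_nhds (U.map fun i => vectorMean (ξ i) f) (by
      rw [Ultrafilter.coe_map, le_principal_iff]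
      exact Filter.univ_mem' (f := U.toFilter) fun i => abs_le.mp (abs_vectorMean_le (h0 i) (h1 i) (hb f)))
    exact ⟨a, ha⟩
  choose L hL using hlim
  have sm : ∀ (f : Γ →ᵇ ℝ) i, Summable fun u => ξ i u * f u⁻¹ := fun f i =>
    summable_vectorMean (h0 i) (h1 i).summable (hb f)
  refine ⟨⟨⟨L, ?_⟩, ?_⟩, ?_, ?_, ?_⟩
  · intro f g
    refine tendsto_nhds_unique (hL (f + g)) (((hL f).add (hL g)).congr fun i => ?_)
    simp only [vectorMean]
    rw [← (sm f i).tsum_add (sm g i)]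
    simp [mul_add]
  · intro c f
    refine tendsto_nhds_unique (hL (c • f)) (((hL f).const_mul c).congr fun i => ?_)
    simp only [vectorMean]
    rw [← tsum_mul_left]
    refine tsum_congr fun u => ?_
    simp; ring
  · intro f hf
    exact ge_of_tendsto' (hL f) fun i => tsum_nonneg fun u => mul_nonneg (h0 i u) (hf _)
  · refine tendsto_nhds_unique (hL 1) (tendsto_const_nhds.congr fun i => ?_)
    simp [vectorMean, (h1 i).tsum_eq]
  · intro g f
    refine tendsto_nhds_unique (hL _) ?_
    have hz : Tendsto (fun i => vectorMean (ξ i) (fun h => f (g⁻¹ * h)) - vectorMean (ξ i) f)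
        U (𝓝 0) := by
      have hdec : Tendsto (fun i : Finset Γ × ℕ => ‖f‖ * (3 / ((i.2 : ℝ) + 1))) U (𝓝 0) := by
        have h2 : Tendsto (fun n : ℕ => ‖f‖ * (3 * (1 / ((n : ℝ) + 1)))) atTop (𝓝 (‖f‖ * (3 * 0))) :=
          (tendsto_one_div_add_atTop_nhds_zero_nat.const_mul 3).const_mul _
        have h3 : Tendsto (fun i : Finset Γ × ℕ => i.2) U atTop :=
          (tendsto_snd (f := (atTop : Filter (Finset Γ)))).mono_left
            (hU.trans (prod_atTop_atTop_eq (α := Finset Γ) (β := ℕ)).ge)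
        refine ((h2.comp h3).congr fun i => ?_).trans (by simp)
        simp [div_eq_mul_inv]
      refine squeeze_zero_norm' ?_ hdec
      have hev : ∀ᶠ i : Finset Γ × ℕ in U, ({g⁻¹}, 0) ≤ i := hU (eventually_ge_atTop _)
      filter_upwards [hev] with i hi
      refine (abs_vectorMean_translate_sub_le (h0 i) (h1 i).summable (hb f) g).trans ?_
      refine mul_le_mul_of_nonneg_left (hinv i _ ?_) (norm_nonneg _)
      exact hi.1 (Finset.mem_singleton_self _)
    have := hz.add (hL f)
    simpa [Function.comp_def] using this

theorem exists_correlation_gap (hna : ¬ IsAmenable Γ) :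
    ∃ (S : Finset Γ) (δ : ℝ), 0 < δ ∧ δ < 1 ∧ ∀ F : Γ → ℝ, (∀ u, 0 ≤ F u) →
      Summable (fun u => F u ^ 2) → ∃ s ∈ S, ∑' u, F u * F (u * s) ≤ δ * ∑' u, F u ^ 2 := by
  classical
  contrapose! hna
  refine isAmenable_of_almost_invariant fun S n => ?_
  set m : ℝ := (n : ℝ) + 2 with hm
  have hm0 : 2 ≤ m := by simp [hm]
  have hmi : 1 / m ^ 2 < 1 := by
    rw [div_lt_one (by positivity)]; nlinarith
  obtain ⟨F, hF, hs, hc⟩ := hna (insert 1 S) (1 - 1 / m ^ 2) (by linarith) (by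
    have : 0 < 1 / m ^ 2 := by positivity
    linarith)
  set N := ∑' u, F u ^ 2 with hN
  have hN0 : 0 < N := by
    rcases (tsum_nonneg fun u => sq_nonneg (F u)).lt_or_eq with h | h
    · exact h
    · have h1 := hc 1 (Finset.mem_insert_self _ _)
      simp only [mul_one, ← pow_two, ← hN] at h1
      rw [← hN] at h
      simp [← h] at h1
  refine ⟨fun u => F u ^ 2 / N, fun u => by positivity, ?_, fun s hsS => ?_⟩
  · have := hs.hasSum.div_const N
    rwa [← hN, div_self hN0.ne'] at this
  · have hs' : Summable fun u => F (u * s) ^ 2 :=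
      (Equiv.mulRight s).summable_iff.mpr hs
    have hN' : ∑' u, F (u * s) ^ 2 = N := (Equiv.mulRight s).tsum_eq fun u => F u ^ 2
    have hprod : Summable fun u => F u * F (u * s) := by
      refine Summable.of_nonneg_of_le (fun u => mul_nonneg (hF _) (hF _)) (fun u => ?_)
        (hs.add hs')
      nlinarith [sq_nonneg (F u - F (u * s)), sq_nonneg (F u), sq_nonneg (F (u * s))]
    set c := ∑' u, F u * F (u * s) with hcdef
    have hcl : (1 - 1 / m ^ 2) * N < c := hc s (Finset.mem_insert_of_mem hsS)
    have hcu : c ≤ N := by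
      have : c ≤ ∑' u, (F u ^ 2 + F (u * s) ^ 2) / 2 := by
        refine hprod.tsum_le_tsum (fun u => ?_) ((hs.add hs').div_const 2)
        nlinarith [sq_nonneg (F u - F (u * s))]
      rw [tsum_div_const, hs.tsum_add hs', hN'] at this
      linarith
    have hA : HasSum (fun u => (m * (F (u * s) ^ 2 + F u ^ 2 - 2 * (F u * F (u * s))) +
        (F (u * s) ^ 2 + F u ^ 2 + 2 * (F u * F (u * s))) / m) / 2 / N)
        ((m * (N + N - 2 * c) + (N + N + 2 * c) / m) / 2 / N) := by
      have a1 : HasSum (fun u => F (u * s) ^ 2) N := hN' ▸ hs'.hasSum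
      have a2 : HasSum (fun u => F u ^ 2) N := hs.hasSum
      have a3 : HasSum (fun u => 2 * (F u * F (u * s))) (2 * c) := hprod.hasSum.mul_left 2
      exact (((((a1.add a2).sub a3).mul_left m).add (((a1.add a2).add a3).div_const m)).div_const
        2).div_const N
    refine (Summable.tsum_le_tsum (fun u => ?_) ?_ hA.summable).trans ?_
    · rw [← sub_div, abs_div, abs_of_pos hN0]
      refine div_le_div_of_nonneg_right ?_ hN0.le
      have e : F (u * s) ^ 2 - F u ^ 2 = (F (u * s) - F u) * (F (u * s) + F u) := by ring
      rw [e, abs_mul, le_div_iff₀ two_pos]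
      set a := |F (u * s) - F u| with ha
      set b := |F (u * s) + F u| with hb
      have ea : F (u * s) ^ 2 + F u ^ 2 - 2 * (F u * F (u * s)) = a ^ 2 := by
        rw [ha, sq_abs]; ring
      have eb : F (u * s) ^ 2 + F u ^ 2 + 2 * (F u * F (u * s)) = b ^ 2 := by
        rw [hb, sq_abs]; ring
      rw [ea, eb, ← sub_nonneg]
      have : m * a ^ 2 + b ^ 2 / m - a * b * 2 = (m * a - b) ^ 2 / m := by
        field_simp; ring
      rw [this]; positivity
    · exact summable_abs_translate_sub (ξ := fun u => F u ^ 2 / N) (hs.div_const N) s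
    · rw [hA.tsum_eq]
      have hm1 : (0 : ℝ) < n + 1 := by positivity
      have hmp : 0 < m := by linarith
      have b1 : m * (N + N - 2 * c) ≤ 2 * N / m := by
        have : N + N - 2 * c ≤ 2 * N / m ^ 2 := by
          have e : 2 * N / m ^ 2 = 2 * (1 / m ^ 2 * N) := by ring
          rw [e]; linarith
        refine (mul_le_mul_of_nonneg_left this hmp.le).trans_eq ?_
        field_simp
      have b2 : (N + N + 2 * c) / m ≤ 4 * N / m :=
        div_le_div_of_nonneg_right (by linarith) hmp.le
      calc (m * (N + N - 2 * c) + (N + N + 2 * c) / m) / 2 / N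
          ≤ (2 * N / m + 4 * N / m) / 2 / N := by gcongr
        _ = 3 / m := by field_simp; ring
        _ ≤ 3 / (n + 1) := div_le_div_of_nonneg_left (by norm_num) hm1 (by simp [hm])

end Amenability

section Contraction

variable {Γ : Type*} [Group Γ]

/-- The squared `ℓ²` norm. -/
def sqNorm {α : Type*} (f : α → ℝ≥0∞) : ℝ≥0∞ := ∑' u, f u ^ 2

/-- Averaging of `f` along right translations by `w`-distributed elements. -/
def avg (w f : Γ → ℝ≥0∞) (u : Γ) : ℝ≥0∞ := ∑' s, w s * f (u * s)

/-- Averaging of `f` along right translations by inverses of `w`-distributed elements. -/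
def avgInv (w f : Γ → ℝ≥0∞) (u : Γ) : ℝ≥0∞ := ∑' s, w s * f (u * s⁻¹)

/-- `w` is a probability vector whose averaging operators contract `ℓ²` by the factor `θ`
(for squared norms). -/
structure Contracts (w : Γ → ℝ≥0∞) (θ : ℝ≥0∞) : Prop where
  tsum_eq : ∑' s, w s = 1
  avg_le : ∀ f, sqNorm (avg w f) ≤ θ * sqNorm f
  avgInv_le : ∀ f, sqNorm (avgInv w f) ≤ θ * sqNorm f

theorem two_mul_mul_le (a b : ℝ≥0∞) : 2 * a * b ≤ a ^ 2 + b ^ 2 := by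
  wlog h : a ≤ b generalizing a b
  · have := this b a (le_of_not_ge h)
    calc 2 * a * b = 2 * b * a := by ring
      _ ≤ b ^ 2 + a ^ 2 := this
      _ = a ^ 2 + b ^ 2 := add_comm _ _
  obtain ⟨c, rfl⟩ := le_iff_exists_add.mp h
  calc 2 * a * (a + c) ≤ 2 * a * (a + c) + c ^ 2 := le_self_add
    _ = a ^ 2 + (a + c) ^ 2 := by ring

theorem sqNorm_translate (f : Γ → ℝ≥0∞) (s : Γ) : sqNorm (fun u => f (u * s)) = sqNorm f :=
  (Equiv.mulRight s).tsum_eq fun u => f u ^ 2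

theorem tsum_mul_le_of_sqNorm {α : Type*} {f g : α → ℝ≥0∞} {N : ℝ≥0∞} (hf : sqNorm f ≤ N)
    (hg : sqNorm g ≤ N) : ∑' u, f u * g u ≤ N := by
  have h2 : 2 * ∑' u, f u * g u ≤ 2 * N := by
    rw [← ENNReal.tsum_mul_left, two_mul N]
    refine le_trans (ENNReal.tsum_le_tsum fun u => ?_) ((ENNReal.tsum_add (f := fun u => f u ^ 2)
      (g := fun u => g u ^ 2)).trans_le (add_le_add hf hg))
    rw [← mul_assoc]; exact two_mul_mul_le _ _
  exact (ENNReal.mul_le_mul_iff_right two_ne_zero ofNat_ne_top).mp h2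

/-- An average of finitely many vectors of equal norm, two of which are far from parallel. -/
theorem sqNorm_average_le {α ι : Type*} (T : Finset ι) (g : ι → α → ℝ≥0∞)
    {N δ : ℝ≥0∞} (hN : ∀ i ∈ T, sqNorm (g i) ≤ N) {i j : ι} (hi : i ∈ T) (hj : j ∈ T)
    (hij : ∑' u, g i u * g j u ≤ δ * N) :
    sqNorm (fun u => ∑ s ∈ T, (T.card : ℝ≥0∞)⁻¹ * g s u) ≤
      ((T.card : ℝ≥0∞)⁻¹ ^ 2 * (((T.card ^ 2 - 1 : ℕ) : ℝ≥0∞) + δ)) * N := by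
  classical
  have e : sqNorm (fun u => ∑ s ∈ T, (T.card : ℝ≥0∞)⁻¹ * g s u) =
      (T.card : ℝ≥0∞)⁻¹ ^ 2 * ∑ p ∈ T ×ˢ T, ∑' u, g p.1 u * g p.2 u := by
    rw [← Summable.tsum_finsetSum (fun _ _ => ENNReal.summable), ← ENNReal.tsum_mul_left]
    refine tsum_congr fun u => ?_
    beta_reduce
    rw [← Finset.mul_sum, mul_pow, pow_two (∑ s ∈ T, g s u), Finset.sum_mul_sum,
      Finset.sum_product]
  rw [e, mul_assoc]
  gcongr
  have hmem : (i, j) ∈ T ×ˢ T := Finset.mem_product.mpr ⟨hi, hj⟩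
  rw [← Finset.sum_erase_add _ _ hmem, add_mul]
  refine add_le_add ?_ hij
  refine (Finset.sum_le_card_nsmul _ _ N fun p hp => ?_).trans_eq ?_
  · have hp' := Finset.mem_product.mp (Finset.mem_of_mem_erase hp)
    exact tsum_mul_le_of_sqNorm (hN _ hp'.1) (hN _ hp'.2)
  · rw [Finset.card_erase_of_mem hmem, Finset.card_product, nsmul_eq_mul, pow_two]

theorem exists_correlation_gap_ennreal (hna : ¬ IsAmenable Γ) :
    ∃ (S : Finset Γ) (δ : ℝ≥0∞), δ ≠ 0 ∧ δ < 1 ∧ ∀ f : Γ → ℝ≥0∞, sqNorm f ≠ ⊤ →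
      ∃ s ∈ S, ∑' u, f u * f (u * s) ≤ δ * sqNorm f := by
  obtain ⟨S, δ, h0, h1, h⟩ := exists_correlation_gap hna
  refine ⟨S, ENNReal.ofReal δ, by simpa using h0, by rwa [ENNReal.ofReal_lt_one], fun f hf => ?_⟩
  have hfu : ∀ u, f u ≠ ⊤ := fun u hu => by
    have h2 : f u ^ 2 ≠ ⊤ := ENNReal.ne_top_of_tsum_ne_top hf u
    simp [hu] at h2
  lift f to Γ → NNReal using hfu
  have hs : Summable fun u => f u ^ 2 := by
    refine ENNReal.tsum_coe_ne_top_iff_summable.mp ?_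
    simpa [sqNorm] using hf
  have hs1 : Summable fun u => (f u : ℝ) ^ 2 := by exact_mod_cast NNReal.summable_coe.mpr hs
  obtain ⟨s, hsS, hle⟩ := h (fun u => (f u : ℝ)) (fun u => NNReal.coe_nonneg _) hs1
  refine ⟨s, hsS, ?_⟩
  have hs' : Summable fun u => (f (u * s) : ℝ) ^ 2 :=
    (Equiv.mulRight s).summable_iff.mpr hs1
  have hprod : Summable fun u => (f u : ℝ) * f (u * s) := by
    refine Summable.of_nonneg_of_le (fun u => by positivity) (fun u => ?_) (hs1.add hs')
    nlinarith [sq_nonneg ((f u : ℝ) - f (u * s)), sq_nonneg (f u : ℝ), sq_nonneg (f (u * s) : ℝ)]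
  have e1 : sqNorm (fun u => (f u : ℝ≥0∞)) = ENNReal.ofReal (∑' u, (f u : ℝ) ^ 2) := by
    rw [ENNReal.ofReal_tsum_of_nonneg (fun u => by positivity) hs1, sqNorm]
    refine tsum_congr fun u => ?_
    rw [ENNReal.ofReal_pow (NNReal.coe_nonneg _), ENNReal.ofReal_coe_nnreal]
  have e2 : ∑' u, (f u : ℝ≥0∞) * f (u * s) = ENNReal.ofReal (∑' u, (f u : ℝ) * f (u * s)) := by
    rw [ENNReal.ofReal_tsum_of_nonneg (fun u => by positivity) hprod]
    refine tsum_congr fun u => ?_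
    rw [ENNReal.ofReal_mul (NNReal.coe_nonneg _), ENNReal.ofReal_coe_nnreal,
      ENNReal.ofReal_coe_nnreal]
  rw [e1, e2, ← ENNReal.ofReal_mul h0.le]
  exact ENNReal.ofReal_le_ofReal hle

theorem exists_contracts (hna : ¬ IsAmenable Γ) :
    ∃ (w : Γ → ℝ≥0∞) (θ : ℝ≥0∞), θ < 1 ∧ Contracts w θ := by
  classical
  obtain ⟨S, δ, hδ0, hδ, h⟩ := exists_correlation_gap_ennreal hna
  set T := insert 1 S with hT
  have h1T : (1 : Γ) ∈ T := Finset.mem_insert_self _ _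
  set m := T.card with hm
  have hm0 : 0 < m := Finset.card_pos.mpr ⟨1, h1T⟩
  have hmE : (m : ℝ≥0∞) ≠ 0 := by exact_mod_cast hm0.ne'
  have hmt : (m : ℝ≥0∞) ≠ ⊤ := ENNReal.natCast_ne_top m
  set w : Γ → ℝ≥0∞ := fun s => if s ∈ T then (m : ℝ≥0∞)⁻¹ else 0 with hw
  have hsum : ∀ F : Γ → ℝ≥0∞, ∑' s, w s * F s = ∑ s ∈ T, (m : ℝ≥0∞)⁻¹ * F s := by
    intro F
    rw [tsum_eq_sum (s := T) fun s hs => by simp [hw, hs]]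
    exact Finset.sum_congr rfl fun s hs => by simp [hw, hs]
  set θ : ℝ≥0∞ := (m : ℝ≥0∞)⁻¹ ^ 2 * (((m ^ 2 - 1 : ℕ) : ℝ≥0∞) + δ) with hθ
  have hθ1 : θ < 1 := by
    have h2 : ((m ^ 2 - 1 : ℕ) : ℝ≥0∞) + δ < (m : ℝ≥0∞) ^ 2 := by
      have : ((m ^ 2 : ℕ) : ℝ≥0∞) = ((m ^ 2 - 1 : ℕ) : ℝ≥0∞) + 1 := by
        exact_mod_cast (Nat.sub_add_cancel (Nat.one_le_pow _ _ hm0)).symm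
      rw [← Nat.cast_pow, this]
      exact (ENNReal.add_lt_add_iff_left (ENNReal.natCast_ne_top _)).mpr hδ
    rw [hθ, ← ENNReal.inv_pow, mul_comm, ← div_eq_mul_inv]
    exact (ENNReal.div_lt_iff (Or.inl (pow_ne_zero _ hmE)) (Or.inl (ENNReal.pow_ne_top hmt))).mpr
      (by rwa [one_mul])
  have hθ0 : θ ≠ 0 := by
    rw [hθ]
    exact mul_ne_zero (pow_ne_zero _ (ENNReal.inv_ne_zero.mpr hmt)) (by simp [hδ0])
  refine ⟨w, θ, hθ1, ?_, fun f => ?_, fun f => ?_⟩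
  · have := hsum fun _ => 1
    simp only [mul_one] at this
    rw [this, Finset.sum_const, nsmul_eq_mul, ← hm, ENNReal.mul_inv_cancel hmE hmt]
  · by_cases hf : sqNorm f = ⊤
    · rw [hf, ENNReal.mul_top hθ0]; exact le_top
    obtain ⟨s, hs, hle⟩ := h f hf
    have e : avg w f = fun u => ∑ s ∈ T, (m : ℝ≥0∞)⁻¹ * f (u * s) := funext fun u => hsum _
    rw [e]
    exact sqNorm_average_le T (fun s u => f (u * s)) (fun s _ => (sqNorm_translate f s).le) h1T
      (Finset.mem_insert_of_mem hs) (by simpa using hle)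
  · by_cases hf : sqNorm f = ⊤
    · rw [hf, ENNReal.mul_top hθ0]; exact le_top
    obtain ⟨s, hs, hle⟩ := h f hf
    have e : avgInv w f = fun u => ∑ s ∈ T, (m : ℝ≥0∞)⁻¹ * f (u * s⁻¹) := funext fun u => hsum _
    rw [e]
    refine sqNorm_average_le T (fun s u => f (u * s⁻¹)) (fun s _ => (sqNorm_translate f s⁻¹).le)
      (Finset.mem_insert_of_mem hs) h1T (le_of_eq_of_le ?_ hle)
    rw [← (Equiv.mulRight s).tsum_eq]
    simp

theorem Contracts.mul {w w' : Γ → ℝ≥0∞} {θ θ' : ℝ≥0∞} (h : Contracts w θ) (h' : Contracts w' θ') :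
    Contracts (fun s => ∑' t, w t * w' (t⁻¹ * s)) (θ * θ') := by
  have key : ∀ F : Γ → ℝ≥0∞, ∑' s, (∑' t, w t * w' (t⁻¹ * s)) * F s =
      ∑' t, w t * ∑' r, w' r * F (t * r) := by
    intro F
    simp_rw [← ENNReal.tsum_mul_right]
    rw [ENNReal.tsum_comm]
    refine tsum_congr fun t => ?_
    rw [← ENNReal.tsum_mul_left, ← (Equiv.mulLeft t).tsum_eq]
    refine tsum_congr fun r => ?_
    simp [mul_assoc]
  refine ⟨?_, fun f => ?_, fun f => ?_⟩
  · have := key fun _ => 1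
    simpa [h.tsum_eq, h'.tsum_eq] using this
  · have e : avg (fun s => ∑' t, w t * w' (t⁻¹ * s)) f = avg w (avg w' f) := by
      funext u
      simp only [avg, key, mul_assoc]
    rw [e, mul_assoc]
    exact (h.avg_le _).trans (mul_le_mul_right (h'.avg_le f) θ)
  · have e : avgInv (fun s => ∑' t, w t * w' (t⁻¹ * s)) f = avgInv w' (avgInv w f) := by
      funext u
      simp only [avgInv, key, mul_inv_rev]
      simp_rw [← ENNReal.tsum_mul_left]
      rw [ENNReal.tsum_comm]
      refine tsum_congr fun t => tsum_congr fun r => ?_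
      rw [← mul_assoc u]
      ring
    rw [e, mul_comm θ, mul_assoc]
    exact (h'.avgInv_le _).trans (mul_le_mul_right (h.avgInv_le f) θ')

theorem exists_contracts_small (hna : ¬ IsAmenable Γ) {ε : ℝ≥0∞} (hε : ε ≠ 0) :
    ∃ w : Γ → ℝ≥0∞, Contracts w ε := by
  obtain ⟨w, θ, hθ, h⟩ := exists_contracts hna
  have hpow : ∀ n : ℕ, ∃ w : Γ → ℝ≥0∞, Contracts w (θ ^ (n + 1)) := by
    intro n
    induction n with
    | zero => exact ⟨w, by simpa using h⟩
    | succ n ih =>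
      obtain ⟨w', h'⟩ := ih
      exact ⟨_, by simpa only [pow_succ] using h'.mul h⟩
  have ht := (ENNReal.tendsto_pow_atTop_nhds_zero_of_lt_one hθ).comp (tendsto_add_atTop_nat 1)
  obtain ⟨n, hn⟩ := (ht.eventually (gt_mem_nhds (pos_iff_ne_zero.mpr hε))).exists
  obtain ⟨w', h'⟩ := hpow n
  exact ⟨w', h'.tsum_eq, fun f => (h'.avg_le f).trans (mul_le_mul_left hn.le _),
    fun f => (h'.avgInv_le f).trans (mul_le_mul_left hn.le _)⟩

theorem Contracts.sqNorm_le {w : Γ → ℝ≥0∞} {θ : ℝ≥0∞} (h : Contracts w θ) : sqNorm w ≤ θ := by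
  classical
  have h1 := h.avgInv_le fun u => if u = 1 then 1 else 0
  have e1 : avgInv w (fun u => if u = 1 then 1 else 0) = w := by
    funext u
    rw [avgInv, tsum_eq_single u]
    · simp
    · intro s hs
      have : u * s⁻¹ ≠ 1 := fun h => hs (mul_inv_eq_one.mp h).symm
      simp [this]
  have e2 : sqNorm (fun u : Γ => if u = 1 then (1 : ℝ≥0∞) else 0) = 1 := by
    rw [sqNorm, tsum_eq_single 1]
    · simp
    · intro s hs; simp [hs]
  rwa [e1, e2, mul_one] at h1

end Contraction

section Green

variable {Γ : Type*} [Group Γ]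

theorem sq_sum_range_le (g : ℕ → ℝ≥0∞) (n : ℕ) :
    (∑ k ∈ Finset.range n, g k) ^ 2 ≤ ∑ k ∈ Finset.range n, 2 ^ (k + 1) * g k ^ 2 := by
  induction n generalizing g with
  | zero => simp
  | succ n ih =>
    rw [Finset.sum_range_succ', Finset.sum_range_succ' (fun k => 2 ^ (k + 1) * g k ^ 2)]
    have h := ih fun k => g (k + 1)
    set a := ∑ k ∈ Finset.range n, g (k + 1)
    calc (a + g 0) ^ 2 = a ^ 2 + g 0 ^ 2 + 2 * a * g 0 := by ring
      _ ≤ a ^ 2 + g 0 ^ 2 + (a ^ 2 + g 0 ^ 2) := by gcongr; exact two_mul_mul_le _ _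
      _ = 2 * a ^ 2 + 2 ^ (0 + 1) * g 0 ^ 2 := by ring
      _ ≤ 2 * (∑ k ∈ Finset.range n, 2 ^ (k + 1) * g (k + 1) ^ 2) + 2 ^ (0 + 1) * g 0 ^ 2 := by
        gcongr
      _ = _ := by
        rw [Finset.mul_sum]
        congr 1
        refine Finset.sum_congr rfl fun k _ => ?_
        ring

theorem sqNorm_tsum_le {α : Type*} (g : ℕ → α → ℝ≥0∞) :
    sqNorm (fun u => ∑' k, g k u) ≤ ∑' k, 2 ^ (k + 1) * sqNorm (g k) := by
  simp only [sqNorm, ← ENNReal.tsum_mul_left]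
  rw [ENNReal.tsum_comm]
  refine ENNReal.tsum_le_tsum fun u => ?_
  have h1 := (ENNReal.continuous_pow 2).continuousAt.tendsto.comp
    (ENNReal.tendsto_nat_tsum fun k => g k u)
  exact le_of_tendsto' h1 fun n => (sq_sum_range_le _ n).trans (ENNReal.sum_le_tsum _)

theorem sqNorm_add_le {α : Type*} (f g : α → ℝ≥0∞) :
    sqNorm (fun u => f u + g u) ≤ 2 * sqNorm f + 2 * sqNorm g := by
  simp only [sqNorm, ← ENNReal.tsum_mul_left]
  rw [← ENNReal.tsum_add]
  refine ENNReal.tsum_le_tsum fun u => ?_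
  calc (f u + g u) ^ 2 = f u ^ 2 + g u ^ 2 + 2 * f u * g u := by ring
    _ ≤ f u ^ 2 + g u ^ 2 + (f u ^ 2 + g u ^ 2) := by gcongr; exact two_mul_mul_le _ _
    _ = _ := by ring

/-- Expected number of edges of all colours joining `u` to a vertex weighted by `f`. -/
def walkStep (w : ℕ → Γ → ℝ≥0∞) (f : Γ → ℝ≥0∞) (u : Γ) : ℝ≥0∞ :=
  ∑' k, (avg (w k) f u + avgInv (w k) f u)

open Classical in
/-- Weighted count of walks with `n` steps. -/
def walkWeight (w : ℕ → Γ → ℝ≥0∞) : ℕ → Γ → Γ → ℝ≥0∞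
  | 0, u, v => if u = v then 1 else 0
  | n + 1, u, v => walkStep w (fun x => walkWeight w n x v) u

/-- Weighted count of all walks. -/
def green (w : ℕ → Γ → ℝ≥0∞) (u v : Γ) : ℝ≥0∞ := ∑' n, walkWeight w n u v

/-- The edge weights contract fast enough for the percolation below to be subcritical. -/
def Subcritical (w : ℕ → Γ → ℝ≥0∞) : Prop := ∀ k, Contracts (w k) (2⁻¹ ^ (2 * k + 17))

theorem exists_subcritical (hna : ¬ IsAmenable Γ) : ∃ w : ℕ → Γ → ℝ≥0∞, Subcritical w := by
  choose w hw using fun k : ℕ => exists_contracts_small hna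
    (ε := 2⁻¹ ^ (2 * k + 17)) (pow_ne_zero _ (ENNReal.inv_ne_zero.mpr ofNat_ne_top))
  exact ⟨w, hw⟩

theorem two_pow_mul_inv_two_pow (a b : ℕ) : (2 : ℝ≥0∞) ^ a * 2⁻¹ ^ (a + b) = 2⁻¹ ^ b := by
  rw [pow_add, ← mul_assoc, ← mul_pow, ENNReal.mul_inv_cancel two_ne_zero ofNat_ne_top, one_pow,
    one_mul]

theorem tsum_inv_two_pow : ∑' k : ℕ, (2⁻¹ : ℝ≥0∞) ^ k = 2 := by
  rw [ENNReal.tsum_geometric, ENNReal.one_sub_inv_two, inv_inv]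

namespace Subcritical

variable {w : ℕ → Γ → ℝ≥0∞}

theorem sqNorm_walkStep_le (hw : Subcritical w) (f : Γ → ℝ≥0∞) :
    sqNorm (walkStep w f) ≤ 2⁻¹ ^ 13 * sqNorm f := by
  refine (sqNorm_tsum_le _).trans ?_
  have h : ∀ k, 2 ^ (k + 1) * sqNorm (fun u => avg (w k) f u + avgInv (w k) f u) ≤
      (2⁻¹ ^ k) * (2⁻¹ ^ 14 * sqNorm f) := by
    intro k
    calc 2 ^ (k + 1) * sqNorm (fun u => avg (w k) f u + avgInv (w k) f u)
        ≤ 2 ^ (k + 1) * (2 * (2⁻¹ ^ (2 * k + 17) * sqNorm f) +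
          2 * (2⁻¹ ^ (2 * k + 17) * sqNorm f)) := by
          gcongr
          refine (sqNorm_add_le _ _).trans ?_
          gcongr
          · exact (hw k).avg_le f
          · exact (hw k).avgInv_le f
      _ = (2 ^ (k + 3) * 2⁻¹ ^ ((k + 3) + (k + 14))) * sqNorm f := by
          rw [show (k + 3) + (k + 14) = 2 * k + 17 by ring]; ring
      _ = (2⁻¹ ^ k) * (2⁻¹ ^ 14 * sqNorm f) := by
          rw [two_pow_mul_inv_two_pow, pow_add]; ring
  refine (ENNReal.tsum_le_tsum h).trans_eq ?_
  rw [ENNReal.tsum_mul_right, tsum_inv_two_pow, ← mul_assoc]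
  congr 1
  have := two_pow_mul_inv_two_pow 1 13
  simpa using this

theorem sqNorm_walkWeight_le (hw : Subcritical w) (n : ℕ) (v : Γ) :
    sqNorm (fun u => walkWeight w n u v) ≤ 2⁻¹ ^ (13 * n) := by
  induction n with
  | zero =>
    rw [sqNorm, tsum_eq_single v]
    · simp [walkWeight]
    · intro s hs; simp [walkWeight, hs]
  | succ n ih =>
    refine (hw.sqNorm_walkStep_le _).trans ?_
    rw [mul_add, pow_add, mul_comm]
    gcongr

theorem sqNorm_green_le (hw : Subcritical w) (v : Γ) : sqNorm (fun u => green w u v) ≤ 4 := by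
  refine (sqNorm_tsum_le _).trans ?_
  calc ∑' k, 2 ^ (k + 1) * sqNorm (fun u => walkWeight w k u v)
      ≤ ∑' k : ℕ, 2⁻¹ ^ k * 2 := by
        refine ENNReal.tsum_le_tsum fun k => ?_
        refine (mul_le_mul_right (hw.sqNorm_walkWeight_le k v) _).trans ?_
        calc (2 : ℝ≥0∞) ^ (k + 1) * 2⁻¹ ^ (13 * k)
            = 2 * (2 ^ k * 2⁻¹ ^ (k + (k + 11 * k))) := by
              rw [show k + (k + 11 * k) = 13 * k by ring]; ring
          _ = 2⁻¹ ^ k * 2 * 2⁻¹ ^ (11 * k) := by rw [two_pow_mul_inv_two_pow, pow_add]; ring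
          _ ≤ 2⁻¹ ^ k * 2 * 1 := by
              gcongr
              exact pow_le_one₀ zero_le (ENNReal.inv_le_one.mpr one_le_two)
          _ = _ := mul_one _
    _ = 4 := by rw [ENNReal.tsum_mul_right, tsum_inv_two_pow]; norm_num

theorem tendsto_green (hw : Subcritical w) (v : Γ) :
    Tendsto (fun u => green w u v) cofinite (𝓝 0) := by
  have h : Tendsto (fun u => green w u v ^ 2) cofinite (𝓝 0) :=
    ENNReal.tendsto_cofinite_zero_of_tsum_ne_top
      (ne_top_of_le_ne_top ofNat_ne_top (hw.sqNorm_green_le v))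
  rw [ENNReal.tendsto_nhds_zero] at h ⊢
  intro ε hε
  filter_upwards [h (ε ^ 2) (by positivity)] with u hu
  exact le_of_not_gt fun hlt => absurd hu (not_le.mpr (ENNReal.pow_lt_pow_left two_ne_zero hlt))

theorem sq_le (hw : Subcritical w) (k : ℕ) (s : Γ) : w k s ^ 2 ≤ 2⁻¹ ^ (2 * k + 17) :=
  (ENNReal.le_tsum (f := fun u => w k u ^ 2) s).trans (hw k).sqNorm_le

theorem tsum_mul_green_le (hw : Subcritical w) (k : ℕ) (v : Γ) :
    ∑' s, w k s * green w s v ≤ ENNReal.ofReal (1 / 100) := by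
  have h1 : 2 * (400 * ∑' s, w k s * green w s v) ≤ 2 * (400 * ENNReal.ofReal (1 / 100)) := by
    rw [← ENNReal.tsum_mul_left, ← ENNReal.tsum_mul_left]
    calc ∑' s, 2 * (400 * (w k s * green w s v))
        ≤ ∑' s, ((400 * w k s) ^ 2 + green w s v ^ 2) := by
          refine ENNReal.tsum_le_tsum fun s => ?_
          refine le_of_eq_of_le ?_ (two_mul_mul_le (400 * w k s) (green w s v))
          ring
      _ = 400 ^ 2 * sqNorm (w k) + sqNorm (fun s => green w s v) := by
          simp only [mul_pow]
          rw [ENNReal.tsum_add, ENNReal.tsum_mul_left]; rfl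
      _ ≤ 400 ^ 2 * 2⁻¹ ^ 17 + 4 := by
          gcongr
          · refine (hw k).sqNorm_le.trans ?_
            exact pow_le_pow_of_le_one zero_le (ENNReal.inv_le_one.mpr one_le_two) (by omega)
          · exact hw.sqNorm_green_le v
      _ ≤ 2 * (400 * ENNReal.ofReal (1 / 100)) := by
          rw [← ENNReal.ofReal_ofNat 2, ← ENNReal.ofReal_ofNat 400, ← ENNReal.ofReal_ofNat 4,
            ← ENNReal.ofReal_inv_of_pos two_pos, ← ENNReal.ofReal_pow (by norm_num),
            ← ENNReal.ofReal_pow (by norm_num), ← ENNReal.ofReal_mul (by norm_num),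
            ← ENNReal.ofReal_add (by norm_num) (by norm_num), ← ENNReal.ofReal_mul (by norm_num),
            ← ENNReal.ofReal_mul (by norm_num)]
          exact ENNReal.ofReal_le_ofReal (by norm_num)
  rw [← mul_assoc, ← mul_assoc] at h1
  exact (ENNReal.mul_le_mul_iff_right (by norm_num) (by finiteness)).mp h1

end Subcritical

end Green

section Graph

variable {Γ : Type*} [Group Γ]

/-- The terminal vertex of the edge `e`, which starts at `e.1` and has colour `e.2`, in the
configuration `ω`. -/
def tip (ω : Γ × ℕ → Γ) (e : Γ × ℕ) : Γ := e.1 * ω e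

/-- There is a walk with `n` steps from `u` to `v` along edges in `E` whose product of colours
is `m`. -/
def Walk (ω : Γ × ℕ → Γ) (E : Set (Γ × ℕ)) : ℕ → Γ → Γ → FreeGroup ℕ → Prop
  | 0, u, v, m => u = v ∧ m = 1
  | n + 1, u, v, m => ∃ e ∈ E,
      (e.1 = u ∧ Walk ω E n (tip ω e) v (m * (FreeGroup.of e.2)⁻¹)) ∨
      (tip ω e = u ∧ Walk ω E n e.1 v (m * FreeGroup.of e.2))

/-- `u` and `v` are connected along edges in `E`. -/
def Conn (ω : Γ × ℕ → Γ) (E : Set (Γ × ℕ)) (u v : Γ) : Prop := ∃ n m, Walk ω E n u v m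

variable {ω : Γ × ℕ → Γ} {E E' : Set (Γ × ℕ)} {n n' : ℕ} {u v x : Γ} {m m' : FreeGroup ℕ}

theorem Walk.mono (h : Walk ω E n u v m) (hE : E ⊆ E') : Walk ω E' n u v m := by
  induction n generalizing u m with
  | zero => exact h
  | succ n ih =>
    obtain ⟨e, he, ⟨h1, h2⟩ | ⟨h1, h2⟩⟩ := h
    · exact ⟨e, hE he, Or.inl ⟨h1, ih h2⟩⟩
    · exact ⟨e, hE he, Or.inr ⟨h1, ih h2⟩⟩

theorem Walk.trans (h : Walk ω E n u v m) (h' : Walk ω E n' v x m') :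
    Walk ω E (n + n') u x (m' * m) := by
  induction n generalizing u m with
  | zero =>
    obtain ⟨rfl, rfl⟩ := h
    simpa using h'
  | succ n ih =>
    rw [Nat.add_right_comm]
    obtain ⟨e, he, ⟨h1, h2⟩ | ⟨h1, h2⟩⟩ := h
    · exact ⟨e, he, Or.inl ⟨h1, by simpa only [mul_assoc] using ih h2⟩⟩
    · exact ⟨e, he, Or.inr ⟨h1, by simpa only [mul_assoc] using ih h2⟩⟩

theorem Walk.edge {e : Γ × ℕ} (he : e ∈ E) : Walk ω E 1 e.1 (tip ω e) (FreeGroup.of e.2) :=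
  ⟨e, he, Or.inl ⟨rfl, rfl, mul_inv_cancel _⟩⟩

theorem Walk.edge_symm {e : Γ × ℕ} (he : e ∈ E) :
    Walk ω E 1 (tip ω e) e.1 (FreeGroup.of e.2)⁻¹ :=
  ⟨e, he, Or.inr ⟨rfl, rfl, inv_mul_cancel _⟩⟩

theorem Walk.symm (h : Walk ω E n u v m) : Walk ω E n v u m⁻¹ := by
  induction n generalizing u m with
  | zero =>
    obtain ⟨rfl, rfl⟩ := h
    exact ⟨rfl, inv_one⟩
  | succ n ih =>
    obtain ⟨e, he, ⟨rfl, h2⟩ | ⟨rfl, h2⟩⟩ := h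
    · simpa using (ih h2).trans (Walk.edge_symm he)
    · simpa using (ih h2).trans (Walk.edge he)

theorem Walk.potential {H : Γ → FreeGroup ℕ} (hH : ∀ e ∈ E, H (tip ω e) = FreeGroup.of e.2 * H e.1)
    (h : Walk ω E n u v m) : H v = m * H u := by
  induction n generalizing u m with
  | zero =>
    obtain ⟨rfl, rfl⟩ := h
    simp
  | succ n ih =>
    obtain ⟨e, he, ⟨rfl, h2⟩ | ⟨rfl, h2⟩⟩ := h
    · rw [ih h2, hH e he]; group
    · rw [ih h2, hH e he]; group

theorem Walk.exists_finset (h : Walk ω E n u v m) :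
    ∃ S : Finset (Γ × ℕ), (S : Set (Γ × ℕ)) ⊆ E ∧ Walk ω S n u v m := by
  classical
  induction n generalizing u m with
  | zero => exact ⟨∅, by simp, h⟩
  | succ n ih =>
    obtain ⟨e, he, ⟨h1, h2⟩ | ⟨h1, h2⟩⟩ := h
    all_goals
      obtain ⟨S, hS, hw⟩ := ih h2
      refine ⟨insert e S, by simpa using Set.insert_subset he hS, e, by simp, ?_⟩
    · exact Or.inl ⟨h1, hw.mono (by simp)⟩
    · exact Or.inr ⟨h1, hw.mono (by simp)⟩

theorem Conn.refl (u : Γ) : Conn ω E u u := ⟨0, 1, rfl, rfl⟩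

theorem Conn.symm (h : Conn ω E u v) : Conn ω E v u :=
  let ⟨n, _, h⟩ := h
  ⟨n, _, h.symm⟩

theorem Conn.trans (h : Conn ω E u v) (h' : Conn ω E v x) : Conn ω E u x :=
  let ⟨_, _, h⟩ := h
  let ⟨_, _, h'⟩ := h'
  ⟨_, _, h.trans h'⟩

theorem Conn.mono (h : Conn ω E u v) (hE : E ⊆ E') : Conn ω E' u v :=
  let ⟨n, m, h⟩ := h
  ⟨n, m, h.mono hE⟩

theorem Conn.edge {e : Γ × ℕ} (he : e ∈ E) : Conn ω E e.1 (tip ω e) := ⟨_, _, Walk.edge he⟩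

/-- The edges whose end points are not connected by the other edges. -/
def bridges (ω : Γ × ℕ → Γ) : Set (Γ × ℕ) := {e | ¬ Conn ω {e}ᶜ (tip ω e) e.1}

theorem exists_potential (S : Finset (Γ × ℕ)) (hS : (S : Set (Γ × ℕ)) ⊆ bridges ω) :
    ∃ H : Γ → FreeGroup ℕ, ∀ e ∈ S, H (tip ω e) = FreeGroup.of e.2 * H e.1 := by
  classical
  induction S using Finset.induction_on with
  | empty => exact ⟨1, by simp⟩
  | insert e S he ih =>
    obtain ⟨H, hH⟩ := ih fun x hx => hS (by simp [Finset.mem_coe.mp hx])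
    set T : Set Γ := {v | Conn ω S (tip ω e) v}
    have htip : tip ω e ∈ T := Conn.refl _
    have hsrc : e.1 ∉ T := fun h =>
      hS (by simp) (h.mono (E' := {e}ᶜ) fun x hx hxe => he (by
        rw [Set.mem_singleton_iff] at hxe; exact hxe ▸ hx))
    refine ⟨fun v => if v ∈ T then H v * ((H (tip ω e))⁻¹ * FreeGroup.of e.2 * H e.1) else H v, ?_⟩
    intro e' he'
    rcases Finset.mem_insert.mp he' with rfl | he'
    · simp [htip, hsrc, ← mul_assoc]
    · by_cases h : e'.1 ∈ T
      · have h' : tip ω e' ∈ T := Conn.trans h (Conn.edge he')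
        simp only [h, h', if_true, hH e' he', mul_assoc]
      · have h' : tip ω e' ∉ T := fun h' => h (Conn.trans h' (Conn.edge he').symm)
        simp only [h, h', if_false, hH e' he']

theorem Walk.unique (h : Walk ω (bridges ω) n u v m) (h' : Walk ω (bridges ω) n' u v m') :
    m = m' := by
  classical
  obtain ⟨S, hS, hw⟩ := h.exists_finset
  obtain ⟨S', hS', hw'⟩ := h'.exists_finset
  obtain ⟨H, hH⟩ := exists_potential (ω := ω) (S ∪ S') (by simp [hS, hS'])
  have e1 := (hw.mono (E' := ↑(S ∪ S')) (by simp)).potential hH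
  have e2 := (hw'.mono (E' := ↑(S ∪ S')) (by simp)).potential hH
  exact mul_right_cancel (e1.symm.trans e2)

/-- The component of `u` in the forest of bridges contains `v`. -/
def Tree (ω : Γ × ℕ → Γ) (u v : Γ) : Prop := Conn ω (bridges ω) u v

open Classical in
/-- The product of the colours along a walk of bridges from `u` to `v`. -/
def colour (ω : Γ × ℕ → Γ) (u v : Γ) : FreeGroup ℕ :=
  if h : ∃ m n, Walk ω (bridges ω) n u v m then h.choose else 1

theorem colour_eq (h : Walk ω (bridges ω) n u v m) : colour ω u v = m := by
  have hex : ∃ m n, Walk ω (bridges ω) n u v m := ⟨m, n, h⟩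
  rw [colour, dif_pos hex]
  obtain ⟨n', h'⟩ := hex.choose_spec
  exact h'.unique h

theorem Tree.refl (u : Γ) : Tree ω u u := Conn.refl u

theorem Tree.symm (h : Tree ω u v) : Tree ω v u := Conn.symm h

theorem Tree.trans (h : Tree ω u v) (h' : Tree ω v x) : Tree ω u x := Conn.trans h h'

theorem Tree.exists_walk (h : Tree ω u v) : ∃ n, Walk ω (bridges ω) n u v (colour ω u v) := by
  obtain ⟨n, m, h⟩ := h
  exact ⟨n, by rwa [colour_eq h]⟩

theorem Tree.colour_mul (h : Tree ω u v) (h' : Tree ω v x) :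
    colour ω v x * colour ω u v = colour ω u x := by
  obtain ⟨n, hn⟩ := h.exists_walk
  obtain ⟨n', hn'⟩ := h'.exists_walk
  exact (colour_eq (hn.trans hn')).symm

theorem colour_edge {e : Γ × ℕ} (he : e ∈ bridges ω) :
    colour ω e.1 (tip ω e) = FreeGroup.of e.2 := colour_eq (Walk.edge he)

/-- The left translation action on configurations. -/
def shift (g : Γ) (ω : Γ × ℕ → Γ) : Γ × ℕ → Γ := fun e => ω (g⁻¹ * e.1, e.2)

theorem tip_shift (g : Γ) (e : Γ × ℕ) : tip (shift g ω) e = g * tip ω (g⁻¹ * e.1, e.2) := by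
  simp [tip, shift, mul_assoc]

theorem Walk.shift (g : Γ) (h : Walk ω {e | (g * e.1, e.2) ∈ E} n u v m) :
    Walk (shift g ω) E n (g * u) (g * v) m := by
  induction n generalizing u m with
  | zero =>
    obtain ⟨rfl, rfl⟩ := h
    exact ⟨rfl, rfl⟩
  | succ n ih =>
    obtain ⟨e, he, ⟨rfl, h2⟩ | ⟨rfl, h2⟩⟩ := h
    · exact ⟨_, he, Or.inl ⟨rfl, by simpa [tip_shift] using ih h2⟩⟩
    · exact ⟨_, he, Or.inr ⟨by simp [tip_shift], by simpa using ih h2⟩⟩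

theorem shift_mul (g h : Γ) (ω : Γ × ℕ → Γ) : shift (g * h) ω = shift g (shift h ω) := by
  funext e; simp [shift, mul_assoc]

theorem shift_one (ω : Γ × ℕ → Γ) : shift 1 ω = ω := by
  funext e; simp [shift]

theorem shift_inv_shift (g : Γ) (ω : Γ × ℕ → Γ) : shift g⁻¹ (shift g ω) = ω := by
  rw [← shift_mul, inv_mul_cancel, shift_one]

theorem conn_shift (g : Γ) :
    Conn (shift g ω) E (g * u) (g * v) ↔ Conn ω {e | (g * e.1, e.2) ∈ E} u v := by
  refine ⟨fun ⟨n, m, h⟩ => ⟨n, m, ?_⟩, fun ⟨n, m, h⟩ => ⟨n, m, h.shift g⟩⟩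
  have := Walk.shift (E := {e | (g * e.1, e.2) ∈ E}) g⁻¹ (ω := shift g ω) (u := g * u) (v := g * v)
    (n := n) (m := m) (by simpa using h)
  simpa [shift_inv_shift] using this

theorem mem_bridges_shift (g : Γ) (e : Γ × ℕ) :
    (g * e.1, e.2) ∈ bridges (shift g ω) ↔ e ∈ bridges ω := by
  simp only [bridges, mem_ofPred_eq, tip_shift, inv_mul_cancel_left, conn_shift]
  have : {e' : Γ × ℕ | (g * e'.1, e'.2) ∈ ({(g * e.1, e.2)}ᶜ : Set (Γ × ℕ))} = {e}ᶜ := by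
    ext e'
    simp [Prod.ext_iff]
  rw [this]

theorem preimage_bridges_shift (g : Γ) :
    {e : Γ × ℕ | (g * e.1, e.2) ∈ bridges (shift g ω)} = bridges ω := by
  ext e; exact mem_bridges_shift g e

theorem tree_shift (g : Γ) : Tree (shift g ω) (g * u) (g * v) ↔ Tree ω u v := by
  rw [Tree, conn_shift, preimage_bridges_shift, Tree]

theorem Tree.colour_shift (h : Tree ω u v) (g : Γ) :
    colour (shift g ω) (g * u) (g * v) = colour ω u v := by
  obtain ⟨n, h⟩ := h.exists_walk
  exact colour_eq (Walk.shift g (by rwa [preimage_bridges_shift]))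

/-- There is a walk with `n` steps from `u` to `v` using distinct edges outside `C`. -/
def Trail (ω : Γ × ℕ → Γ) [DecidableEq (Γ × ℕ)] : Finset (Γ × ℕ) → ℕ → Γ → Γ → Prop
  | _, 0, u, v => u = v
  | C, n + 1, u, v => ∃ e, e ∉ C ∧ ((e.1 = u ∧ Trail ω (insert e C) n (tip ω e) v) ∨
      (tip ω e = u ∧ Trail ω (insert e C) n e.1 v))

variable [DecidableEq (Γ × ℕ)]

theorem Trail.anti {C C' : Finset (Γ × ℕ)} (hC : C ⊆ C') (h : Trail ω C' n u v) :
    Trail ω C n u v := by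
  induction n generalizing u C C' with
  | zero => exact h
  | succ n ih =>
    obtain ⟨e, he, ⟨h1, h2⟩ | ⟨h1, h2⟩⟩ := h
    · exact ⟨e, fun h => he (hC h), Or.inl ⟨h1, ih (Finset.insert_subset_insert e hC) h2⟩⟩
    · exact ⟨e, fun h => he (hC h), Or.inr ⟨h1, ih (Finset.insert_subset_insert e hC) h2⟩⟩

theorem Walk.avoid {C : Finset (Γ × ℕ)} (e : Γ × ℕ) (h : Walk ω (C : Set (Γ × ℕ))ᶜ n u v m) :
    ∃ n' ≤ n, ∃ m' x, (x = u ∨ x = e.1 ∨ x = tip ω e) ∧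
      Walk ω (↑(insert e C) : Set (Γ × ℕ))ᶜ n' x v m' := by
  induction n generalizing u m with
  | zero => exact ⟨0, le_rfl, m, u, Or.inl rfl, h⟩
  | succ n ih =>
    have key : ∀ (e' : Γ × ℕ) (a b : Γ) (m₁ : FreeGroup ℕ) (m₂ : FreeGroup ℕ),
        (e' = e → b = e.1 ∨ b = tip ω e) →
        (e' ≠ e → Walk ω (↑(insert e C) : Set (Γ × ℕ))ᶜ 1 a b m₂) →
        Walk ω (C : Set (Γ × ℕ))ᶜ n b v m₁ → ∃ n' ≤ n + 1, ∃ m' x,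
        (x = a ∨ x = e.1 ∨ x = tip ω e) ∧
          Walk ω (↑(insert e C) : Set (Γ × ℕ))ᶜ n' x v m' := by
      intro e' a b m₁ m₂ h1 h2 hb
      obtain ⟨n', hn', m', x, hx, hw⟩ := ih hb
      rcases hx with rfl | hx
      · by_cases hee : e' = e
        · exact ⟨n', hn'.trans n.le_succ, m', _, Or.inr (h1 hee), hw⟩
        · exact ⟨1 + n', by omega, _, a, Or.inl rfl, (h2 hee).trans hw⟩
      · exact ⟨n', hn'.trans n.le_succ, m', x, Or.inr hx, hw⟩
    have hmem : ∀ e', e' ∈ (C : Set (Γ × ℕ))ᶜ → e' ≠ e → e' ∈ (↑(insert e C) : Set (Γ × ℕ))ᶜ := by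
      intro e' h1 h2
      simpa [h2] using h1
    obtain ⟨e', he', ⟨rfl, h2⟩ | ⟨rfl, h2⟩⟩ := h
    · exact key e' _ _ _ _ (fun h => Or.inr (h ▸ rfl)) (fun h => Walk.edge (hmem _ he' h)) h2
    · exact key e' _ _ _ _ (fun h => Or.inl (h ▸ rfl)) (fun h => Walk.edge_symm (hmem _ he' h)) h2

theorem Walk.exists_trail {C : Finset (Γ × ℕ)} (h : Walk ω (C : Set (Γ × ℕ))ᶜ n u v m) :
    ∃ k, Trail ω C k u v := by
  induction n using Nat.strong_induction_on generalizing u m C with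
  | _ n ih =>
    rcases n with _ | n
    · exact ⟨0, h.1⟩
    · have key : ∀ (e : Γ × ℕ) (a b : Γ) (m₁ : FreeGroup ℕ), e ∉ C →
          (e.1 = a ∧ tip ω e = b ∨ tip ω e = a ∧ e.1 = b) →
          Walk ω (C : Set (Γ × ℕ))ᶜ n b v m₁ → ∃ k, Trail ω C k a v := by
        intro e a b m₁ he hab hb
        obtain ⟨n', hn', m', x, hx, hw⟩ := hb.avoid e
        obtain ⟨k, hk⟩ := ih n' (by omega) hw
        have hx' : x = a ∨ x = b := by
          rcases hab with ⟨rfl, rfl⟩ | ⟨rfl, rfl⟩ <;> tauto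
        rcases hx' with rfl | rfl
        · exact ⟨k, hk.anti (Finset.subset_insert _ _)⟩
        · rcases hab with ⟨h1, rfl⟩ | ⟨h1, rfl⟩
          · exact ⟨k + 1, e, he, Or.inl ⟨h1, hk⟩⟩
          · exact ⟨k + 1, e, he, Or.inr ⟨h1, hk⟩⟩
      obtain ⟨e, he, ⟨h1, h2⟩ | ⟨h1, h2⟩⟩ := h
      · exact key e u _ _ (by simpa using he) (Or.inl ⟨h1, rfl⟩) h2
      · exact key e u _ _ (by simpa using he) (Or.inr ⟨h1, rfl⟩) h2

end Graph

section Percolation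

variable {Γ : Type*} [Group Γ]

instance : Countable (FreeGroup ℕ) := Quotient.countable

instance : MeasurableSpace (FreeGroup ℕ) := ⊤

instance : DiscreteMeasurableSpace (FreeGroup ℕ) := ⟨fun _ => trivial⟩

theorem measurableSet_of_countable_value {Ω α : Type*} [MeasurableSpace Ω] [Countable α]
    [MeasurableSpace α] [DiscreteMeasurableSpace α] {h : Ω → α} (hh : Measurable h)
    {p : Ω → α → Prop} (hp : ∀ x, MeasurableSet {ω | p ω x}) : MeasurableSet {ω | p ω (h ω)} := by
  have : {ω | p ω (h ω)} = ⋃ x, {ω | h ω = x} ∩ {ω | p ω x} := by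
    ext ω; simp
  rw [this]
  exact MeasurableSet.iUnion fun x => (hh (measurableSet_singleton x)).inter (hp x)

theorem measurable_of_countable_fibres {Ω α : Type*} [MeasurableSpace Ω] [Countable α]
    [MeasurableSpace α] {h : Ω → α} (hh : ∀ x, MeasurableSet {ω | h ω = x}) : Measurable h :=
  measurable_to_countable' hh

section Measurability

variable [Countable Γ] [MeasurableSpace Γ] [DiscreteMeasurableSpace Γ]

omit [Countable Γ] in
theorem measurable_tip (e : Γ × ℕ) : Measurable fun ω : Γ × ℕ → Γ => tip ω e :=
  (Measurable.of_discrete (f := fun x : Γ => e.1 * x)).comp (measurable_pi_apply e)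

theorem measurableSet_walk {E : (Γ × ℕ → Γ) → Set (Γ × ℕ)}
    (hE : ∀ e, MeasurableSet {ω | e ∈ E ω}) (n : ℕ) (u v : Γ) (m : FreeGroup ℕ) :
    MeasurableSet {ω | Walk ω (E ω) n u v m} := by
  induction n generalizing u m with
  | zero => exact MeasurableSet.const _
  | succ n ih =>
    simp only [Walk, ofPred_exists, ofPred_and, ofPred_or]
    refine MeasurableSet.iUnion fun e => (hE e).inter (.union (.inter (.const _) ?_) (.inter ?_ (ih _ _)))
    · exact measurableSet_of_countable_value (measurable_tip e) fun x => ih x _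
    · exact measurable_tip e (measurableSet_singleton u)

theorem measurableSet_conn {E : (Γ × ℕ → Γ) → Set (Γ × ℕ)}
    (hE : ∀ e, MeasurableSet {ω | e ∈ E ω}) (u v : Γ) :
    MeasurableSet {ω | Conn ω (E ω) u v} := by
  simp only [Conn, ofPred_exists]
  exact MeasurableSet.iUnion fun n => MeasurableSet.iUnion fun m => measurableSet_walk hE n u v m

theorem measurableSet_bridge (e : Γ × ℕ) : MeasurableSet {ω | e ∈ bridges ω} :=
  (measurableSet_of_countable_value (measurable_tip e) fun x =>
    measurableSet_conn (E := fun _ => {e}ᶜ) (fun _ => .const _) x e.1).compl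

theorem measurableSet_tree (u v : Γ) : MeasurableSet {ω | Tree ω u v} :=
  measurableSet_conn measurableSet_bridge u v

theorem measurable_colour (u v : Γ) : Measurable fun ω : Γ × ℕ → Γ => colour ω u v := by
  refine measurable_of_countable_fibres fun m => ?_
  have : {ω : Γ × ℕ → Γ | colour ω u v = m} = (⋃ n, {ω | Walk ω (bridges ω) n u v m}) ∪
      ({ω | Tree ω u v}ᶜ ∩ {_ω | m = 1}) := by
    ext ω
    simp only [mem_union, mem_iUnion, mem_inter_iff, mem_compl_iff, mem_ofPred_eq]
    constructor
    · rintro rfl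
      by_cases h : Tree ω u v
      · exact Or.inl h.exists_walk
      · refine Or.inr ⟨h, dif_neg fun ⟨m, n, h'⟩ => h ⟨n, m, h'⟩⟩
    · rintro (⟨n, h⟩ | ⟨h, rfl⟩)
      · exact colour_eq h
      · exact dif_neg fun ⟨m, n, h'⟩ => h ⟨n, m, h'⟩
  rw [this]
  exact (MeasurableSet.iUnion fun n => measurableSet_walk measurableSet_bridge n u v m).union
    ((measurableSet_tree u v).compl.inter (.const _))

end Measurability

section Root

variable [Countable Γ]

/-- An injection of `Γ` into `ℕ`. -/
def rank (γ : Γ) : ℕ := (exists_injective_nat Γ).choose γ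

omit [Group Γ] in
theorem rank_injective : Function.Injective (rank : Γ → ℕ) := (exists_injective_nat Γ).choose_spec

theorem exists_root (ω : Γ × ℕ → Γ) (γ : Γ) :
    ∃ δ, Tree ω δ γ ∧ ∀ ε, Tree ω ε γ → rank δ ≤ rank ε := by
  obtain ⟨δ, hδ, h⟩ := WellFounded.has_min (measure (rank : Γ → ℕ)).wf {δ | Tree ω δ γ}
    ⟨γ, Tree.refl γ⟩
  exact ⟨δ, hδ, fun ε hε => not_lt.mp (h ε hε)⟩

/-- The vertex of least rank in the tree of `γ`. -/
def root (ω : Γ × ℕ → Γ) (γ : Γ) : Γ := (exists_root ω γ).choose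

/-- `r` assigns to each vertex a vertex of its tree, depending only on the tree. -/
structure IsSelection (ω : Γ × ℕ → Γ) (r : Γ → Γ) : Prop where
  tree : ∀ γ, Tree ω (r γ) γ
  eq_of_tree : ∀ γ γ', Tree ω γ γ' → r γ = r γ'

theorem root_eq_iff {ω : Γ × ℕ → Γ} {γ δ : Γ} :
    root ω γ = δ ↔ Tree ω δ γ ∧ ∀ ε, Tree ω ε γ → rank δ ≤ rank ε := by
  have hs := (exists_root ω γ).choose_spec
  refine ⟨fun h => h ▸ hs, fun h => rank_injective (le_antisymm (hs.2 _ h.1) (h.2 _ hs.1))⟩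

theorem isSelection_root (ω : Γ × ℕ → Γ) : IsSelection ω (root ω) where
  tree γ := (root_eq_iff.mp rfl).1
  eq_of_tree γ γ' h := by
    have hs := root_eq_iff.mp (rfl : root ω γ' = _)
    exact root_eq_iff.mpr ⟨hs.1.trans h.symm, fun ε hε => hs.2 _ (hε.trans h)⟩

theorem measurable_root [MeasurableSpace Γ] [DiscreteMeasurableSpace Γ] (γ : Γ) :
    Measurable fun ω : Γ × ℕ → Γ => root ω γ := by
  refine measurable_of_countable_fibres fun δ => ?_
  simp only [root_eq_iff, ofPred_and, ofPred_forall]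
  refine (measurableSet_tree _ _).inter (MeasurableSet.iInter fun ε => ?_)
  exact (measurableSet_tree ε γ).imp (.const _)

omit [Countable Γ] in
theorem IsSelection.conj {ω : Γ × ℕ → Γ} {r : Γ → Γ} (h : IsSelection ω r) (g : Γ) :
    IsSelection (shift g ω) fun γ => g * r (g⁻¹ * γ) where
  tree γ := by
    have := (tree_shift g).mpr (h.tree (g⁻¹ * γ))
    simpa using this
  eq_of_tree γ γ' hγ := by
    rw [h.eq_of_tree (g⁻¹ * γ) (g⁻¹ * γ') ((tree_shift g).mp (by simpa using hγ))]

end Root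

section Bounds

variable [Countable Γ] [MeasurableSpace Γ] [DiscreteMeasurableSpace Γ]

/-- The law of a configuration with independent edges. -/
def perc (w : ℕ → PMF Γ) : Measure (Γ × ℕ → Γ) :=
  Measure.infinitePi fun e : Γ × ℕ => (w e.2).toMeasure

variable (w : ℕ → PMF Γ)

instance : IsProbabilityMeasure (perc w) := by unfold perc; infer_instance

omit [Group Γ] in
theorem perc_cylinder (C : Finset (Γ × ℕ)) (c : Γ × ℕ → Γ) :
    perc w {ω | ∀ e ∈ C, ω e = c e} = ∏ e ∈ C, w e.2 (c e) := by
  have : {ω : Γ × ℕ → Γ | ∀ e ∈ C, ω e = c e} = Set.pi C fun e => {c e} := by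
    ext ω; simp [Set.mem_pi]
  rw [this, perc, Measure.infinitePi_pi _ fun e _ => measurableSet_singleton _]
  exact Finset.prod_congr rfl fun e _ => PMF.toMeasure_apply_singleton _ _ (measurableSet_singleton _)

omit [Group Γ] in
theorem perc_edge (e : Γ × ℕ) (s : Γ) : perc w {ω | ω e = s} = w e.2 s := by
  have := perc_cylinder w {e} fun _ => s
  simpa using this

theorem perc_trail_le [DecidableEq (Γ × ℕ)] (C : Finset (Γ × ℕ)) (c : Γ × ℕ → Γ) (n : ℕ) (u v : Γ) :
    perc w ({ω | ∀ e ∈ C, ω e = c e} ∩ {ω | Trail ω C n u v}) ≤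
      (∏ e ∈ C, w e.2 (c e)) * walkWeight (fun k => w k) n u v := by
  classical
  induction n generalizing C c u with
  | zero =>
    by_cases h : u = v
    · simp only [walkWeight, h, if_true, mul_one]
      exact (measure_mono inter_subset_left).trans (perc_cylinder w C c).le
    · simp [walkWeight, h, Trail]
  | succ n ih =>
    have hstep : ∀ (e : Γ × ℕ) (s b : Γ), e ∉ C →
        perc w ({ω | ∀ e' ∈ C, ω e' = c e'} ∩ {ω | ω e = s ∧ Trail ω (insert e C) n b v}) ≤
        (∏ e ∈ C, w e.2 (c e)) * (w e.2 s * walkWeight (fun k => w k) n b v) := by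
      intro e s b he
      have hne : ∀ e' ∈ C, e' ≠ e := fun e' he' h => he (h ▸ he')
      have h := ih (insert e C) (Function.update c e s) b
      rw [Finset.prod_insert he, Function.update_self, Finset.prod_congr rfl (g := fun e => w e.2 (c e))
        fun e' he' => by rw [Function.update_of_ne (hne e' he')], mul_comm (w e.2 s),
        mul_assoc] at h
      refine (measure_mono ?_).trans h
      rintro ω ⟨h1, h2, h3⟩
      refine ⟨fun e' he' => ?_, h3⟩
      rcases Finset.mem_insert.mp he' with rfl | he'
      · simpa using h2
      · rw [Function.update_of_ne (hne e' he')]; exact h1 e' he'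
    have hsub : ({ω | ∀ e ∈ C, ω e = c e} ∩ {ω | Trail ω C (n + 1) u v}) ⊆
        ⋃ k : ℕ, ⋃ s : Γ, (⋃ (_ : (u, k) ∉ C), {ω | ∀ e ∈ C, ω e = c e} ∩
            {ω | ω (u, k) = s ∧ Trail ω (insert (u, k) C) n (u * s) v}) ∪
          (⋃ (_ : (u * s⁻¹, k) ∉ C), {ω | ∀ e ∈ C, ω e = c e} ∩
            {ω | ω (u * s⁻¹, k) = s ∧ Trail ω (insert (u * s⁻¹, k) C) n (u * s⁻¹) v}) := by
      rintro ω ⟨h1, ⟨x, k⟩, he, ⟨rfl, h2⟩ | ⟨h3, h2⟩⟩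
      · simp only [mem_iUnion]
        exact ⟨k, ω (x, k), Or.inl (mem_iUnion.mpr ⟨he, h1, rfl, h2⟩)⟩
      · simp only [mem_iUnion]
        have hx : u * (ω (x, k))⁻¹ = x := by rw [← h3, tip]; simp
        refine ⟨k, ω (x, k), Or.inr (mem_iUnion.mpr ⟨by rwa [hx], h1, ?_⟩)⟩
        rw [hx]
        exact ⟨rfl, h2⟩
    refine (measure_mono hsub).trans ((measure_iUnion_le _).trans ?_)
    rw [walkWeight, walkStep, ← ENNReal.tsum_mul_left]
    refine ENNReal.tsum_le_tsum fun k => (measure_iUnion_le _).trans ?_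
    rw [avg, avgInv, ← ENNReal.tsum_add, ← ENNReal.tsum_mul_left]
    refine ENNReal.tsum_le_tsum fun s => (measure_union_le _ _).trans ?_
    rw [mul_add]
    refine add_le_add ?_ ?_
    · by_cases h : (u, k) ∉ C
      · simpa [h] using hstep (u, k) s (u * s) h
      · simp [h]
    · by_cases h : (u * s⁻¹, k) ∉ C
      · simpa [h] using hstep (u * s⁻¹, k) s (u * s⁻¹) h
      · simp [h]

theorem perc_cylinder_conn_le (C : Finset (Γ × ℕ)) (c : Γ × ℕ → Γ) (u v : Γ) :
    perc w ({ω | ∀ e ∈ C, ω e = c e} ∩ {ω | Conn ω (C : Set (Γ × ℕ))ᶜ u v}) ≤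
      (∏ e ∈ C, w e.2 (c e)) * green (fun k => w k) u v := by
  classical
  rw [green, ← ENNReal.tsum_mul_left]
  refine le_trans (measure_mono ?_) ((measure_iUnion_le _).trans
    (ENNReal.tsum_le_tsum fun n => perc_trail_le w C c n u v))
  rintro ω ⟨h1, n, m, h2⟩
  obtain ⟨k, hk⟩ := h2.exists_trail
  exact mem_iUnion.mpr ⟨k, h1, hk⟩

theorem perc_tree_le (u v : Γ) : perc w {ω | Tree ω u v} ≤ green (fun k => w k) u v := by
  have := perc_cylinder_conn_le w ∅ (fun _ => 1) u v
  simp only [Finset.notMem_empty, false_imp_iff, implies_true, Finset.prod_empty, one_mul] at this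
  refine (measure_mono fun ω hω => ?_).trans this
  exact ⟨trivial, Conn.mono hω (by simp)⟩

theorem perc_not_bridge_le (k : ℕ) :
    perc w {ω | (1, k) ∉ bridges ω} ≤ ∑' s, w k s * green (fun k => w k) s 1 := by
  have hsub : {ω : Γ × ℕ → Γ | (1, k) ∉ bridges ω} ⊆ ⋃ s : Γ,
      ({ω | ∀ e ∈ ({((1 : Γ), k)} : Finset (Γ × ℕ)), ω e = s} ∩
        {ω | Conn ω (({((1 : Γ), k)} : Finset (Γ × ℕ)) : Set (Γ × ℕ))ᶜ s 1}) := by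
    intro ω hω
    refine mem_iUnion.mpr ⟨ω (1, k), by simp, ?_⟩
    simpa [bridges, tip] using hω
  refine (measure_mono hsub).trans ((measure_iUnion_le _).trans (ENNReal.tsum_le_tsum fun s => ?_))
  simpa using perc_cylinder_conn_le w {((1 : Γ), k)} (fun _ => s) s 1

variable {w}

theorem perc_not_bridge_le_of_subcritical (hw : Subcritical fun k => ⇑(w k)) (k : ℕ) :
    perc w {ω | (1, k) ∉ bridges ω} ≤ ENNReal.ofReal (1 / 100) :=
  (perc_not_bridge_le w k).trans (hw.tsum_mul_green_le k 1)

end Bounds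

end Percolation

section Spread

variable {Γ : Type*} [Group Γ] {K : Type*} [MulAction (FreeGroup ℕ) K]

/-- The labelling obtained by transporting the labels `V` of the selected vertices along the trees
of bridges, where crossing an edge of colour `k` acts as `h (of k)`. -/
def spread (h : FreeGroup ℕ →* FreeGroup ℕ) (ω : Γ × ℕ → Γ) (r : Γ → Γ) (V : Γ → K) : Γ → K :=
  fun γ => h (colour ω (r γ) γ) • V (r γ)

theorem spread_eq_of_tree (h : FreeGroup ℕ →* FreeGroup ℕ) {ω : Γ × ℕ → Γ} {r : Γ → Γ}
    (hr : IsSelection ω r) (V : Γ → K) {u v : Γ} (huv : Tree ω u v) :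
    spread h ω r V v = h (colour ω u v) • spread h ω r V u := by
  rw [spread, spread, smul_smul, ← map_mul, ← hr.eq_of_tree u v huv,
    Tree.colour_mul (hr.tree u) huv]

theorem spread_conj (h : FreeGroup ℕ →* FreeGroup ℕ) {ω : Γ × ℕ → Γ} {r : Γ → Γ}
    (hr : IsSelection ω r) (V : Γ → K) (g : Γ) :
    (fun γ => spread h ω r V (g⁻¹ * γ)) =
      spread h (shift g ω) (fun γ => g * r (g⁻¹ * γ)) fun γ => V (g⁻¹ * γ) := by
  funext γ
  have := (hr.tree (g⁻¹ * γ)).colour_shift g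
  rw [mul_inv_cancel_left] at this
  simp only [spread, this, inv_mul_cancel_left]

variable [MeasurableSpace K]

/-- The law of independent labels of the vertices. -/
def bern (Γ : Type*) (κ : Measure K) : Measure (Γ → K) := Measure.infinitePi fun _ => κ

variable (κ : Measure K) [IsProbabilityMeasure κ]

instance : IsProbabilityMeasure (bern Γ κ) := by unfold bern; infer_instance

omit [Group Γ] [MulAction (FreeGroup ℕ) K] in
theorem bern_map_precomp {Δ : Type*} {f : Δ → Γ} (hf : Function.Injective f) :
    (bern Γ κ).map (fun V δ => V (f δ)) = bern Δ κ :=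
  Measure.map_infinitePi_infinitePi_of_inj (P := fun _ => κ) hf

variable [MeasurableConstSMul (FreeGroup ℕ) K]

theorem measurable_spread (h : FreeGroup ℕ →* FreeGroup ℕ) (ω : Γ × ℕ → Γ) (r : Γ → Γ) :
    Measurable (spread h ω r : (Γ → K) → Γ → K) :=
  measurable_pi_lambda _ fun γ => (measurable_pi_apply (r γ)).const_smul _

variable [SMulInvariantMeasure (FreeGroup ℕ) K κ]

/-- The law of the transported labels does not depend on the selection. -/
theorem bern_map_spread_eq (h : FreeGroup ℕ →* FreeGroup ℕ) {ω : Γ × ℕ → Γ} {r r' : Γ → Γ}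
    (hr : IsSelection ω r) (hr' : IsSelection ω r') :
    (bern Γ κ).map (spread h ω r) = (bern Γ κ).map (spread h ω r') := by
  let G : (range r' → K) → Γ → K := fun Z γ => h (colour ω (r' γ) γ) • Z ⟨r' γ, γ, rfl⟩
  have hG : Measurable G :=
    measurable_pi_lambda _ fun γ => (measurable_pi_apply _).const_smul _
  have hinj : Function.Injective fun δ : range r' => r δ := by
    rintro ⟨_, γ, rfl⟩ ⟨_, γ', rfl⟩ hδ
    have ht : Tree ω γ γ' := by
      refine (hr'.tree γ).symm.trans (((hr.tree (r' γ)).symm).trans ?_)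
      have := hr.tree (r' γ')
      simp only at hδ
      rw [hδ]
      exact this.trans (hr'.tree γ')
    exact Subtype.ext (hr'.eq_of_tree _ _ ht)
  have e1 : spread h ω r = G ∘ (fun Z (δ : range r') => h (colour ω (r δ) δ) • Z δ) ∘
      fun (V : Γ → K) (δ : range r') => V (r δ) := by
    funext V γ
    have h1 := hr'.tree γ
    simp only [Function.comp_apply, G, spread]
    rw [smul_smul, ← map_mul, Tree.colour_mul (hr.tree _) h1, hr.eq_of_tree _ _ h1]
  have e2 : spread h ω r' = G ∘ fun (V : Γ → K) (δ : range r') => V δ := rfl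
  have m1 : Measurable fun (V : Γ → K) (δ : range r') => V (r δ) :=
    measurable_pi_lambda _ fun _ => measurable_pi_apply _
  have m2 : Measurable fun (Z : range r' → K) (δ : range r') => h (colour ω (r δ) δ) • Z δ :=
    measurable_pi_lambda _ fun _ => (measurable_pi_apply _).const_smul _
  have m3 : Measurable fun (V : Γ → K) (δ : range r') => V δ :=
    measurable_pi_lambda _ fun _ => measurable_pi_apply _
  rw [e1, e2, ← Measure.map_map hG (m2.comp m1), ← Measure.map_map m2 m1, ← Measure.map_map hG m3]
  congr 1
  have b1 : (bern Γ κ).map (fun (V : Γ → K) (δ : range r') => V (r δ)) = bern (range r') κ :=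
    bern_map_precomp κ hinj
  have b2 : (bern Γ κ).map (fun (V : Γ → K) (δ : range r') => V δ) = bern (range r') κ :=
    bern_map_precomp κ Subtype.val_injective
  rw [b1, b2, bern, Measure.infinitePi_map_pi (fun _ => κ) fun δ => measurable_const_smul _]
  congr 1
  funext δ
  exact (measurePreserving_smul _ κ).map_eq

end Spread

section Law

variable {Γ : Type*} [Group Γ] [Countable Γ] [MeasurableSpace Γ] [DiscreteMeasurableSpace Γ]
  {K : Type*} [MulAction (FreeGroup ℕ) K] [MeasurableSpace K] [MeasurableConstSMul (FreeGroup ℕ) K]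

variable (Γ K) in
/-- Edge configurations together with labellings of the vertices. -/
abbrev Config := (Γ × ℕ → Γ) × (Γ → K)

/-- The translation action on configurations. -/
def translate (g : Γ) (x : Config Γ K) : Config Γ K := (shift g x.1, fun γ => x.2 (g⁻¹ * γ))

omit [Countable Γ] [DiscreteMeasurableSpace Γ] [MulAction (FreeGroup ℕ) K]
  [MeasurableConstSMul (FreeGroup ℕ) K] in
theorem measurable_shift (g : Γ) : Measurable (shift g : (Γ × ℕ → Γ) → _) :=
  measurable_pi_lambda _ fun _ => measurable_pi_apply _

omit [Countable Γ] [DiscreteMeasurableSpace Γ] [MulAction (FreeGroup ℕ) K]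
  [MeasurableConstSMul (FreeGroup ℕ) K] in
theorem measurable_translate (g : Γ) : Measurable (translate g : Config Γ K → _) :=
  ((measurable_shift g).comp measurable_fst).prodMk
    (measurable_pi_lambda _ fun _ => (measurable_pi_apply _).comp measurable_snd)

/-- The map spreading the labels of the roots. -/
def rootSpread (h : FreeGroup ℕ →* FreeGroup ℕ) (x : Config Γ K) : Config Γ K :=
  (x.1, spread h x.1 (root x.1) x.2)

theorem measurable_smul_apply {Ω Δ : Type*} [MeasurableSpace Ω] [Countable Δ] [MeasurableSpace Δ]
    [DiscreteMeasurableSpace Δ] {c : Ω → FreeGroup ℕ} {ρ : Ω → Δ} (hc : Measurable c)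
    (hρ : Measurable ρ) {V : Ω → Δ → K} (hV : Measurable V) :
    Measurable fun ω => c ω • V ω (ρ ω) := by
  have h1 : Measurable fun p : (Δ → K) × (FreeGroup ℕ × Δ) => p.2.1 • p.1 p.2.2 :=
    measurable_from_prod_countable_left fun y => (measurable_pi_apply y.2).const_smul y.1
  exact h1.comp (hV.prodMk (hc.prodMk hρ))

theorem measurable_colour_root (γ : Γ) :
    Measurable fun ω : Γ × ℕ → Γ => colour ω (root ω γ) γ := by
  have h1 : Measurable fun p : (Γ × ℕ → Γ) × Γ => colour p.1 p.2 γ :=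
    measurable_from_prod_countable_left fun y => measurable_colour y γ
  exact h1.comp (measurable_id.prodMk (measurable_root γ))

theorem measurable_rootSpread (h : FreeGroup ℕ →* FreeGroup ℕ) :
    Measurable (rootSpread h : Config Γ K → _) := by
  refine measurable_fst.prodMk (measurable_pi_lambda _ fun γ => ?_)
  have hh : Measurable fun m : FreeGroup ℕ => h m := measurable_from_top
  exact measurable_smul_apply (hh.comp ((measurable_colour_root γ).comp measurable_fst))
    ((measurable_root γ).comp measurable_fst) measurable_snd

variable (w : ℕ → PMF Γ) (κ : Measure K) [IsProbabilityMeasure κ]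

/-- The law of an edge configuration with labels spread along the trees of bridges. -/
def law (h : FreeGroup ℕ →* FreeGroup ℕ) : Measure (Config Γ K) :=
  ((perc w).prod (bern Γ κ)).map (rootSpread h)

instance (h : FreeGroup ℕ →* FreeGroup ℕ) : IsProbabilityMeasure (law w κ h) :=
  Measure.isProbabilityMeasure_map (measurable_rootSpread h).aemeasurable

theorem law_apply (h : FreeGroup ℕ →* FreeGroup ℕ) {s : Set (Config Γ K)} (hs : MeasurableSet s) :
    law w κ h s = ∫⁻ ω, bern Γ κ {V | (ω, spread h ω (root ω) V) ∈ s} ∂perc w := by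
  rw [law, Measure.map_apply (measurable_rootSpread h) hs,
    Measure.prod_apply (measurable_rootSpread h hs)]
  rfl

theorem law_map_fst (h : FreeGroup ℕ →* FreeGroup ℕ) : (law w κ h).map Prod.fst = perc w := by
  rw [law, Measure.map_map measurable_fst (measurable_rootSpread h)]
  exact Measure.map_fst_prod.trans (by simp)

omit [Countable Γ] [DiscreteMeasurableSpace Γ] in
theorem perc_map_shift (g : Γ) : (perc w).map (shift g) = perc w := by
  have hinj : Function.Injective fun e : Γ × ℕ => (g⁻¹ * e.1, e.2) := by
    rintro ⟨a, k⟩ ⟨b, l⟩ h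
    simpa using h
  exact Measure.map_infinitePi_infinitePi_of_inj (P := fun e : Γ × ℕ => (w e.2).toMeasure) hinj

theorem law_map_translate [SMulInvariantMeasure (FreeGroup ℕ) K κ]
    (h : FreeGroup ℕ →* FreeGroup ℕ) (g : Γ) :
    (law w κ h).map (translate g) = law w κ h := by
  ext s hs
  rw [Measure.map_apply (measurable_translate g) hs, law_apply w κ h (measurable_translate g hs),
    law_apply w κ h hs]
  have key : ∀ ω : Γ × ℕ → Γ,
      bern Γ κ {V | (ω, spread h ω (root ω) V) ∈ translate g ⁻¹' s} =
      bern Γ κ {V | (shift g ω, spread h (shift g ω) (root (shift g ω)) V) ∈ s} := by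
    intro ω
    have hs' : MeasurableSet {f : Γ → K | (shift g ω, f) ∈ s} := measurable_prodMk_left hs
    have m0 : Measurable fun (V : Γ → K) γ => V (g⁻¹ * γ) :=
      measurable_pi_lambda _ fun _ => measurable_pi_apply _
    have e1 : {V : Γ → K | (ω, spread h ω (root ω) V) ∈ translate g ⁻¹' s} =
        (fun (V : Γ → K) γ => V (g⁻¹ * γ)) ⁻¹'
          (spread h (shift g ω) (fun γ => g * root ω (g⁻¹ * γ)) ⁻¹' {f | (shift g ω, f) ∈ s}) := by
      ext V
      simp only [mem_preimage, mem_ofPred_eq, ← spread_conj h (isSelection_root ω) V g]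
      rfl
    have m1 := measurable_spread (K := K) h (shift g ω) fun γ => g * root ω (g⁻¹ * γ)
    have m2 := measurable_spread (K := K) h (shift g ω) (root (shift g ω))
    rw [e1, ← Measure.map_apply m0 (m1 hs'), bern_map_precomp κ (mul_right_injective g⁻¹),
      ← Measure.map_apply m1 hs',
      bern_map_spread_eq κ h ((isSelection_root ω).conj g) (isSelection_root _),
      Measure.map_apply m2 hs']
    rfl
  simp_rw [key]
  have hF : Measurable fun ω : Γ × ℕ → Γ => bern Γ κ {V | (ω, spread h ω (root ω) V) ∈ s} :=
    measurable_measure_prodMk_left (measurable_rootSpread h hs)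
  conv_rhs => rw [← perc_map_shift w g, lintegral_map hF (measurable_shift g)]

/-- The equivalence of configurations changing the transport of labels from the trivial one. -/
def retwist (h : FreeGroup ℕ →* FreeGroup ℕ) : Config Γ K ≃ᵐ Config Γ K where
  toFun x := (x.1, fun γ => h (colour x.1 (root x.1 γ) γ) • x.2 γ)
  invFun x := (x.1, fun γ => (h (colour x.1 (root x.1 γ) γ))⁻¹ • x.2 γ)
  left_inv x := by simp
  right_inv x := by simp
  measurable_toFun := by
    have hh : Measurable fun m : FreeGroup ℕ => h m := measurable_from_top
    exact measurable_fst.prodMk (measurable_pi_lambda _ fun γ => measurable_smul_apply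
      (hh.comp ((measurable_colour_root γ).comp measurable_fst)) (measurable_const (a := γ))
      measurable_snd)
  measurable_invFun := by
    have hh : Measurable fun m : FreeGroup ℕ => (h m)⁻¹ := measurable_from_top
    exact measurable_fst.prodMk (measurable_pi_lambda _ fun γ => measurable_smul_apply
      (hh.comp ((measurable_colour_root γ).comp measurable_fst)) (measurable_const (a := γ))
      measurable_snd)

omit [IsProbabilityMeasure κ] in
theorem law_map_retwist (h : FreeGroup ℕ →* FreeGroup ℕ) :
    (law w κ 1).map (retwist h) = law w κ h := by
  rw [law, Measure.map_map (retwist h).measurable (measurable_rootSpread 1), law]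
  congr 1
  funext x
  simp [retwist, rootSpread, spread]
  rfl

end Law

section Convergence

variable {Ω ι : Type*} [MeasurableSpace Ω] {l : Filter ι}

theorem tendsto_ennreal_tsum_of_dominated {f : ι → ℕ → ℝ≥0∞} {g b : ℕ → ℝ≥0∞}
    (hb : ∑' n, b n ≠ ∞) (hf : ∀ i n, f i n ≤ b n) (hg : ∀ n, g n ≤ b n)
    (h : ∀ n, Tendsto (fun i => f i n) l (𝓝 (g n))) :
    Tendsto (fun i => ∑' n, f i n) l (𝓝 (∑' n, g n)) := by
  have hbn : ∀ n, b n ≠ ∞ := ENNReal.ne_top_of_tsum_ne_top hb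
  have hfn : ∀ i n, f i n ≠ ∞ := fun i n => ne_top_of_le_ne_top (hbn n) (hf i n)
  have hgn : ∀ n, g n ≠ ∞ := fun n => ne_top_of_le_ne_top (hbn n) (hg n)
  have hfs : ∀ i, ∑' n, f i n ≠ ∞ := fun i => ne_top_of_le_ne_top hb (ENNReal.tsum_le_tsum (hf i))
  have hgs : ∑' n, g n ≠ ∞ := ne_top_of_le_ne_top hb (ENNReal.tsum_le_tsum hg)
  rw [← ENNReal.tendsto_toReal_iff hfs hgs]
  simp_rw [ENNReal.tsum_toReal_eq (hfn _)]
  rw [ENNReal.tsum_toReal_eq hgn]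
  refine tendsto_tsum_of_dominated_convergence (bound := fun n => (b n).toReal)
    (ENNReal.summable_toReal hb) (fun n => (ENNReal.tendsto_toReal_iff (fun i => hfn i n)
      (hgn n)).mpr (h n)) (.of_forall fun i n => ?_)
  rw [Real.norm_of_nonneg ENNReal.toReal_nonneg]
  exact ENNReal.toReal_mono (hbn n) (hf i n)

/-- Setwise convergence of dominated measures may be checked on a generating π-system. -/
theorem tendsto_measure_of_piSystem {C : Set (Set Ω)} (hC : ‹MeasurableSpace Ω› = .generateFrom C)
    (hpi : IsPiSystem C) {m κ₀ : Measure Ω} {κ : ι → Measure Ω} [IsFiniteMeasure m]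
    (hκ : ∀ i, κ i ≤ m) (hκ₀ : κ₀ ≤ m) (huniv : Tendsto (fun i => κ i univ) l (𝓝 (κ₀ univ)))
    (h : ∀ s ∈ C, Tendsto (fun i => κ i s) l (𝓝 (κ₀ s))) {s : Set Ω} (hs : MeasurableSet s) :
    Tendsto (fun i => κ i s) l (𝓝 (κ₀ s)) := by
  have hfin : ∀ i s, κ i s ≠ ∞ := fun i s => ne_top_of_le_ne_top (measure_ne_top m s) (hκ i s)
  have hfin₀ : ∀ s, κ₀ s ≠ ∞ := fun s => ne_top_of_le_ne_top (measure_ne_top m s) (hκ₀ s)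
  induction s, hs using MeasurableSpace.induction_on_inter hC hpi with
  | empty => simpa using tendsto_const_nhds
  | basic t ht => exact h t ht
  | compl t ht ih =>
    simp_rw [measure_compl ht (hfin _ _)]
    rw [measure_compl ht (hfin₀ _)]
    exact ENNReal.Tendsto.sub huniv ih (.inl (hfin₀ _))
  | iUnion f hd hm ih =>
    simp_rw [measure_iUnion hd hm]
    refine tendsto_ennreal_tsum_of_dominated (b := fun n => m (f n)) ?_ (fun i n => hκ i _)
      (fun n => hκ₀ _) ih
    rw [← measure_iUnion hd hm]
    exact measure_ne_top _ _

/-- Mixing may be checked on a generating π-system. -/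
theorem mixing_of_piSystem {C : Set (Set Ω)} (hC : ‹MeasurableSpace Ω› = .generateFrom C)
    (hpi : IsPiSystem C) {m : Measure Ω} [IsProbabilityMeasure m] {T : ι → Ω → Ω}
    (hT : ∀ i, MeasurePreserving (T i) m m)
    (h : ∀ s ∈ C, ∀ t ∈ C, Tendsto (fun i => m (s ∩ T i ⁻¹' t)) l (𝓝 (m s * m t)))
    {s t : Set Ω} (hs : MeasurableSet s) (ht : MeasurableSet t) :
    Tendsto (fun i => m (s ∩ T i ⁻¹' t)) l (𝓝 (m s * m t)) := by
  have hle : ∀ s, m s • m ≤ m := fun s => Measure.le_iff'.mpr fun t => by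
    simpa using mul_le_mul_left (prob_le_one (μ := m) (s := s)) (m t)
  have h1 : ∀ t ∈ C, ∀ s, MeasurableSet s →
      Tendsto (fun i => m (s ∩ T i ⁻¹' t)) l (𝓝 (m s * m t)) := by
    intro t ht s hs
    have htm : MeasurableSet t := hC ▸ .basic t ht
    have := tendsto_measure_of_piSystem hC hpi (l := l) (m := m) (κ₀ := m t • m)
      (κ := fun i => m.restrict (T i ⁻¹' t)) (fun i => Measure.restrict_le_self) (hle t)
      (by simpa [(hT _).measure_preimage htm.nullMeasurableSet] using tendsto_const_nhds) (fun s hs => ?_) hs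
    · simpa [Measure.restrict_apply hs, mul_comm] using this
    · have hsm : MeasurableSet s := hC ▸ .basic s hs
      simpa [Measure.restrict_apply hsm, mul_comm] using h s hs t ht
  have hmap : ∀ i t, MeasurableSet t → (m.restrict s).map (T i) t = m (s ∩ T i ⁻¹' t) :=
    fun i t ht => by
      rw [Measure.map_apply (hT i).measurable ht, Measure.restrict_apply ((hT i).measurable ht),
        inter_comm]
  have := tendsto_measure_of_piSystem hC hpi (l := l) (m := m) (κ₀ := m s • m)
    (κ := fun i => (m.restrict s).map (T i)) (fun i => ?_) (hle s) ?_ (fun t ht => ?_) ht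
  · simpa [hmap _ _ ht] using this
  · exact (Measure.map_mono Measure.restrict_le_self (hT i).measurable).trans (hT i).map_eq.le
  · simpa [hmap] using tendsto_const_nhds
  · have htm : MeasurableSet t := hC ▸ .basic t ht
    simpa [hmap _ _ htm] using h1 t ht s hs

end Convergence

section Products

variable {I ι A : Type*} [MeasurableSpace A] {l : Filter ι}

theorem isPiSystem_squareCylinders_measurableSet :
    IsPiSystem (squareCylinders fun _ : I => {s : Set A | MeasurableSet s}) :=
  isPiSystem_squareCylinders (fun _ => MeasurableSpace.isPiSystem_measurableSet) (by simp)

theorem mixing_infinitePi {m : I → Measure A} [∀ i, IsProbabilityMeasure (m i)] {σ : ι → I → I}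
    (hσ : ∀ g, (Measure.infinitePi m).map (fun ω i => ω (σ g i)) = Measure.infinitePi m)
    (hl : ∀ i j, ∀ᶠ g in l, σ g i ≠ j) {s t : Set (I → A)} (hs : MeasurableSet s)
    (ht : MeasurableSet t) :
    Tendsto (fun g => Measure.infinitePi m (s ∩ (fun ω i => ω (σ g i)) ⁻¹' t)) l
      (𝓝 (Measure.infinitePi m s * Measure.infinitePi m t)) := by
  classical
  have hmeas : ∀ g, Measurable fun (ω : I → A) i => ω (σ g i) := fun g =>
    measurable_pi_lambda _ fun _ => measurable_pi_apply _
  refine mixing_of_piSystem (T := fun g ω i => ω (σ g i)) generateFrom_squareCylinders.symm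
    isPiSystem_squareCylinders_measurableSet (fun g => ⟨hmeas g, hσ g⟩) ?_ hs ht
  rintro _ ⟨F, S, hS, rfl⟩ _ ⟨F', S', hS', rfl⟩
  simp only [mem_univ_pi, mem_ofPred_eq] at hS hS'
  have hm' : MeasurableSet ((F' : Set I).pi S') :=
    .pi F'.countable_toSet fun i _ => hS' i
  have hev : ∀ᶠ g in l, ∀ i ∈ F', ∀ j ∈ F, σ g i ≠ j :=
    (eventually_all_finset F').mpr fun i _ => (eventually_all_finset F).mpr fun j _ => hl i j
  refine tendsto_const_nhds.congr' ?_
  filter_upwards [hev] with g hg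
  have hd : Disjoint F (F'.image (σ g)) := by
    rw [Finset.disjoint_left]
    intro j hj hj'
    obtain ⟨i, hi, rfl⟩ := Finset.mem_image.mp hj'
    exact hg i hi _ hj rfl
  have hind := (ProbabilityTheory.iIndepFun_infinitePi (P := m) (X := fun _ x => x)
    fun _ => measurable_id).indepFun_finset F (F'.image (σ g)) hd fun i => measurable_pi_apply i
  have hU : MeasurableSet {x : F → A | ∀ i : F, x i ∈ S i} := by
    rw [ofPred_forall]
    exact .iInter fun i => measurable_pi_apply i (hS i)
  have hV : MeasurableSet {x : F'.image (σ g) → A |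
      ∀ i : F', x ⟨σ g i, Finset.mem_image_of_mem _ i.2⟩ ∈ S' i} := by
    rw [ofPred_forall]
    exact .iInter fun i => measurable_pi_apply _ (hS' i)
  have := hind.measure_inter_preimage_eq_mul _ _ hU hV
  have e1 : (fun (a : I → A) (i : F) => a i) ⁻¹' {x : F → A | ∀ i : F, x i ∈ S i} =
      (F : Set I).pi S := by
    ext ω; simp [Set.mem_pi]
  have e2 : (fun (a : I → A) (i : F'.image (σ g)) => a i) ⁻¹' {x : F'.image (σ g) → A |
      ∀ i : F', x ⟨σ g i, Finset.mem_image_of_mem _ i.2⟩ ∈ S' i} =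
      (fun (ω : I → A) i => ω (σ g i)) ⁻¹' (F' : Set I).pi S' := by
    ext ω; simp [Set.mem_pi]
  rw [e1, e2] at this
  rw [this]
  congr 1
  conv_lhs => rw [← hσ g, Measure.map_apply (hmeas g) hm']

theorem mixing_prod {Ω Ω' : Type*} [MeasurableSpace Ω] [MeasurableSpace Ω'] {m : Measure Ω}
    {m' : Measure Ω'} [IsProbabilityMeasure m] [IsProbabilityMeasure m'] {T : ι → Ω → Ω}
    {T' : ι → Ω' → Ω'} (hT : ∀ i, MeasurePreserving (T i) m m)
    (hT' : ∀ i, MeasurePreserving (T' i) m' m')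
    (h : ∀ s t, MeasurableSet s → MeasurableSet t →
      Tendsto (fun i => m (s ∩ T i ⁻¹' t)) l (𝓝 (m s * m t)))
    (h' : ∀ s t, MeasurableSet s → MeasurableSet t →
      Tendsto (fun i => m' (s ∩ T' i ⁻¹' t)) l (𝓝 (m' s * m' t)))
    {s t : Set (Ω × Ω')} (hs : MeasurableSet s) (ht : MeasurableSet t) :
    Tendsto (fun i => m.prod m' (s ∩ Prod.map (T i) (T' i) ⁻¹' t)) l
      (𝓝 (m.prod m' s * m.prod m' t)) := by
  refine mixing_of_piSystem generateFrom_prod.symm isPiSystem_prod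
    (fun i => (hT i).prod (hT' i)) ?_ hs ht
  rintro _ ⟨a, ha, b, hb, rfl⟩ _ ⟨a', ha', b', hb', rfl⟩
  simp only [preimage_prod_map_prod, prod_inter_prod, Measure.prod_prod]
  rw [mul_mul_mul_comm]
  exact ENNReal.Tendsto.mul (h a a' ha ha') (.inr (by finiteness))
    (h' b b' hb hb') (.inr (by finiteness))

end Products

section LawMixing

variable {Γ : Type*} [Group Γ] {K : Type*} [MulAction (FreeGroup ℕ) K] [MeasurableSpace K]
  [MeasurableConstSMul (FreeGroup ℕ) K] (κ : Measure K) [IsProbabilityMeasure κ]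

/-- On sets of vertices in different trees, the transported labels for two different selections
are jointly distributed as for a single selection. -/
theorem bern_spread_inter_eq [SMulInvariantMeasure (FreeGroup ℕ) K κ]
    (h : FreeGroup ℕ →* FreeGroup ℕ) {ω : Γ × ℕ → Γ} {r r' : Γ → Γ}
    (hr : IsSelection ω r) (hr' : IsSelection ω r') {F F' : Finset Γ}
    (hF : ∀ γ ∈ F, ∀ γ' ∈ F', ¬ Tree ω γ γ') {S S' : Γ → Set K}
    (hS : ∀ γ, MeasurableSet (S γ)) (hS' : ∀ γ, MeasurableSet (S' γ)) :
    bern Γ κ {V | (∀ γ ∈ F, spread h ω r V γ ∈ S γ) ∧ ∀ γ ∈ F', spread h ω r V γ ∈ S' γ} =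
      bern Γ κ {V | (∀ γ ∈ F, spread h ω r V γ ∈ S γ) ∧ ∀ γ ∈ F', spread h ω r' V γ ∈ S' γ} := by
  classical
  let r'' : Γ → Γ := fun γ => if ∃ δ ∈ F, Tree ω δ γ then r γ else r' γ
  have hr'' : IsSelection ω r'' := by
    refine ⟨fun γ => ?_, fun γ γ' hγ => ?_⟩
    · by_cases hc : ∃ δ ∈ F, Tree ω δ γ
      · simpa [r'', hc] using hr.tree γ
      · simpa only [r'', if_neg hc] using hr'.tree γ
    · have hiff : (∃ δ ∈ F, Tree ω δ γ) ↔ ∃ δ ∈ F, Tree ω δ γ' :=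
        ⟨fun ⟨δ, hδ, ht⟩ => ⟨δ, hδ, ht.trans hγ⟩, fun ⟨δ, hδ, ht⟩ => ⟨δ, hδ, ht.trans hγ.symm⟩⟩
      simp only [r'', hiff, hr.eq_of_tree _ _ hγ, hr'.eq_of_tree _ _ hγ]
  have h1 : ∀ γ ∈ F, r'' γ = r γ := fun γ hγ => if_pos ⟨γ, hγ, Tree.refl γ⟩
  have h2 : ∀ γ ∈ F', r'' γ = r' γ := fun γ hγ => if_neg fun ⟨δ, hδ, ht⟩ => hF δ hδ γ hγ ht
  have hE : MeasurableSet ((F : Set Γ).pi S ∩ (F' : Set Γ).pi S') :=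
    (MeasurableSet.pi F.countable_toSet fun γ _ => hS γ).inter
      (.pi F'.countable_toSet fun γ _ => hS' γ)
  have key := congrArg (fun m => m ((F : Set Γ).pi S ∩ (F' : Set Γ).pi S'))
    (bern_map_spread_eq κ h hr hr'')
  simp only [Measure.map_apply (measurable_spread h ω _) hE] at key
  convert! key using 2
  ext V
  simp only [spread, mem_ofPred_eq, mem_preimage, mem_inter_iff, Set.mem_pi, SetLike.mem_coe]
  refine and_congr (forall₂_congr fun γ hγ => ?_) (forall₂_congr fun γ hγ => ?_)
  · rw [h1 γ hγ]
  · rw [h2 γ hγ]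

variable [Countable Γ] [MeasurableSpace Γ] [DiscreteMeasurableSpace Γ] (w : ℕ → PMF Γ)

omit [Countable Γ] [DiscreteMeasurableSpace Γ] in
theorem perc_mixing {s t : Set (Γ × ℕ → Γ)} (hs : MeasurableSet s) (ht : MeasurableSet t) :
    Tendsto (fun g => perc w (s ∩ shift g ⁻¹' t)) cofinite (𝓝 (perc w s * perc w t)) := by
  refine mixing_infinitePi (m := fun e : Γ × ℕ => (w e.2).toMeasure)
    (σ := fun (g : Γ) e => (g⁻¹ * e.1, e.2)) (fun g => perc_map_shift w g) (fun i j => ?_) hs ht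
  refine eventually_cofinite.mpr ((Set.finite_singleton (i.1 * j.1⁻¹)).subset fun g hg => ?_)
  simp only [not_not, mem_ofPred_eq] at hg
  simp [← hg]

omit [MulAction (FreeGroup ℕ) K] [MeasurableConstSMul (FreeGroup ℕ) K] [Countable Γ]
  [MeasurableSpace Γ] [DiscreteMeasurableSpace Γ] in
theorem bern_mixing {s t : Set (Γ → K)} (hs : MeasurableSet s) (ht : MeasurableSet t) :
    Tendsto (fun g : Γ => bern Γ κ (s ∩ (fun V γ => V (g⁻¹ * γ)) ⁻¹' t)) cofinite
      (𝓝 (bern Γ κ s * bern Γ κ t)) := by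
  refine mixing_infinitePi (m := fun _ : Γ => κ) (σ := fun (g : Γ) γ => g⁻¹ * γ)
    (fun g => bern_map_precomp κ (mul_right_injective g⁻¹)) (fun i j => ?_) hs ht
  refine eventually_cofinite.mpr ((Set.finite_singleton (i * j⁻¹)).subset fun g hg => ?_)
  simp only [not_not, mem_ofPred_eq] at hg
  simp [← hg]

omit [DiscreteMeasurableSpace Γ] [MulAction (FreeGroup ℕ) K]
  [MeasurableConstSMul (FreeGroup ℕ) K] [Countable Γ] in
theorem mixing_perc_prod_bern {s t : Set (Config Γ K)} (hs : MeasurableSet s)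
    (ht : MeasurableSet t) :
    Tendsto (fun g => (perc w).prod (bern Γ κ) (s ∩ translate g ⁻¹' t)) cofinite
      (𝓝 ((perc w).prod (bern Γ κ) s * (perc w).prod (bern Γ κ) t)) := by
  have h1 : ∀ g : Γ, MeasurePreserving (shift g) (perc w) (perc w) :=
    fun g => ⟨measurable_shift g, perc_map_shift w g⟩
  have h2 : ∀ g : Γ, MeasurePreserving (fun (V : Γ → K) γ => V (g⁻¹ * γ)) (bern Γ κ) (bern Γ κ) :=
    fun g => ⟨measurable_pi_lambda _ fun _ => measurable_pi_apply _,
      bern_map_precomp κ (mul_right_injective g⁻¹)⟩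
  exact mixing_prod h1 h2 (fun s t => perc_mixing w) (fun s t => bern_mixing κ) hs ht

variable {w} in
omit [MeasurableSpace K] [MeasurableConstSMul (FreeGroup ℕ) K] [MulAction (FreeGroup ℕ) K] in
theorem tendsto_perc_exists_tree (hw : Subcritical fun k => ⇑(w k)) (F F' : Finset Γ) :
    Tendsto (fun g => perc w {ω | ∃ γ ∈ F, ∃ γ' ∈ F', Tree ω γ (g⁻¹ * γ')}) cofinite (𝓝 0) := by
  have hle : ∀ g : Γ, perc w {ω | ∃ γ ∈ F, ∃ γ' ∈ F', Tree ω γ (g⁻¹ * γ')} ≤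
      ∑ γ ∈ F, ∑ γ' ∈ F', green (fun k => w k) (g⁻¹ * γ') γ := by
    intro g
    have : {ω : Γ × ℕ → Γ | ∃ γ ∈ F, ∃ γ' ∈ F', Tree ω γ (g⁻¹ * γ')} =
        ⋃ γ ∈ F, ⋃ γ' ∈ F', {ω | Tree ω (g⁻¹ * γ') γ} := by
      ext ω
      simp only [mem_ofPred_eq, mem_iUnion, exists_prop]
      exact exists_congr fun γ => and_congr_right fun _ => exists_congr fun γ' =>
        and_congr_right fun _ => ⟨Tree.symm, Tree.symm⟩
    rw [this]
    refine (measure_biUnion_finset_le _ _).trans (Finset.sum_le_sum fun γ _ => ?_)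
    exact (measure_biUnion_finset_le _ _).trans (Finset.sum_le_sum fun γ' _ => perc_tree_le w _ _)
  refine tendsto_of_tendsto_of_tendsto_of_le_of_le tendsto_const_nhds ?_ (fun _ => zero_le) hle
  have : (0 : ℝ≥0∞) = ∑ γ ∈ F, ∑ γ' ∈ F', (0 : ℝ≥0∞) := by simp
  rw [this]
  refine tendsto_finsetSum _ fun γ _ => tendsto_finsetSum _ fun γ' _ => ?_
  have hinj : Function.Injective fun g : Γ => g⁻¹ * γ' := fun a b hab => by simpa using hab
  exact (hw.tendsto_green γ).comp hinj.tendsto_cofinite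

theorem tendsto_of_le_add {ι : Type*} {l : Filter ι} {a b d : ι → ℝ≥0∞} {c : ℝ≥0∞}
    (hc : c ≠ ∞) (hb : Tendsto b l (𝓝 c)) (hd : Tendsto d l (𝓝 0)) (h1 : ∀ i, a i ≤ b i + d i)
    (h2 : ∀ i, b i ≤ a i + d i) : Tendsto a l (𝓝 c) := by
  refine tendsto_of_tendsto_of_tendsto_of_le_of_le (g := fun i => b i - d i)
    (h := fun i => b i + d i) ?_ ?_ (fun i => tsub_le_iff_right.mpr (h2 i)) h1
  · simpa using ENNReal.Tendsto.sub hb hd (.inl hc)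
  · simpa using hb.add hd

variable {w} in
theorem law_mixing [SMulInvariantMeasure (FreeGroup ℕ) K κ]
    (h : FreeGroup ℕ →* FreeGroup ℕ) (hw : Subcritical fun k => ⇑(w k))
    {s t : Set (Config Γ K)} (hs : MeasurableSet s) (ht : MeasurableSet t) :
    Tendsto (fun g => law w κ h (s ∩ translate g ⁻¹' t)) cofinite
      (𝓝 (law w κ h s * law w κ h t)) := by
  classical
  let C : Set (Set (Config Γ K)) := image2 (· ×ˢ ·) {A : Set (Γ × ℕ → Γ) | MeasurableSet A}
    (squareCylinders fun _ : Γ => {s : Set K | MeasurableSet s})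
  have hC : (inferInstance : MeasurableSpace (Config Γ K)) = .generateFrom C := by
    have hspan : IsCountablySpanning (squareCylinders fun _ : Γ => {s : Set K | MeasurableSet s}) :=
      ⟨fun _ => univ, fun _ => ⟨∅, fun _ => univ, by simp, by simp⟩, iUnion_const _⟩
    rw [← generateFrom_prod_eq isCountablySpanning_measurableSet hspan,
      MeasurableSpace.generateFrom_measurableSet, generateFrom_squareCylinders]
  refine mixing_of_piSystem hC
    (MeasurableSpace.isPiSystem_measurableSet.prod isPiSystem_squareCylinders_measurableSet)
    (fun g => ⟨measurable_translate g, law_map_translate w κ h g⟩) ?_ hs ht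
  rintro _ ⟨A, hA, _, ⟨F, (S : Γ → Set K), hS, rfl⟩, rfl⟩
    _ ⟨A', hA', _, ⟨F', (S' : Γ → Set K), hS', rfl⟩, rfl⟩
  simp only [mem_univ_pi, mem_ofPred_eq] at hS hS' hA hA'
  have hs : MeasurableSet (A ×ˢ (F : Set Γ).pi S) :=
    hA.prod (.pi F.countable_toSet fun γ _ => hS γ)
  have ht : MeasurableSet (A' ×ˢ (F' : Set Γ).pi S') :=
    hA'.prod (.pi F'.countable_toSet fun γ _ => hS' γ)
  set s := A ×ˢ (F : Set Γ).pi S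
  set t := A' ×ˢ (F' : Set Γ).pi S'
  have hlaw : ∀ s, MeasurableSet s →
      law w κ h s = (perc w).prod (bern Γ κ) (rootSpread h ⁻¹' s) := fun s hs =>
    Measure.map_apply (measurable_rootSpread h) hs
  let J : Γ → Set (Γ × ℕ → Γ) := fun g => {ω | ∃ γ ∈ F, ∃ γ' ∈ F', Tree ω γ (g⁻¹ * γ')}
  have hJ : ∀ g, MeasurableSet (J g) := fun g => by
    have : J g = ⋃ γ ∈ F, ⋃ γ' ∈ F', {ω | Tree ω γ (g⁻¹ * γ')} := by
      ext ω; simp [J]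
    rw [this]
    exact .biUnion F.countable_toSet fun γ _ => .biUnion F'.countable_toSet fun γ' _ =>
      measurableSet_tree _ _
  have key : ∀ g, ∀ ω ∉ J g,
      bern Γ κ {V | (ω, spread h ω (root ω) V) ∈ s ∩ translate g ⁻¹' t} =
        bern Γ κ {V | (ω, V) ∈ rootSpread h ⁻¹' s ∩ translate g ⁻¹' (rootSpread h ⁻¹' t)} := by
    intro g ω hω
    have hr' := (isSelection_root (shift g ω)).conj g⁻¹
    rw [shift_inv_shift] at hr'
    have hsep : ∀ γ ∈ F, ∀ γ' ∈ F'.image (g⁻¹ * ·), ¬ Tree ω γ γ' := by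
      intro γ hγ γ' hγ' hT
      obtain ⟨δ, hδ, rfl⟩ := Finset.mem_image.mp hγ'
      exact hω ⟨γ, hγ, δ, hδ, hT⟩
    have e := bern_spread_inter_eq κ h (isSelection_root ω) hr' hsep hS
      (S' := fun γ => S' (g * γ)) fun γ => hS' _
    have e1 : ∀ V : Γ → K, (fun γ => spread h ω
        (fun γ => g⁻¹ * root (shift g ω) (g⁻¹⁻¹ * γ)) V (g⁻¹ * γ)) =
        spread h (shift g ω) (root (shift g ω)) fun γ => V (g⁻¹ * γ) := by
      intro V
      rw [spread_conj h hr' V g]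
      simp
    by_cases hm : ω ∈ A ∧ shift g ω ∈ A'
    · convert! e using 2
      · ext V
        simp only [Finset.forall_mem_image, mul_inv_cancel_left]
        simp [s, t, hm, translate, Set.mem_pi]
      · ext V
        have e2 := congrFun (e1 V)
        simp only [Finset.forall_mem_image, mul_inv_cancel_left]
        simp only [s, t, mem_preimage, mem_inter_iff, mem_prod, translate, Set.mem_pi, rootSpread,
          mem_ofPred_eq, hm, true_and, SetLike.mem_coe]
        exact and_congr_right' (forall₂_congr fun x _ => by rw [← e2])
    · congr 1
      ext V
      simp only [s, t, mem_ofPred_eq, mem_inter_iff, mem_preimage, mem_prod, translate, rootSpread]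
      tauto
  have hle : ∀ {a b : (Γ × ℕ → Γ) → ℝ≥0∞} (g : Γ), (∀ ω, a ω ≤ 1) → (∀ ω ∉ J g, a ω = b ω) →
      ∫⁻ ω, a ω ∂perc w ≤ ∫⁻ ω, b ω ∂perc w + perc w (J g) := by
    intro a b g ha hab
    rw [← lintegral_indicator_one (hJ g), ← lintegral_add_right _ (measurable_one.indicator (hJ g))]
    refine lintegral_mono fun ω => ?_
    by_cases hω : ω ∈ J g
    · simpa [hω] using (ha ω).trans le_add_self
    · simp [hω, hab ω hω]
  have hmt : ∀ g, MeasurableSet (s ∩ translate g ⁻¹' t) := fun g =>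
    hs.inter (measurable_translate g ht)
  have hmt' : ∀ g, MeasurableSet (rootSpread h ⁻¹' s ∩ translate g ⁻¹' (rootSpread h ⁻¹' t)) :=
    fun g => (measurable_rootSpread h hs).inter
      (measurable_translate g (measurable_rootSpread h ht))
  have hlim := mixing_perc_prod_bern κ w (measurable_rootSpread h hs) (measurable_rootSpread h ht)
  rw [← hlaw s hs, ← hlaw t ht] at hlim
  refine tendsto_of_le_add (by finiteness) hlim (tendsto_perc_exists_tree hw F F')
    (fun g => ?_) fun g => ?_
  · rw [law_apply w κ h (hmt g), Measure.prod_apply (hmt' g)]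
    exact hle g (fun ω => prob_le_one) (key g)
  · rw [law_apply w κ h (hmt g), Measure.prod_apply (hmt' g)]
    exact hle g (fun ω => prob_le_one) fun ω hω => (key g ω hω).symm

end LawMixing

section Model

variable {Γ : Type*} [Group Γ] {K : Type*} [MulAction (FreeGroup ℕ) K] [MeasurableSpace K]

/-- A description of the orbits of `A` by partial transformations `S k` moving a `K`-valued label
by the `k`-th free generator, for `k ∈ I`, where the generators outside `I` never relate two labels
in the same orbit. -/
structure Model {X : Type*} [MeasurableSpace X] {μ : Measure X} (A : PmpAction Γ X μ) (K : Type*)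
    [MulAction (FreeGroup ℕ) K] [MeasurableSpace K] (I : Set ℕ) where
  label : X → K
  step : ℕ → X → X
  dom : ℕ → Set X
  measurable_label : Measurable label
  measurable_step : ∀ k, Measurable (step k)
  measurableSet_dom : ∀ k, MeasurableSet (dom k)
  step_mem_orbit : ∀ k, ∀ᵐ x ∂μ, step k x ∈ A.orbit x
  compl_dom_le : ∀ k, μ (dom k)ᶜ ≤ ENNReal.ofReal (1 / 100)
  label_step : ∀ k ∈ I, ∀ᵐ x ∂μ, x ∈ dom k → label (step k x) = FreeGroup.of k • label x
  preimage_step_le : ∀ k, ∀ s, MeasurableSet s → ∀ t : ℝ≥0∞,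
    4 * t * μ (step k ⁻¹' s) ≤ 4 * t ^ 2 * μ s + 2
  label_ne : ∀ k ∉ I, ∀ᵐ x ∂μ, ∀ y ∈ A.orbit x, label y ≠ FreeGroup.of k • label x

/-- Models can be transported along orbit equivalences. -/
theorem Model.transport {X Y : Type*} [MeasurableSpace X] [MeasurableSpace Y] {μ : Measure X}
    {ν : Measure Y} {A : PmpAction Γ X μ} {B : PmpAction Γ Y ν} {I : Set ℕ}
    (hAB : OrbitEquivalent A B) (M : Model A K I) : Nonempty (Model B K I) := by
  obtain ⟨Δ, h1, h2, h3, h4⟩ := hAB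
  have h3' : MeasurePreserving Δ.symm ν μ := by
    refine ⟨h2, ?_⟩
    rw [← h3.map_eq, Measure.map_map h2 h1]
    simp
  have hae : ∀ {p : X → Prop}, (∀ᵐ x ∂μ, p x) → ∀ᵐ y ∂ν, p (Δ.symm y) := fun h =>
    h3'.quasiMeasurePreserving.ae h
  refine ⟨{
    label := M.label ∘ Δ.symm
    step := fun k => Δ ∘ M.step k ∘ Δ.symm
    dom := fun k => Δ.symm ⁻¹' M.dom k
    measurable_label := M.measurable_label.comp h2
    measurable_step := fun k => h1.comp ((M.measurable_step k).comp h2)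
    measurableSet_dom := fun k => h2 (M.measurableSet_dom k)
    step_mem_orbit := fun k => ?_
    compl_dom_le := fun k => ?_
    label_step := fun k hk => ?_
    preimage_step_le := fun k s hs t => ?_
    label_ne := fun k hk => ?_ }⟩
  · filter_upwards [hae h4, hae (M.step_mem_orbit k)] with y h5 h6
    rw [Equiv.apply_symm_apply] at h5
    rw [← h5]
    exact mem_image_of_mem _ h6
  · rw [← preimage_compl, h3'.measure_preimage (M.measurableSet_dom k).compl.nullMeasurableSet]
    exact M.compl_dom_le k
  · filter_upwards [hae (M.label_step k hk)] with y h5 h6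
    simpa using h5 h6
  · have := M.preimage_step_le k (Δ ⁻¹' s) (h1 hs) t
    rw [h3.measure_preimage hs.nullMeasurableSet] at this
    rwa [show (Δ ∘ M.step k ∘ Δ.symm) ⁻¹' s = Δ.symm ⁻¹' (M.step k ⁻¹' (Δ ⁻¹' s)) from rfl,
      h3'.measure_preimage (M.measurable_step k (h1 hs)).nullMeasurableSet]
  · filter_upwards [hae h4, hae (M.label_ne k hk)] with y h5 h6 z hz
    rw [Equiv.apply_symm_apply] at h5
    rw [← h5] at hz
    obtain ⟨x, hx, rfl⟩ := hz
    simpa using h6 x hx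

end Model

section OrbitEquivalence

variable {Γ : Type*} [Group Γ] {X Y Z : Type*} [MeasurableSpace X] [MeasurableSpace Y]
  [MeasurableSpace Z] {μ : Measure X} {ν : Measure Y} {ξ : Measure Z}

theorem orbitEquivalent_refl (A : PmpAction Γ X μ) : OrbitEquivalent A A :=
  ⟨Equiv.refl X, measurable_id, measurable_id, .id μ, by simp⟩

theorem orbitEquivalent_symm {A : PmpAction Γ X μ} {B : PmpAction Γ Y ν}
    (h : OrbitEquivalent A B) : OrbitEquivalent B A := by
  obtain ⟨Δ, h1, h2, h3, h4⟩ := h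
  have h3' : MeasurePreserving Δ.symm ν μ := by
    refine ⟨h2, ?_⟩
    rw [← h3.map_eq, Measure.map_map h2 h1]
    simp
  refine ⟨Δ.symm, h2, by simpa using h1, h3', ?_⟩
  filter_upwards [h3'.quasiMeasurePreserving.ae h4] with y h5
  rw [Equiv.apply_symm_apply] at h5
  rw [← h5, ← image_comp]
  simp

theorem orbitEquivalent_trans {A : PmpAction Γ X μ} {B : PmpAction Γ Y ν} {C : PmpAction Γ Z ξ}
    (h : OrbitEquivalent A B) (h' : OrbitEquivalent B C) : OrbitEquivalent A C := by
  obtain ⟨Δ, h1, h2, h3, h4⟩ := h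
  obtain ⟨Θ, k1, k2, k3, k4⟩ := h'
  refine ⟨Δ.trans Θ, k1.comp h1, h2.comp k2, k3.comp h3, ?_⟩
  filter_upwards [h4, h3.quasiMeasurePreserving.ae k4] with x h5 h6
  rw [Equiv.coe_trans, image_comp, h5, h6]
  rfl

/-- The action on `X` obtained by conjugating an action on `Y` by an isomorphism. -/
def conjAction (e : X ≃ᵐ Y) (he : MeasurePreserving e μ ν) (B : PmpAction Γ Y ν) :
    PmpAction Γ X μ where
  act g x := e.symm (B.act g (e x))
  act_one x := by simp [B.act_one]
  act_mul g h x := by simp [B.act_mul]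
  measurable g := e.symm.measurable.comp ((B.measurable g).comp e.measurable)
  measurePreserving g := (he.symm e).comp ((B.measurePreserving g).comp he)

variable {e : X ≃ᵐ Y} {he : MeasurePreserving e μ ν} {B : PmpAction Γ Y ν}

theorem orbitEquivalent_conjAction : OrbitEquivalent (conjAction e he B) B := by
  refine ⟨e.toEquiv, e.measurable, e.symm.measurable, he, .of_forall fun x => ?_⟩
  ext y
  constructor
  · rintro ⟨_, ⟨g, rfl⟩, rfl⟩
    exact ⟨g, by simp [conjAction]⟩
  · rintro ⟨g, rfl⟩
    exact ⟨_, ⟨g, rfl⟩, by simp [conjAction]⟩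

theorem isFree_conjAction (hB : B.IsFree) : (conjAction e he B).IsFree := by
  filter_upwards [he.quasiMeasurePreserving.ae hB] with x hx g hg
  refine hx g ?_
  simpa [conjAction] using congrArg e hg

theorem isMixing_conjAction (hB : B.IsMixing) : (conjAction e he B).IsMixing := by
  intro s t hs ht
  have h := hB (e.symm ⁻¹' s) (e.symm ⁻¹' t) (e.symm.measurable hs) (e.symm.measurable ht)
  have h' := he.symm e
  rw [h'.measure_preimage hs.nullMeasurableSet, h'.measure_preimage ht.nullMeasurableSet] at h
  refine h.congr fun g => ?_
  rw [← he.measure_preimage_equiv]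
  congr 1
  ext x
  simp only [conjAction, mem_preimage, mem_inter_iff, MeasurableEquiv.symm_apply_apply, mem_image]
  refine and_congr_left fun _ => ⟨?_, ?_⟩
  · rintro ⟨y, hy, hx⟩
    exact ⟨e.symm y, hy, by simp [hx]⟩
  · rintro ⟨y, hy, rfl⟩
    exact ⟨e y, by simpa using hy, by simp⟩

end OrbitEquivalence

section Translation

variable {Γ : Type*} [Group Γ] [Countable Γ] [MeasurableSpace Γ] [DiscreteMeasurableSpace Γ]
  {K : Type*} [MulAction (FreeGroup ℕ) K] [MeasurableSpace K] [MeasurableConstSMul (FreeGroup ℕ) K]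
  (w : ℕ → PMF Γ) (κ : Measure K) [IsProbabilityMeasure κ]

theorem law_fst_preimage (h : FreeGroup ℕ →* FreeGroup ℕ) {s : Set (Γ × ℕ → Γ)}
    (hs : MeasurableSet s) : law w κ h (Prod.fst ⁻¹' s) = perc w s := by
  rw [← Measure.map_apply measurable_fst hs, law_map_fst]

omit [Group Γ] in
theorem measurableSet_edge (e : Γ × ℕ) (s : Γ) : MeasurableSet {ω : Γ × ℕ → Γ | ω e = s} :=
  measurable_pi_apply (X := fun _ : Γ × ℕ => Γ) e (measurableSet_singleton s)

theorem law_edge (h : FreeGroup ℕ →* FreeGroup ℕ) (e : Γ × ℕ) (s : Γ) :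
    law w κ h {x | x.1 e = s} = w e.2 s := by
  rw [← perc_edge w e s, ← law_fst_preimage w κ h (measurableSet_edge e s)]
  rfl

theorem law_edge_inter_edge (h : FreeGroup ℕ →* FreeGroup ℕ) {e e' : Γ × ℕ} (hne : e ≠ e')
    (s s' : Γ) : law w κ h ({x | x.1 e = s} ∩ {x | x.1 e' = s'}) = w e.2 s * w e'.2 s' := by
  classical
  have := perc_cylinder w {e, e'} fun f => if f = e then s else s'
  rw [Finset.prod_pair hne] at this
  simp only [if_true, hne.symm, if_false, Finset.mem_insert, Finset.mem_singleton, forall_eq_or_imp,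
    forall_eq] at this
  rw [← this, ofPred_and, ← law_fst_preimage w κ h ((measurableSet_edge e s).inter (measurableSet_edge e' s'))]
  rfl

variable [SMulInvariantMeasure (FreeGroup ℕ) K κ]

/-- The translation action. -/
def translateAction (h : FreeGroup ℕ →* FreeGroup ℕ) :
    PmpAction Γ (Config Γ K) (law w κ h) where
  act := translate
  act_one x := by simp [translate, shift_one]
  act_mul g g' x := by simp [translate, shift_mul, mul_assoc]
  measurable := measurable_translate
  measurePreserving g := ⟨measurable_translate g, law_map_translate w κ h g⟩

variable {w}

theorem tendsto_two_inv_pow : Tendsto (fun k : ℕ => (2⁻¹ : ℝ≥0∞) ^ (2 * k + 17)) atTop (𝓝 0) := by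
  refine (ENNReal.tendsto_pow_atTop_nhds_zero_of_lt_one (r := 2⁻¹) (by simp)).comp ?_
  exact tendsto_atTop_mono (fun k => (by omega : k ≤ 2 * k + 17)) tendsto_id

theorem isFree_translateAction (hw : Subcritical fun k => ⇑(w k))
    (h : FreeGroup ℕ →* FreeGroup ℕ) : (translateAction w κ h).IsFree := by
  rw [PmpAction.IsFree, ae_all_iff]
  intro g
  by_cases hg : g = 1
  · simp [hg]
  have hle : ∀ k, law w κ h {x | ¬ (translate g x = x → g = 1)} ≤ 2⁻¹ ^ (2 * k + 17) := by
    intro k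
    have hne : (g⁻¹, k) ≠ ((1 : Γ), k) := by simpa using hg
    calc law w κ h {x | ¬ (translate g x = x → g = 1)}
        ≤ law w κ h (⋃ s, {x | x.1 (g⁻¹, k) = s} ∩ {x | x.1 (1, k) = s}) := by
          refine measure_mono fun x hx => ?_
          simp only [mem_ofPred_eq, Classical.not_imp] at hx
          have := congrFun (congrArg Prod.fst hx.1) (1, k)
          exact mem_iUnion.mpr ⟨x.1 (1, k), by simpa [translate, shift] using this, rfl⟩
      _ ≤ ∑' s, law w κ h ({x | x.1 (g⁻¹, k) = s} ∩ {x | x.1 (1, k) = s}) := measure_iUnion_le _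
      _ = sqNorm (w k) := by
          simp only [law_edge_inter_edge w κ h hne, sqNorm, sq]
      _ ≤ _ := (hw k).sqNorm_le
  exact le_antisymm (ge_of_tendsto' tendsto_two_inv_pow hle) zero_le

omit [SMulInvariantMeasure (FreeGroup ℕ) K κ] in
theorem noAtoms_law (hw : Subcritical fun k => ⇑(w k)) (h : FreeGroup ℕ →* FreeGroup ℕ) :
    NullSingletonClass (law w κ h) := by
  refine ⟨fun x => ?_⟩
  have hle : ∀ k, law w κ h {x} ^ 2 ≤ 2⁻¹ ^ (2 * k + 17) := by
    intro k
    refine le_trans ?_ (hw.sq_le k (x.1 (1, k)))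
    gcongr
    rw [← law_edge w κ h (1, k)]
    exact measure_mono (by simp)
  have : law w κ h {x} ^ 2 = 0 := le_antisymm (ge_of_tendsto' tendsto_two_inv_pow hle) zero_le
  simpa using this

theorem isMixing_translateAction (hw : Subcritical fun k => ⇑(w k))
    (h : FreeGroup ℕ →* FreeGroup ℕ) : (translateAction w κ h).IsMixing := by
  intro s t hs ht
  have h1 := law_mixing κ h hw ht hs
  rw [mul_comm]
  refine (h1.comp (inv_injective (G := Γ)).tendsto_cofinite).congr fun g => ?_
  rw [Function.comp_apply, inter_comm]
  congr 2
  let A := translateAction w κ h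
  have hinv : ∀ (g : Γ) x, A.act g⁻¹ (A.act g x) = x := fun g x => by
    rw [← A.act_mul, inv_mul_cancel, A.act_one]
  ext x
  constructor
  · intro hx
    refine ⟨_, hx, ?_⟩
    have := hinv g⁻¹ x
    rwa [inv_inv] at this
  · rintro ⟨y, hy, rfl⟩
    change A.act g⁻¹ (A.act g y) ∈ s
    rwa [hinv]

variable (w)

/-- Moving along the edge of colour `k` starting at the identity. -/
def follow (k : ℕ) (x : Config Γ K) : Config Γ K := translate (x.1 (1, k))⁻¹ x

omit [MulAction (FreeGroup ℕ) K] [MeasurableConstSMul (FreeGroup ℕ) K] in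
theorem measurable_follow (k : ℕ) : Measurable (follow k : Config Γ K → _) := by
  have h1 : Measurable fun p : Config Γ K × Γ => translate p.2⁻¹ p.1 :=
    measurable_from_prod_countable_left fun y => measurable_translate y⁻¹
  exact h1.comp (measurable_id.prodMk ((measurable_pi_apply _).comp measurable_fst))

theorem law_preimage_follow (h : FreeGroup ℕ →* FreeGroup ℕ) (k : ℕ) {s : Set (Config Γ K)}
    (hs : MeasurableSet s) :
    law w κ h (follow k ⁻¹' s) = ∑' u, law w κ h (s ∩ {x | x.1 (u⁻¹, k) = u}) := by
  have hm : ∀ u : Γ, MeasurableSet {x : Config Γ K | x.1 (u⁻¹, k) = u} := fun u =>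
    measurable_fst (measurableSet_edge _ u)
  have h1 : follow k ⁻¹' s =
      ⋃ u : Γ, translate u⁻¹ ⁻¹' (s ∩ {x : Config Γ K | x.1 (u⁻¹, k) = u}) := by
    ext x
    simp only [follow, translate, shift, mem_preimage, mem_iUnion, mem_inter_iff, mem_ofPred_eq,
      inv_inv, mul_inv_cancel]
    exact ⟨fun hx => ⟨_, hx, rfl⟩, fun ⟨u, hx, hu⟩ => hu ▸ hx⟩
  rw [h1, measure_iUnion]
  · refine tsum_congr fun u => ?_
    exact ((translateAction w κ h).measurePreserving u⁻¹).measure_preimage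
      (hs.inter (hm u)).nullMeasurableSet
  · intro u v huv
    refine disjoint_left.mpr fun x hx hy => huv ?_
    simp only [translate, shift, mem_preimage, mem_inter_iff, mem_ofPred_eq,
      inv_inv, mul_inv_cancel] at hx hy
    exact hx.2.symm.trans hy.2
  · exact fun u => measurable_translate _ (hs.inter (hm u))

omit [SMulInvariantMeasure (FreeGroup ℕ) K κ] in
theorem lintegral_indegree_sq_le (h : FreeGroup ℕ →* FreeGroup ℕ) (k : ℕ) :
    ∫⁻ x, (∑' u : Γ, {x : Config Γ K | x.1 (u⁻¹, k) = u}.indicator 1 x) ^ 2 ∂law w κ h ≤ 2 := by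
  classical
  have hm : ∀ u : Γ, MeasurableSet {x : Config Γ K | x.1 (u⁻¹, k) = u} := fun u =>
    measurable_fst (measurableSet_edge _ u)
  have h1 : ∀ x : Config Γ K, (∑' u : Γ, {x : Config Γ K | x.1 (u⁻¹, k) = u}.indicator
      (1 : Config Γ K → ℝ≥0∞) x) ^ 2 = ∑' u : Γ, ∑' v : Γ,
        ({x : Config Γ K | x.1 (u⁻¹, k) = u} ∩ {x | x.1 (v⁻¹, k) = v}).indicator 1 x := by
    intro x
    rw [sq, ← ENNReal.tsum_mul_right]
    refine tsum_congr fun u => ?_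
    rw [← ENNReal.tsum_mul_left]
    exact tsum_congr fun v => by rw [inter_indicator_one]; rfl
  simp_rw [h1]
  have hmi : ∀ u v : Γ, Measurable (({x : Config Γ K | x.1 (u⁻¹, k) = u} ∩
      {x | x.1 (v⁻¹, k) = v}).indicator (1 : Config Γ K → ℝ≥0∞)) := fun u v =>
    measurable_one.indicator ((hm u).inter (hm v))
  rw [lintegral_tsum fun u => (Measurable.tsum fun v => hmi u v).aemeasurable]
  calc _ = ∑' u, ∑' v, law w κ h ({x : Config Γ K | x.1 (u⁻¹, k) = u} ∩ {x | x.1 (v⁻¹, k) = v}) := by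
        refine tsum_congr fun u => ?_
        rw [lintegral_tsum fun v => (hmi u v).aemeasurable]
        exact tsum_congr fun v => lintegral_indicator_one ((hm u).inter (hm v))
    _ ≤ ∑' u, ∑' v, ((if v = u then w k u else 0) + w k u * w k v) := by
        refine ENNReal.tsum_le_tsum fun u => ENNReal.tsum_le_tsum fun v => ?_
        by_cases huv : v = u
        · subst huv
          rw [inter_self, law_edge, if_pos rfl]
          exact le_self_add
        · rw [law_edge_inter_edge w κ h (by simpa using Ne.symm huv), if_neg huv, zero_add]
    _ = 2 := by
        simp_rw [ENNReal.tsum_add, tsum_ite_eq, ENNReal.tsum_mul_left, PMF.tsum_coe, mul_one,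
          PMF.tsum_coe]
        norm_num

theorem law_preimage_follow_le (h : FreeGroup ℕ →* FreeGroup ℕ) (k : ℕ) (s : Set (Config Γ K))
    (hs : MeasurableSet s) (t : ℝ≥0∞) :
    4 * t * law w κ h (follow k ⁻¹' s) ≤ 4 * t ^ 2 * law w κ h s + 2 := by
  have hm : ∀ u : Γ, MeasurableSet {x : Config Γ K | x.1 (u⁻¹, k) = u} := fun u =>
    measurable_fst (measurableSet_edge _ u)
  set d : Config Γ K → ℝ≥0∞ := fun x => ∑' u : Γ,
    {x : Config Γ K | x.1 (u⁻¹, k) = u}.indicator 1 x with hd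
  have hdm : Measurable d := Measurable.tsum fun u => measurable_one.indicator (hm u)
  have h1 : law w κ h (follow k ⁻¹' s) = ∫⁻ x in s, d x ∂law w κ h := by
    rw [law_preimage_follow w κ h k hs, hd,
      lintegral_tsum fun u => (measurable_one.indicator (hm u)).aemeasurable]
    refine tsum_congr fun u => ?_
    rw [lintegral_indicator_one (hm u), Measure.restrict_apply (hm u), inter_comm]
  rw [h1, ← lintegral_const_mul _ hdm]
  calc ∫⁻ x in s, 4 * t * d x ∂law w κ h
      ≤ ∫⁻ x in s, (4 * t ^ 2 + d x ^ 2) ∂law w κ h := by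
        refine lintegral_mono fun x => ?_
        have := two_mul_mul_le (2 * t) (d x)
        calc 4 * t * d x = 2 * (2 * t) * d x := by ring
          _ ≤ _ := this
          _ = _ := by ring
    _ = 4 * t ^ 2 * law w κ h s + ∫⁻ x in s, d x ^ 2 ∂law w κ h := by
        rw [lintegral_add_left measurable_const, setLIntegral_const]
    _ ≤ _ := by
        gcongr
        exact (setLIntegral_le_lintegral _ _).trans (lintegral_indegree_sq_le w κ h k)

end Translation

section LawModel

variable {Γ : Type*} [Group Γ] [Countable Γ] [MeasurableSpace Γ] [DiscreteMeasurableSpace Γ]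
  {K : Type*} [MulAction (FreeGroup ℕ) K] [MeasurableSpace K] [StandardBorelSpace K]
  [MeasurableConstSMul (FreeGroup ℕ) K]
  (w : ℕ → PMF Γ) (κ : Measure K) [IsProbabilityMeasure κ]

omit [IsProbabilityMeasure κ] in
theorem ae_label_follow (h : FreeGroup ℕ →* FreeGroup ℕ) (k : ℕ) :
    ∀ᵐ x ∂law w κ h, (1, k) ∈ bridges x.1 →
      (follow k x).2 1 = h (FreeGroup.of k) • x.2 1 := by
  have hm : MeasurableSet {x : Config Γ K | (1, k) ∈ bridges x.1 →
      (follow k x).2 1 = h (FreeGroup.of k) • x.2 1} := by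
    refine MeasurableSet.imp (measurable_fst (measurableSet_bridge _)) ?_
    exact measurableSet_eq_fun ((measurable_pi_apply 1).comp (measurable_snd.comp
      (measurable_follow k))) (((measurable_pi_apply 1).comp measurable_snd).const_smul _)
  rw [law, ae_map_iff (measurable_rootSpread h).aemeasurable hm]
  refine .of_forall fun x hx => ?_
  change (1, k) ∈ bridges x.1 at hx
  have ht : Tree x.1 1 (tip x.1 (1, k)) := Conn.edge hx
  have := spread_eq_of_tree h (isSelection_root x.1) x.2 ht
  rw [show colour x.1 1 _ = _ from colour_edge hx] at this
  simpa [follow, translate, rootSpread, tip] using this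

variable [NullSingletonClass κ] [SMulInvariantMeasure (FreeGroup ℕ) K κ]

omit [Group Γ] [Countable Γ] [MeasurableSpace Γ] [DiscreteMeasurableSpace Γ]
  [SMulInvariantMeasure (FreeGroup ℕ) K κ] in
theorem bern_smul_eq_smul {r r' : Γ} (hr : r ≠ r') (m m' : FreeGroup ℕ) :
    bern Γ κ {V | m • V r = m' • V r'} = 0 := by
  have hms : MeasurableSet {p : K × K | m • p.1 = m' • p.2} :=
    measurableSet_eq_fun (measurable_fst.const_smul _) (measurable_snd.const_smul _)
  have h1 := Measure.infinitePi_map_eval_prod (P := fun _ : Γ => κ) hr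
  have h2 : bern Γ κ {V | m • V r = m' • V r'} =
      ((bern Γ κ).map fun V => (V r, V r')) {p : K × K | m • p.1 = m' • p.2} := by
    rw [Measure.map_apply ((measurable_pi_apply r).prodMk (measurable_pi_apply r')) hms]
    rfl
  rw [h2, bern, h1, Measure.measure_prod_null hms]
  refine .of_forall fun x => ?_
  refine measure_mono_null (t := {m'⁻¹ • m • x}) (fun y hy => ?_) (measure_singleton (μ := κ) _)
  simp only [mem_preimage, mem_ofPred_eq] at hy
  simp [hy]

omit [Group Γ] [Countable Γ] [MeasurableSpace Γ] [DiscreteMeasurableSpace Γ]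
  [NullSingletonClass κ] [SMulInvariantMeasure (FreeGroup ℕ) K κ] in
theorem bern_smul_eq_smul_self (hκ : ∀ m : FreeGroup ℕ, m ≠ 1 → κ {t | m • t = t} = 0) (r : Γ)
    {m m' : FreeGroup ℕ} (hm : m ≠ m') : bern Γ κ {V | m • V r = m' • V r} = 0 := by
  have hms : MeasurableSet {t : K | (m'⁻¹ * m) • t = t} :=
    measurableSet_eq_fun (measurable_id.const_smul _) measurable_id
  have h1 := (measurePreserving_eval_infinitePi (fun _ : Γ => κ) r).measure_preimage
    hms.nullMeasurableSet
  rw [hκ _ (by simpa [inv_mul_eq_one] using hm.symm)] at h1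
  rw [bern, ← h1]
  congr 1
  ext V
  simp [mul_smul, inv_smul_eq_iff]

omit [SMulInvariantMeasure (FreeGroup ℕ) K κ] in
theorem ae_label_ne (hκ : ∀ m : FreeGroup ℕ, m ≠ 1 → κ {t | m • t = t} = 0)
    (h : FreeGroup ℕ →* FreeGroup ℕ) {m : FreeGroup ℕ} (hm : m ∉ h.range) (γ : Γ) :
    ∀ᵐ x ∂law w κ h, x.2 γ ≠ m • x.2 1 := by
  have hms : MeasurableSet {x : Config Γ K | x.2 γ = m • x.2 1} :=
    measurableSet_eq_fun ((measurable_pi_apply γ).comp measurable_snd)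
      (((measurable_pi_apply 1).comp measurable_snd).const_smul _)
  have key : ∀ ω : Γ × ℕ → Γ,
      bern Γ κ {V | (ω, spread h ω (root ω) V) ∈ {x : Config Γ K | x.2 γ = m • x.2 1}} = 0 := by
    intro ω
    simp only [mem_ofPred_eq, spread, smul_smul]
    by_cases hr : root ω γ = root ω 1
    · rw [hr]
      refine bern_smul_eq_smul_self κ hκ _ fun heq => hm ?_
      rw [eq_mul_inv_iff_mul_eq.mpr heq.symm, ← map_inv, ← map_mul]
      exact ⟨_, rfl⟩
    · exact bern_smul_eq_smul κ hr _ _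
  have : law w κ h {x | x.2 γ = m • x.2 1} = 0 := by
    rw [law_apply w κ h hms]
    simp_rw [key, lintegral_zero]
  rw [ae_iff]
  simpa using this

variable {w}

/-- The homomorphism killing the free generators outside `I`. -/
def keep (I : Set ℕ) : FreeGroup ℕ →* FreeGroup ℕ := by
  classical
  exact FreeGroup.lift fun k => if k ∈ I then FreeGroup.of k else 1

theorem keep_of {I : Set ℕ} {k : ℕ} (hk : k ∈ I) : keep I (FreeGroup.of k) = FreeGroup.of k := by
  simp [keep, hk]

theorem of_notMem_range_keep {I : Set ℕ} {k : ℕ} (hk : k ∉ I) :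
    FreeGroup.of k ∉ (keep I).range := by
  classical
  rintro ⟨m, hm⟩
  let φ : FreeGroup ℕ →* FreeGroup ℕ := FreeGroup.lift fun j => if j = k then FreeGroup.of k else 1
  have h1 : φ.comp (keep I) = 1 := by
    ext j
    by_cases hj : j ∈ I
    · have : j ≠ k := fun h => hk (h ▸ hj)
      simp [keep, hj, φ, this]
    · simp [keep, hj]
  have h2 := DFunLike.congr_fun h1 m
  rw [MonoidHom.comp_apply, hm] at h2
  simp [φ] at h2

theorem nonempty_model (hw : Subcritical fun k => ⇑(w k))
    (hκ : ∀ m : FreeGroup ℕ, m ≠ 1 → κ {t | m • t = t} = 0) (I : Set ℕ) :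
    Nonempty (Model (translateAction w κ (keep I)) K I) := by
  refine ⟨{
    label := fun x => x.2 1
    step := follow
    dom := fun k => {x | (1, k) ∈ bridges x.1}
    measurable_label := (measurable_pi_apply 1).comp measurable_snd
    measurable_step := measurable_follow
    measurableSet_dom := fun k => measurable_fst (measurableSet_bridge _)
    step_mem_orbit := fun k => .of_forall fun x => ⟨_, rfl⟩
    compl_dom_le := fun k => ?_
    label_step := fun k hk => ?_
    preimage_step_le := law_preimage_follow_le w κ _
    label_ne := fun k hk => ?_ }⟩
  · refine le_trans (le_of_eq ?_) (perc_not_bridge_le_of_subcritical hw k)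
    exact law_fst_preimage w κ _ (measurableSet_bridge _).compl
  · have := ae_label_follow w κ (keep I) k
    rwa [keep_of hk] at this
  · have := ae_all_iff.mpr fun γ : Γ => ae_label_ne w κ hκ (keep I) (of_notMem_range_keep hk) γ
    filter_upwards [this] with x hx
    rintro _ ⟨g, rfl⟩
    exact hx _

end LawModel

section Torus

/-- The one-dimensional torus. -/
abbrev Circ := AddCircle (1 : ℝ)

/-- The two-dimensional torus. -/
abbrev Torus := Circ × Circ

/-- The Haar probability measure of the two-dimensional torus. -/
def torusHaar : Measure Torus := AddCircle.haarAddCircle.prod AddCircle.haarAddCircle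

instance : IsProbabilityMeasure torusHaar := by unfold torusHaar; infer_instance

instance : Measure.IsAddHaarMeasure torusHaar := by unfold torusHaar; infer_instance

instance : NullSingletonClass (AddCircle.haarAddCircle (T := 1)) := by
  refine ⟨fun x => ?_⟩
  have h1 := AddCircle.volume_closedBall (1 : ℝ) (x := x) 0
  rw [AddCircle.volume_eq_smul_haarAddCircle] at h1
  simpa using h1

instance : NullSingletonClass torusHaar := by unfold torusHaar; infer_instance

open Matrix (SpecialLinearGroup)

/-- Integer matrices of determinant one act on pairs of elements of an additive group. -/
def linearAct {V : Type*} [AddCommGroup V] (A : SpecialLinearGroup (Fin 2) ℤ) (v : V × V) : V × V :=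
  (A 0 0 • v.1 + A 0 1 • v.2, A 1 0 • v.1 + A 1 1 • v.2)

section LinearAct

variable {V : Type*} [AddCommGroup V]

theorem linearAct_one (v : V × V) : linearAct 1 v = v := by simp [linearAct]

theorem linearAct_mul (A B : SpecialLinearGroup (Fin 2) ℤ) (v : V × V) :
    linearAct (A * B) v = linearAct A (linearAct B v) := by
  have h : ∀ i j, (A * B) i j = A i 0 * B 0 j + A i 1 * B 1 j := fun i j => by
    change (A.1 * B.1) i j = _
    rw [Matrix.mul_apply, Fin.sum_univ_two]
  simp only [linearAct, h, smul_add, add_smul, mul_smul]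
  ext <;> (dsimp only; abel)

theorem linearAct_sub (A : SpecialLinearGroup (Fin 2) ℤ) (v v' : V × V) :
    linearAct A (v - v') = linearAct A v - linearAct A v' := by
  simp only [linearAct, Prod.fst_sub, Prod.snd_sub, smul_sub]
  ext <;> (simp only [Prod.fst_sub, Prod.snd_sub]; abel)

theorem linearAct_zero (A : SpecialLinearGroup (Fin 2) ℤ) : linearAct A (0 : V × V) = 0 := by
  simp [linearAct]

end LinearAct

/-- The hyperbolic matrices generating a free group. -/
def gen (k : ℕ) : SpecialLinearGroup (Fin 2) ℤ :=
  ⟨!![6 * k + 3, -1 - 6 * k * (6 * k + 3); 1, -(6 * k)], by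
    rw [Matrix.det_fin_two_of]; ring⟩

theorem linearAct_gen {V : Type*} [AddCommGroup V] (k : ℕ) (v : V × V) :
    linearAct (gen k) v = ((6 * k + 3 : ℤ) • (v.1 - (6 * k : ℤ) • v.2) - v.2,
      v.1 - (6 * k : ℤ) • v.2) := by
  ext <;> simp [linearAct, gen] <;> module

theorem linearAct_gen_inv {V : Type*} [AddCommGroup V] (k : ℕ) (v : V × V) :
    linearAct (gen k)⁻¹ v = (v.2 - (6 * k : ℤ) • (v.1 - (6 * k + 3 : ℤ) • v.2),
      -(v.1 - (6 * k + 3 : ℤ) • v.2)) := by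
  have h : linearAct (gen k) (v.2 - (6 * k : ℤ) • (v.1 - (6 * k + 3 : ℤ) • v.2),
      -(v.1 - (6 * k + 3 : ℤ) • v.2)) = v := by
    rw [linearAct_gen]
    ext <;> (dsimp only; module)
  have h' := congrArg (linearAct (gen k)⁻¹) h
  rwa [← linearAct_mul, inv_mul_cancel, linearAct_one, eq_comm] at h'

/-- The representation of the free group by integer matrices. -/
def rep : FreeGroup ℕ →* SpecialLinearGroup (Fin 2) ℤ := FreeGroup.lift gen

theorem rep_injective : Function.Injective rep := by
  let V := {v : ℤ × ℤ // v ≠ 0}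
  let : MulAction (SpecialLinearGroup (Fin 2) ℤ) V :=
    { smul := fun A v => ⟨linearAct A v.1, fun h => v.2 (by
        rw [← linearAct_one v.1, ← inv_mul_cancel A, linearAct_mul, h, linearAct_zero])⟩
      one_smul := fun v => Subtype.ext (linearAct_one _)
      mul_smul := fun A B v => Subtype.ext (linearAct_mul _ _ _) }
  have hsmul : ∀ (A : SpecialLinearGroup (Fin 2) ℤ) (v : V), (A • v).1 = linearAct A v.1 :=
    fun _ _ => rfl
  let S : ℕ → Set V := fun k => {v | |v.1.1 - (6 * k + 3) * v.1.2| ≤ |v.1.2|}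
  let U : ℕ → Set V := fun k => {v | |v.1.1 - 6 * k * v.1.2| < |v.1.2|}
  have key : ∀ (v : V) (p q : ℤ), 3 ≤ |p - q| → |v.1.1 - p * v.1.2| ≤ |v.1.2| →
      |v.1.1 - q * v.1.2| ≤ |v.1.2| → False := by
    rintro ⟨⟨x, y⟩, hv⟩ p q hpq h1 h2
    simp only at h1 h2
    have h3 : |p - q| * |y| ≤ 2 * |y| := by
      rw [← abs_mul, show (p - q) * y = (x - q * y) - (x - p * y) by ring]
      exact (abs_sub _ _).trans (by linarith)
    have hy : |y| = 0 := by nlinarith [abs_nonneg y]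
    rw [hy] at h1
    have hy' : y = 0 := abs_eq_zero.mp hy
    subst hy'
    simp only [mul_zero, sub_zero] at h1
    exact hv (by simpa using h1)
  have habs : ∀ a b : ℤ, 3 ≤ |3 * a - 3 * b| ↔ a ≠ b := by
    intro a b
    constructor
    · rintro h rfl
      simp at h
    · intro h
      rw [le_abs]
      omega
  refine FreeGroup.injective_lift_of_ping_pong gen S U ?_ ?_ ?_ ?_ ?_ ?_
  · intro k
    refine ⟨⟨(6 * k + 3, 1), by simp⟩, ?_⟩
    simp [S]
  · intro i j hij
    refine disjoint_left.mpr fun v h1 h2 => key v (6 * i + 3) (6 * j + 3) ?_ h1 h2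
    have := (habs (2 * i + 1) (2 * j + 1)).mpr (by omega)
    convert this using 2; ring
  · intro i j hij
    refine disjoint_left.mpr fun v h1 h2 => key v (6 * i) (6 * j) ?_ (le_of_lt h1) (le_of_lt h2)
    have := (habs (2 * i) (2 * j)).mpr (by omega)
    convert this using 2; ring
  · intro i j
    refine disjoint_left.mpr fun v h1 h2 => key v (6 * i + 3) (6 * j) ?_ h1 (le_of_lt h2)
    have := (habs (2 * i + 1) (2 * j)).mpr (by omega)
    convert this using 2; ring
  · rintro k _ ⟨v, hv, rfl⟩
    simp only [U, mem_compl_iff, mem_ofPred_eq, not_lt] at hv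
    simp only [S, mem_ofPred_eq, hsmul, linearAct_gen, smul_eq_mul]
    refine le_of_eq_of_le ?_ hv
    rw [← abs_neg]; congr 1; ring
  · rintro k _ ⟨v, hv, rfl⟩
    simp only [S, mem_compl_iff, mem_ofPred_eq, not_le] at hv
    simp only [U, mem_ofPred_eq, Pi.inv_apply, hsmul, linearAct_gen_inv, smul_eq_mul, abs_neg]
    refine lt_of_eq_of_lt ?_ hv
    congr 1; ring

instance : MulAction (FreeGroup ℕ) Torus where
  smul m t := linearAct (rep m) t
  one_smul t := by
    change linearAct (rep 1) t = t
    rw [map_one, linearAct_one]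
  mul_smul m m' t := by
    change linearAct (rep (m * m')) t = linearAct (rep m) (linearAct (rep m') t)
    rw [map_mul, linearAct_mul]

theorem torus_smul_def (m : FreeGroup ℕ) (t : Torus) : m • t = linearAct (rep m) t := rfl

theorem of_smul_sub (k : ℕ) (t t' : Torus) :
    FreeGroup.of k • t - FreeGroup.of k • t' = linearAct (gen k) (t - t') := by
  rw [torus_smul_def, torus_smul_def, ← linearAct_sub, rep, FreeGroup.lift_apply_of]

theorem continuous_linearAct (A : SpecialLinearGroup (Fin 2) ℤ) :
    Continuous (linearAct A : Torus → Torus) := by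
  unfold linearAct; fun_prop

instance : MeasurableConstSMul (FreeGroup ℕ) Torus :=
  ⟨fun m => (continuous_linearAct (rep m)).measurable⟩

instance : SMulInvariantMeasure (FreeGroup ℕ) Torus torusHaar := by
  refine ⟨fun m s hs => ?_⟩
  let f : Torus →+ Torus :=
    { toFun := linearAct (rep m)
      map_zero' := linearAct_zero _
      map_add' := fun x y => by
        have := linearAct_sub (rep m) (x + y) y
        rwa [add_sub_cancel_right, eq_comm, sub_eq_iff_eq_add] at this }
  have hf : Function.Surjective f := fun y => ⟨linearAct (rep m)⁻¹ y, by
    change linearAct _ (linearAct _ y) = y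
    rw [← linearAct_mul, mul_inv_cancel, linearAct_one]⟩
  exact (AddMonoidHom.measurePreserving (μ := torusHaar) (ν := torusHaar)
    (continuous_linearAct (rep m)) hf rfl).measure_preimage hs.nullMeasurableSet

theorem zsmul_circ_surjective {p : ℤ} (hp : p ≠ 0) : Function.Surjective fun x : Circ => p • x := by
  intro y
  obtain ⟨r, rfl⟩ := QuotientAddGroup.mk_surjective y
  refine ⟨((r / p : ℝ) : Circ), ?_⟩
  have : (p : ℝ) ≠ 0 := by exact_mod_cast hp
  change ((p • (r / p : ℝ) : ℝ) : Circ) = r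
  rw [zsmul_eq_mul, mul_div_cancel₀ _ this]

theorem torusHaar_kernel {p q : ℤ} (h : p ≠ 0 ∨ q ≠ 0) :
    torusHaar {t | p • t.1 + q • t.2 = 0} = 0 := by
  let f : Torus →+ Circ :=
    { toFun := fun t => p • t.1 + q • t.2
      map_zero' := by simp
      map_add' := fun x y => by simp only [Prod.fst_add, Prod.snd_add, smul_add]; abel }
  have hc : Continuous f := by
    change Continuous fun t : Torus => p • t.1 + q • t.2
    fun_prop
  have hs : Function.Surjective f := by
    intro y
    rcases h with h | h
    · obtain ⟨x, hx⟩ := zsmul_circ_surjective h y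
      exact ⟨(x, 0), by simpa [f] using hx⟩
    · obtain ⟨x, hx⟩ := zsmul_circ_surjective h y
      exact ⟨(0, x), by simpa [f] using hx⟩
  have := (AddMonoidHom.measurePreserving (μ := torusHaar) (ν := AddCircle.haarAddCircle)
    hc hs (by simp)).measure_preimage (measurableSet_singleton 0).nullMeasurableSet
  rw [measure_singleton] at this
  exact this

theorem torusHaar_fixed (m : FreeGroup ℕ) (hm : m ≠ 1) : torusHaar {t | m • t = t} = 0 := by
  have h1 : rep m ≠ 1 := fun h => hm (rep_injective (h.trans (map_one rep).symm))
  by_cases h2 : rep m 0 0 - 1 ≠ 0 ∨ rep m 0 1 ≠ 0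
  · refine measure_mono_null (fun t ht => ?_) (torusHaar_kernel h2)
    have := congrArg Prod.fst (show linearAct (rep m) t = t from ht)
    simp only [linearAct] at this
    simp only [mem_ofPred_eq, sub_smul, one_smul]
    rw [← sub_eq_zero.mpr this]; abel
  · have h3 : rep m 1 0 ≠ 0 ∨ rep m 1 1 - 1 ≠ 0 := by
      by_contra h3
      push Not at h2 h3
      refine h1 (Matrix.SpecialLinearGroup.ext _ _ fun i j => ?_)
      fin_cases i <;> fin_cases j <;> simp <;> omega
    refine measure_mono_null (fun t ht => ?_) (torusHaar_kernel h3)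
    have := congrArg Prod.snd (show linearAct (rep m) t = t from ht)
    simp only [linearAct] at this
    simp only [mem_ofPred_eq, sub_smul, one_smul]
    rw [← sub_eq_zero.mpr this]; abel

end Torus

section Rigidity

theorem norm_zsmul_circ {n : ℤ} {s : Circ} (h : |(n : ℝ)| * ‖s‖ ≤ 1 / 2) :
    ‖n • s‖ = |(n : ℝ)| * ‖s‖ := by
  obtain ⟨x, rfl, hx⟩ : ∃ x : ℝ, (x : Circ) = s ∧ ‖s‖ = |x| := by
    induction s using QuotientAddGroup.induction_on with
    | H x =>
      refine ⟨x - round x, ?_, ?_⟩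
      · rw [AddCircle.coe_sub, sub_eq_self]
        have := AddCircle.coe_zsmul (p := (1 : ℝ)) (n := round x) (x := 1)
        rw [zsmul_one, AddCircle.coe_period, smul_zero] at this
        exact this
      · exact UnitAddCircle.norm_eq
  rw [hx] at h ⊢
  rw [← AddCircle.coe_zsmul, (AddCircle.norm_coe_eq_abs_iff (1 : ℝ) one_ne_zero).mpr]
  · rw [zsmul_eq_mul, abs_mul]
  · rw [zsmul_eq_mul, abs_mul]
    simpa using h

/-- The region of the torus that the `k`-th generator need not send into `high k`. -/
def low (k : ℕ) : Set Torus := {t | ‖t.1 - (6 * k : ℤ) • t.2‖ < ‖t.2‖}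

/-- The region of the torus receiving the complement of `low k`. -/
def high (k : ℕ) : Set Torus := {t | ‖t.1 - (6 * k + 3 : ℤ) • t.2‖ ≤ ‖t.2‖}

theorem measurableSet_low (k : ℕ) : MeasurableSet (low k) :=
  (isOpen_lt (by fun_prop) (by fun_prop)).measurableSet

theorem measurableSet_high (k : ℕ) : MeasurableSet (high k) :=
  (isClosed_le (by fun_prop) (by fun_prop)).measurableSet

theorem linearAct_gen_mem_high {k : ℕ} {t : Torus} (h : t ∉ low k) :
    linearAct (gen k) t ∈ high k := by
  simp only [low, mem_ofPred_eq, not_lt] at h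
  simp only [high, mem_ofPred_eq, linearAct_gen]
  refine le_of_eq_of_le ?_ h
  rw [← norm_neg]
  congr 1
  abel

theorem norm_zsmul_sub_le {s : Circ × Circ} {m n : ℤ} {i j : ℕ} (hi : i < 100) (hj : j < 100)
    (hij : i ≠ j) (hmn : m - n = 6 * ((i : ℤ) - j)) (hs : ‖s.2‖ < 1 / 1200) :
    6 * ‖s.2‖ ≤ ‖s.1 - m • s.2‖ + ‖s.1 - n • s.2‖ := by
  have h1 : 6 ≤ |m - n| := by rw [hmn, le_abs]; omega
  have h2 : |m - n| ≤ 600 := by rw [hmn, abs_le]; omega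
  have h1' : (6 : ℝ) ≤ |((m - n : ℤ) : ℝ)| := by exact_mod_cast h1
  have h2' : |((m - n : ℤ) : ℝ)| ≤ 600 := by exact_mod_cast h2
  calc 6 * ‖s.2‖ ≤ |((m - n : ℤ) : ℝ)| * ‖s.2‖ := by gcongr
    _ = ‖(m - n) • s.2‖ := (norm_zsmul_circ (by nlinarith [norm_nonneg s.2])).symm
    _ = ‖(s.1 - n • s.2) - (s.1 - m • s.2)‖ := by congr 1; rw [sub_smul]; abel
    _ ≤ ‖s.1 - n • s.2‖ + ‖s.1 - m • s.2‖ := norm_sub_le _ _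
    _ = _ := add_comm _ _

theorem notMem_low_of_mem_low {t : Torus} {i j : ℕ} (hi : i < 100) (hj : j < 100) (hij : i ≠ j)
    (ht : ‖t.2‖ < 1 / 1200) (h : t ∈ low i) : t ∉ low j := by
  intro h'
  simp only [low, mem_ofPred_eq] at h h'
  have := norm_zsmul_sub_le (s := t) (m := 6 * i) (n := 6 * j) hi hj hij (by ring) ht
  linarith [norm_nonneg t.2]

theorem eq_zero_of_mem_high {t : Torus} {i j : ℕ} (hi : i < 100) (hj : j < 100) (hij : i ≠ j)
    (ht : ‖t.2‖ < 1 / 1200) (h : t ∈ high i) (h' : t ∈ high j) : t = 0 := by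
  simp only [high, mem_ofPred_eq] at h h'
  have := norm_zsmul_sub_le (s := t) (m := 6 * i + 3) (n := 6 * j + 3) hi hj hij (by ring) ht
  have h0 : ‖t.2‖ = 0 := by linarith [norm_nonneg t.2]
  rw [h0] at h
  rw [norm_eq_zero] at h0
  rw [h0, smul_zero, sub_zero, norm_le_zero_iff] at h
  exact Prod.ext h h0

theorem sum_measureReal_le {X : Type*} [MeasurableSpace X] {μ : Measure X} [IsFiniteMeasure μ]
    {s : ℕ → Set X} {C : Set X} {n : ℕ} (hs : ∀ k, MeasurableSet (s k)) (hC : ∀ k, s k ⊆ C)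
    (hd : ∀ i < n, ∀ j < n, i ≠ j → Disjoint (s i) (s j)) :
    ∑ k ∈ Finset.range n, μ.real (s k) ≤ μ.real C := by
  rw [← measureReal_biUnion_finset (fun i hi j hj hij => hd i (by simpa using hi) j
    (by simpa using hj) hij) fun k _ => hs k]
  exact measureReal_mono (iUnion₂_subset fun k _ => hC k)

variable {Γ : Type*} [Group Γ] {X : Type*} [MeasurableSpace X] {μ : Measure X}
  {A : PmpAction Γ X μ} {I I' : Set ℕ}

theorem Model.compl_dom_le_real (M : Model A Torus I) (k : ℕ) :
    μ.real (M.dom k)ᶜ ≤ 1 / 100 := by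
  have := ENNReal.toReal_mono (by finiteness) (M.compl_dom_le k)
  rwa [ENNReal.toReal_ofReal (by norm_num)] at this

/-- The locus where two models have different labels. -/
def Model.diff (M : Model A Torus I) (N : Model A Torus I') : Set X := {x | M.label x ≠ N.label x}

theorem Model.measurableSet_diff (M : Model A Torus I) (N : Model A Torus I') :
    MeasurableSet (M.diff N) :=
  (measurableSet_eq_fun M.measurable_label N.measurable_label).compl

theorem Model.diff_comm (M : Model A Torus I) (N : Model A Torus I') : M.diff N = N.diff M := by
  ext x
  exact ne_comm

variable [IsProbabilityMeasure μ]

theorem Model.preimage_step_le_real (M : Model A Torus I) (k : ℕ) {s : Set X}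
    (hs : MeasurableSet s) {t : ℝ} (ht : 0 ≤ t) :
    4 * t * μ.real (M.step k ⁻¹' s) ≤ 4 * t ^ 2 * μ.real s + 2 := by
  have h := M.preimage_step_le k s hs (ENNReal.ofReal t)
  have h' := ENNReal.toReal_mono (by finiteness) h
  rw [ENNReal.toReal_add (by finiteness) (by finiteness)] at h'
  simpa [ENNReal.toReal_mul, ht, Measure.real] using h'

/-- Two models whose labels are close and which share the first hundred transformations outside
a small set have the same labels outside a small set. -/
theorem Model.measureReal_diff_le (M : Model A Torus I) (N : Model A Torus I')
    (hI : ∀ k < 100, k ∈ I) (hI' : ∀ k < 100, k ∈ I') {Q : Set X} (hQ : MeasurableSet Q)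
    (hQc : μ.real Qᶜ ≤ 1 / 10000)
    (hclose : ∀ x ∈ Q, ‖(M.label x - N.label x).2‖ < 1 / 1200)
    (hdom : ∀ k < 100, ∀ x ∈ Q, x ∈ M.dom k → x ∈ N.dom k)
    (hstep : ∀ k < 100, ∀ᵐ x ∂μ, x ∈ Q → M.step k x = N.step k x) :
    μ.real (M.diff N) ≤ 7 / 100 := by
  set q : X → Torus := fun x => M.label x - N.label x with hq
  have hqm : Measurable q := M.measurable_label.sub N.measurable_label
  set C := Q ∩ M.diff N with hC
  have hCm : MeasurableSet C := hQ.inter (M.measurableSet_diff N)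
  have hq0 : ∀ x, x ∈ M.diff N ↔ q x ≠ 0 := fun x => sub_ne_zero.symm
  set b : ℕ → ℝ := fun k => μ.real (C ∩ q ⁻¹' low k)
  set e : ℕ → ℝ := fun k => μ.real (C ∩ q ⁻¹' high k)
  have hb : ∑ k ∈ Finset.range 100, b k ≤ μ.real C := by
    refine sum_measureReal_le (fun k => hCm.inter (hqm (measurableSet_low k)))
      (fun k => inter_subset_left) fun i hi j hj hij => ?_
    refine disjoint_left.mpr fun x h1 h2 => ?_
    exact notMem_low_of_mem_low hi hj hij (hclose x h1.1.1) h1.2 h2.2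
  have he : ∑ k ∈ Finset.range 100, e k ≤ μ.real C := by
    refine sum_measureReal_le (fun k => hCm.inter (hqm (measurableSet_high k)))
      (fun k => inter_subset_left) fun i hi j hj hij => ?_
    refine disjoint_left.mpr fun x h1 h2 => ?_
    exact (hq0 x).mp h1.1.2 (eq_zero_of_mem_high hi hj hij (hclose x h1.1.1) h1.2 h2.2)
  have hk : ∀ k ∈ Finset.range 100, μ.real C ≤ 9 / 200 + b k + 25 * e k := by
    intro k hk
    rw [Finset.mem_range] at hk
    have hcov : μ.real C ≤ μ.real ((((M.dom k)ᶜ ∪ M.step k ⁻¹' Qᶜ) ∪ (C ∩ q ⁻¹' low k)) ∪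
        M.step k ⁻¹' (C ∩ q ⁻¹' high k)) := by
      refine ENNReal.toReal_mono (by finiteness) (measure_mono_ae ?_)
      filter_upwards [M.label_step k (hI k hk), N.label_step k (hI' k hk), hstep k hk]
        with x h1 h2 h3 hx
      by_cases hxd : x ∈ M.dom k
      swap
      · exact Or.inl (Or.inl (Or.inl hxd))
      by_cases hxQ : M.step k x ∈ Q
      swap
      · exact Or.inl (Or.inl (Or.inr hxQ))
      by_cases hxl : q x ∈ low k
      · exact Or.inl (Or.inr ⟨hx, hxl⟩)
      have hqs : q (M.step k x) = linearAct (gen k) (q x) := by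
        simp only [hq]
        rw [h1 hxd, h3 hx.1, h2 (hdom k hk x hx.1 hxd), of_smul_sub]
      refine Or.inr ⟨⟨hxQ, (hq0 _).mpr ?_⟩, ?_⟩
      · rw [hqs]
        intro h0
        apply (hq0 x).mp hx.2
        rw [← linearAct_one (q x), ← inv_mul_cancel (gen k), linearAct_mul, h0, linearAct_zero]
      · rw [mem_preimage, hqs]
        exact linearAct_gen_mem_high hxl
    have h1 := M.preimage_step_le_real k hQ.compl (t := 50) (by norm_num)
    have h2 := M.preimage_step_le_real k (hCm.inter (hqm (measurableSet_high k))) (t := 25)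
      (by norm_num)
    have h3 := M.compl_dom_le_real k
    have h4 := measureReal_union_le (μ := μ) (((M.dom k)ᶜ ∪ M.step k ⁻¹' Qᶜ) ∪ (C ∩ q ⁻¹' low k))
      (M.step k ⁻¹' (C ∩ q ⁻¹' high k))
    have h5 := measureReal_union_le (μ := μ) ((M.dom k)ᶜ ∪ M.step k ⁻¹' Qᶜ) (C ∩ q ⁻¹' low k)
    have h6 := measureReal_union_le (μ := μ) (M.dom k)ᶜ (M.step k ⁻¹' Qᶜ)
    simp only [b, e]
    linarith
  have hsum := Finset.sum_le_sum hk
  rw [Finset.sum_add_distrib, Finset.sum_add_distrib, ← Finset.mul_sum] at hsum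
  simp only [Finset.sum_const, Finset.card_range, nsmul_eq_mul] at hsum
  push_cast at hsum
  have hfin : μ.real (M.diff N) ≤ μ.real Qᶜ + μ.real C := by
    refine (measureReal_mono fun x hx => ?_).trans (measureReal_union_le _ _)
    by_cases hxQ : x ∈ Q
    · exact Or.inr ⟨hxQ, hx⟩
    · exact Or.inl hxQ
  linarith

/-- Models with mostly equal labels have comparable sets of generators. -/
theorem Model.subset_of_measureReal_diff_le (M : Model A Torus I) (N : Model A Torus I')
    (h : μ.real (M.diff N) ≤ 7 / 100) : I ⊆ I' := by
  intro k hk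
  by_contra hk'
  have hcov : μ.real univ ≤ μ.real ((M.diff N ∪ (M.dom k)ᶜ) ∪ M.step k ⁻¹' M.diff N) := by
    refine ENNReal.toReal_mono (by finiteness) (measure_mono_ae ?_)
    filter_upwards [M.label_step k hk, N.label_ne k hk', M.step_mem_orbit k] with x h1 h2 h3 _
    by_cases hxd : x ∈ M.dom k
    swap
    · exact Or.inl (Or.inr hxd)
    by_cases hx1 : x ∈ M.diff N
    · exact Or.inl (Or.inl hx1)
    refine Or.inr fun hx2 => h2 _ h3 ?_
    simp only [diff, mem_ofPred_eq, not_not] at hx1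
    rw [← hx2, h1 hxd, hx1]
  have h1 := M.preimage_step_le_real k (M.measurableSet_diff N) (t := 2) (by norm_num)
  have h2 := M.compl_dom_le_real k
  have h3 := measureReal_union_le (μ := μ) (M.diff N ∪ (M.dom k)ᶜ) (M.step k ⁻¹' M.diff N)
  have h4 := measureReal_union_le (μ := μ) (M.diff N) (M.dom k)ᶜ
  simp only [probReal_univ] at hcov
  linarith

end Rigidity

section Pigeonhole

theorem exists_forall_nhds_ne {T Z : Type*} [Uncountable T] [TopologicalSpace Z]
    [SecondCountableTopology Z] (f : T → Z) : ∃ i, ∀ U ∈ 𝓝 (f i), ∃ j, j ≠ i ∧ f j ∈ U := by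
  by_contra! h
  choose U hU hne using h
  choose V hV hfV hVU using fun i =>
    (TopologicalSpace.isBasis_countableBasis Z).mem_nhds_iff.mp (hU i)
  have hinj : Function.Injective
      fun i => (⟨V i, hV i⟩ : TopologicalSpace.countableBasis Z) := fun i j hij => by
    by_contra hne'
    refine hne i j (Ne.symm hne') (hVU i ?_)
    rw [show V i = V j from congrArg Subtype.val hij]
    exact hfV j
  have : Countable (TopologicalSpace.countableBasis Z) :=
    (TopologicalSpace.countable_countableBasis Z).to_subtype
  exact not_countable (α := T) hinj.countable

theorem inv_sq_le_abs_sub {a b N : ℕ} (h : a ≠ b) (ha : a < N) :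
    1 / ((N : ℝ) + 1) ^ 2 ≤ |1 / ((a : ℝ) + 1) - 1 / ((b : ℝ) + 1)| := by
  have ha' : (a : ℝ) + 1 ≤ N := by exact_mod_cast ha
  have e : 1 / ((a : ℝ) + 1) - 1 / ((b : ℝ) + 1) =
      ((b : ℝ) - a) / (((a : ℝ) + 1) * ((b : ℝ) + 1)) := by
    field_simp
    ring
  have hN : ((a : ℝ) + 1) * ((a : ℝ) + 2) ≤ ((N : ℝ) + 1) ^ 2 := by
    have : (0 : ℝ) ≤ a := a.cast_nonneg
    nlinarith
  rw [e, abs_div, abs_of_pos (a := ((a : ℝ) + 1) * ((b : ℝ) + 1)) (by positivity),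
    div_le_div_iff₀ (by positivity) (by positivity), one_mul]
  have h1 : (1 : ℝ) ≤ |(b : ℝ) - a| := by
    have : 1 ≤ |(b : ℤ) - a| := Int.one_le_abs (by omega)
    exact_mod_cast this
  have h2 : (b : ℝ) + 1 ≤ |(b : ℝ) - a| * (a + 2) := by
    have : (0 : ℝ) ≤ a := a.cast_nonneg
    nlinarith [le_abs_self ((b : ℝ) - a)]
  calc ((a : ℝ) + 1) * ((b : ℝ) + 1) ≤ (a + 1) * (|(b : ℝ) - a| * (a + 2)) := by gcongr
    _ = |(b : ℝ) - a| * ((a + 1) * (a + 2)) := by ring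
    _ ≤ _ := by gcongr

/-- Among uncountably many measurable functions to a countable set, two agree outside a set of
small measure. -/
theorem exists_ne_measure_ne_le {T X δ : Type*} [Uncountable T] [MeasurableSpace X]
    [StandardBorelSpace X] {μ : Measure X} [IsProbabilityMeasure μ] [Countable δ]
    [MeasurableSpace δ] [DiscreteMeasurableSpace δ] {f : T → X → δ} (hf : ∀ i, Measurable (f i))
    {η : ℝ≥0∞} (hη : η ≠ 0) : ∃ i j, i ≠ j ∧ μ {x | f i x ≠ f j x} ≤ η := by
  obtain ⟨enc, henc⟩ := Countable.exists_injective_nat δ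
  let n : T → X → ℕ := fun i x => enc (f i x)
  have hn : ∀ i, Measurable (n i) := fun i => (measurable_of_countable enc).comp (hf i)
  let g : T → X → ℝ := fun i x => 1 / ((n i x : ℝ) + 1)
  have hgm : ∀ i, Measurable (g i) := fun i => by
    have := (measurable_of_countable fun n : ℕ => 1 / ((n : ℝ) + 1)).comp (hn i)
    exact this
  have hg : ∀ i, MemLp (g i) 1 μ := fun i => by
    refine MemLp.of_bound (hgm i).aestronglyMeasurable 1 (ae_of_all _ fun x => ?_)
    have : (0 : ℝ) ≤ n i x := Nat.cast_nonneg _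
    rw [Real.norm_of_nonneg (by positivity), div_le_one (by positivity)]
    linarith
  have : Fact ((1 : ℝ≥0∞) ≠ ∞) := ⟨one_ne_top⟩
  obtain ⟨i, hi⟩ := exists_forall_nhds_ne fun i => (hg i).toLp (g i)
  have hη2 : 0 < η / 2 := ENNReal.half_pos hη
  obtain ⟨N, hN⟩ : ∃ N : ℕ, μ {x | N ≤ n i x} ≤ η / 2 := by
    have h := tendsto_measure_iInter_atTop (μ := μ) (s := fun N : ℕ => {x | N ≤ n i x})
      (fun N => (measurableSet_le measurable_const (hn i)).nullMeasurableSet)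
      (fun a b hab x hx => le_trans hab hx) ⟨0, by finiteness⟩
    have h0 : ⋂ N : ℕ, {x | N ≤ n i x} = ∅ := by
      ext x
      simp only [mem_iInter, mem_ofPred_eq, mem_empty_iff_false, iff_false, not_forall, not_le]
      exact ⟨_, Nat.lt_succ_self _⟩
    rw [h0, measure_empty] at h
    exact (h.eventually_le_const hη2).exists
  set c : ℝ≥0∞ := ENNReal.ofReal (1 / ((N : ℝ) + 1) ^ 2) with hc
  have hc0 : c ≠ 0 := by
    rw [hc, Ne, ENNReal.ofReal_eq_zero, not_le]
    positivity
  have hct : c ≠ ∞ := ofReal_ne_top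
  obtain ⟨j, hji, hj⟩ := hi (Metric.eball _ (c * (η / 2)))
    (Metric.eball_mem_nhds _ (pos_iff_ne_zero.mpr (mul_ne_zero hc0 hη2.ne')))
  refine ⟨i, j, hji.symm, ?_⟩
  rw [Metric.mem_eball, edist_comm, Lp.edist_toLp_toLp, eLpNorm_one_eq_lintegral_enorm] at hj
  have hM := mul_meas_ge_le_lintegral (μ := μ) ((hgm i).sub (hgm j)).enorm c
  have hsmall : μ {x | c ≤ ‖(g i - g j) x‖ₑ} ≤ η / 2 :=
    (ENNReal.mul_le_mul_iff_right hc0 hct).mp (hM.trans hj.le)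
  calc μ {x | f i x ≠ f j x} ≤ μ ({x | N ≤ n i x} ∪ {x | c ≤ ‖(g i - g j) x‖ₑ}) := by
        refine measure_mono fun x hx => ?_
        by_cases hxN : N ≤ n i x
        · exact Or.inl hxN
        refine Or.inr ?_
        rw [mem_ofPred_eq, ← ofReal_norm, hc]
        exact ENNReal.ofReal_le_ofReal
          (inv_sq_le_abs_sub (fun h => hx (henc h)) (not_le.mp hxN))
    _ ≤ η / 2 + η / 2 := (measure_union_le _ _).trans (add_le_add hN hsmall)
    _ = η := ENNReal.add_halves η

end Pigeonhole

section Data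

/-- The index of the cell of length `1 / 1200` containing a point of the circle. -/
def cell (t : Circ) : ℤ := ⌊1200 * (AddCircle.measurableEquivIco 1 0 t : ℝ)⌋

theorem measurable_cell : Measurable cell :=
  Int.measurable_floor.comp
    ((measurable_subtype_coe.comp (AddCircle.measurableEquivIco 1 0).measurable).const_mul 1200)

theorem norm_sub_lt_of_cell_eq {t s : Circ} (h : cell t = cell s) : ‖t - s‖ < 1 / 1200 := by
  have h1 := Int.abs_sub_lt_one_of_floor_eq_floor h
  rw [← mul_sub, abs_mul, abs_of_pos (by norm_num : (0 : ℝ) < 1200)] at h1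
  have e : t - s = ((AddCircle.measurableEquivIco 1 0 t - AddCircle.measurableEquivIco 1 0 s : ℝ) :
      Circ) := by
    rw [AddCircle.coe_sub]
    exact congrArg₂ _ AddCircle.coe_equivIco.symm AddCircle.coe_equivIco.symm
  rw [e]
  refine lt_of_le_of_lt QuotientAddGroup.norm_mk_le_norm ?_
  rw [Real.norm_eq_abs]
  linarith

variable {Γ : Type*} [Group Γ] [Countable Γ] {X : Type*} [MeasurableSpace X] [StandardBorelSpace X]
  {μ : Measure X} {A : PmpAction Γ X μ}

theorem exists_orbit_index (A : PmpAction Γ X μ) :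
    ∃ (γ : ℕ → Γ) (index : (X → X) → X → ℕ), (∀ S, Measurable S → Measurable (index S)) ∧
      ∀ S x, S x ∈ A.orbit x → S x = A.act (γ (index S x)) x := by
  classical
  obtain ⟨γ, hγ⟩ := exists_surjective_nat Γ
  have hex : ∀ (S : X → X) (x : X), ∃ n, S x = A.act (γ n) x ∨ ∀ m, S x ≠ A.act (γ m) x := by
    intro S x
    by_cases h : ∃ m, S x = A.act (γ m) x
    · exact h.imp fun m hm => Or.inl hm
    · exact ⟨0, Or.inr (not_exists.mp h)⟩
  refine ⟨γ, fun S x => Nat.find (hex S x), fun S hS => measurable_find (hex S) fun k => ?_,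
    fun S x hx => ?_⟩
  · have h : ∀ m, MeasurableSet {x | S x = A.act (γ m) x} := fun m =>
      measurableSet_eq_fun hS (A.measurable _)
    rw [ofPred_or, ofPred_forall]
    exact (h k).union (MeasurableSet.iInter fun m => (h m).compl)
  · refine (Nat.find_spec (hex S x)).resolve_right fun h => ?_
    obtain ⟨g, hg⟩ := hx
    obtain ⟨m, rfl⟩ := hγ g
    exact h m hg

/-- An action has only countably many models based on different sets of generators, provided
these contain the first hundred generators. -/
theorem not_injective_of_model [IsProbabilityMeasure μ] {T : Type*} [Uncountable T]
    {I : T → Set ℕ} (hI : ∀ i, ∀ k < 100, k ∈ I i) (M : ∀ i, Model A Torus (I i)) :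
    ¬ Function.Injective I := by
  classical
  intro hinj
  obtain ⟨γ, index, hindex, hspec⟩ := exists_orbit_index A
  let D : T → X → ℤ × (Fin 100 → ℕ × Prop) := fun i x =>
    (cell ((M i).label x).2, fun k => (index ((M i).step k) x, x ∈ (M i).dom k))
  have hD : ∀ i, Measurable (D i) := fun i =>
    (measurable_cell.comp (M i).measurable_label.snd).prodMk <| measurable_pi_lambda _ fun k =>
      (hindex _ ((M i).measurable_step k)).prodMk ((M i).measurableSet_dom k).mem
  obtain ⟨i, j, hij, hμ⟩ := exists_ne_measure_ne_le (μ := μ) hD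
    (η := ENNReal.ofReal (1 / 10000)) (by simp)
  have hQ : MeasurableSet {x | D i x = D j x} := measurableSet_eq_fun (hD i) (hD j)
  have hdiff : μ.real ((M i).diff (M j)) ≤ 7 / 100 := by
    refine (M i).measureReal_diff_le (M j) (hI i) (hI j) hQ ?_ ?_ ?_ ?_
    · have := ENNReal.toReal_mono ofReal_ne_top hμ
      rwa [ENNReal.toReal_ofReal (by norm_num)] at this
    · exact fun x hx => norm_sub_lt_of_cell_eq (congrArg Prod.fst hx)
    · intro k hk x hx
      have := congrArg (fun p => (p.2 ⟨k, hk⟩).2) hx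
      exact this.mp
    · intro k hk
      filter_upwards [(M i).step_mem_orbit k, (M j).step_mem_orbit k] with x h1 h2 hx
      rw [hspec _ _ h1, hspec _ _ h2]
      have := congrArg (fun p => (p.2 ⟨k, hk⟩).1) hx
      exact congrArg (fun n => A.act (γ n) x) this
  refine hij (hinj (((M i).subset_of_measureReal_diff_le (M j) hdiff).antisymm
    ((M j).subset_of_measureReal_diff_le (M i) ?_)))
  rwa [Model.diff_comm]

end Data

section Family

variable {Γ : Type*} [Group Γ] {X : Type*} [MeasurableSpace X] {μ : Measure X}

/-- Orbit equivalence of the members of a family of actions. -/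
def orbitSetoid {ι : Type*} (B : ι → PmpAction Γ X μ) : Setoid ι where
  r i j := OrbitEquivalent (B i) (B j)
  iseqv := ⟨fun _ => orbitEquivalent_refl _, orbitEquivalent_symm, orbitEquivalent_trans⟩

theorem uncountable_quotient {ι : Type*} [Uncountable ι] (s : Setoid ι)
    (h : ∀ i, Countable {j // s j i}) : Uncountable (Quotient s) := by
  by_contra hc
  rw [not_uncountable_iff] at hc
  refine not_countable (α := ι) ?_
  have : Countable (Σ q : Quotient s, {j // s j q.out}) := inferInstance
  refine Function.Injective.countable
    (f := fun i : ι => (⟨⟦i⟧, i, Quotient.exact (Quotient.out_eq ⟦i⟧).symm⟩ : Σ q : Quotient s, {j // s j q.out})) ?_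
  intro i j hij
  simp only [Sigma.mk.injEq] at hij
  have key : ∀ {q q' : Quotient s} {a : {j // s j q.out}} {b : {j // s j q'.out}}, q = q' →
      a ≍ b → a.1 = b.1 := by
    rintro q _ a b rfl hab
    rw [eq_of_heq hab]
  exact key hij.1 hij.2

theorem uncountable_set_nat : Uncountable (Set ℕ) := by
  by_contra h
  rw [not_uncountable_iff] at h
  obtain ⟨f, hf⟩ := exists_surjective_nat (Set ℕ)
  exact Function.cantor_surjective f hf

/-- The set of generators consisting of the first hundred generators and a shifted copy of `J`. -/
def generators (J : Set ℕ) : Set ℕ := {k | k < 100 ∨ ∃ j ∈ J, k = j + 100}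

theorem generators_injective : Function.Injective generators := by
  have h : ∀ J j, j + 100 ∈ generators J ↔ j ∈ J := fun J j => by simp [generators]
  intro J J' hJ
  ext j
  rw [← h J, hJ, h]

end Family

end OEMixing

open OEMixing

/-- Every nonamenable countable discrete group admits uncountably many pairwise
non-orbit-equivalent free mixing pmp actions on a nonatomic standard probability space. -/
theorem uncountably_many_non_OE_mixing_actions (Γ : Type) [Group Γ] [Countable Γ]
    (hna : ¬ IsAmenable Γ) :
    ∃ (X : Type) (_ : MeasurableSpace X) (μ : Measure X),
      StandardBorelSpace X ∧ IsProbabilityMeasure μ ∧ NoAtoms μ ∧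
      ∃ (ι : Type) (_ : Uncountable ι) (A : ι → PmpAction Γ X μ),
        (∀ i, (A i).IsFree ∧ (A i).IsMixing) ∧
        ∀ i j, i ≠ j → ¬ OrbitEquivalent (A i) (A j) := by
  let : MeasurableSpace Γ := ⊤
  have : DiscreteMeasurableSpace Γ := ⟨fun _ => trivial⟩
  obtain ⟨v, hv⟩ := exists_subcritical hna
  let w : ℕ → PMF Γ := fun k => ⟨v k, by rw [← (hv k).tsum_eq]; exact ENNReal.summable.hasSum⟩
  have hw : Subcritical fun k => ⇑(w k) := hv
  let B : Set ℕ → PmpAction Γ (Config Γ Torus) (law w torusHaar 1) := fun J =>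
    conjAction (retwist (keep (generators J)))
      ⟨(retwist _).measurable, law_map_retwist w torusHaar _⟩
      (translateAction w torusHaar (keep (generators J)))
  have hM : ∀ J, Nonempty (Model (B J) Torus (generators J)) := fun J =>
    (nonempty_model torusHaar hw torusHaar_fixed (generators J)).elim fun M =>
      M.transport (orbitEquivalent_symm orbitEquivalent_conjAction)
  have := uncountable_set_nat
  have : StandardBorelSpace Torus := inferInstance
  have hcount : ∀ J, Countable {J' // orbitSetoid B J' J} := by
    intro J
    by_contra hc
    rw [not_countable_iff] at hc
    have hMJ : ∀ J' : {J' // orbitSetoid B J' J}, Nonempty (Model (B J) Torus (generators J'.1)) :=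
      fun J' => (hM J'.1).elim fun M => M.transport J'.2
    exact not_injective_of_model (fun J' k hk => Or.inl hk) (fun J' => (hMJ J').some)
      (generators_injective.comp Subtype.val_injective)
  refine ⟨Config Γ Torus, inferInstance, law w torusHaar 1, inferInstance, inferInstance,
    noAtoms_law torusHaar hw 1, Quotient (orbitSetoid B), uncountable_quotient _ hcount,
    fun q => B q.out, fun q => ⟨isFree_conjAction (isFree_translateAction torusHaar hw _),
      isMixing_conjAction (isMixing_translateAction torusHaar hw _)⟩, fun p q hpq h => hpq ?_⟩
  rw [← Quotient.out_eq p, ← Quotient.out_eq q]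
  exact Quotient.sound h

end
end

section
/- Let Γ be an infinite group generated by a finite generating family S = (s_1, …, s_d) and let G = Cay(Γ, S). Then p_c(G) ≤ 1 / (ι_E(G) + 1). -/
open MeasureTheory Set

noncomputable section

variable {Γ : Type} [Group Γ] {d : ℕ}

/-- The edge `(g, i)` of the Cayley graph `Cay(Γ, S)` joins the vertices `g` and `g * S i`;
`Joins S e u v` says that the edge `e` joins the vertices `u` and `v` (in either order). -/
def Joins (S : Fin d → Γ) (e : Γ × Fin d) (u v : Γ) : Prop :=
  (u = e.1 ∧ v = e.1 * S e.2) ∨ (v = e.1 ∧ u = e.1 * S e.2)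

/-- `u` and `v` are connected by a path of `ω`-open edges. -/
def OpenConn (S : Fin d → Γ) (ω : Γ × Fin d → Bool) (u v : Γ) : Prop :=
  Relation.ReflTransGen (fun a b => ∃ e, ω e = true ∧ Joins S e a b) u v

/-- The cluster (connected component) of the vertex `v` in the configuration `ω`. -/
def Cluster (S : Fin d → Γ) (ω : Γ × Fin d → Bool) (v : Γ) : Set Γ :=
  {u | OpenConn S ω v u}

/-- `P` is Bernoulli(`p`) bond percolation on `Cay(Γ, S)`: the product probability measure on
`{0,1}^E` under which each edge is independently open with probability `p`. -/
def IsBernoulli (S : Fin d → Γ) (p : ℝ) (P : Measure (Γ × Fin d → Bool)) : Prop :=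
  IsProbabilityMeasure P ∧
    ∀ (s : Finset (Γ × Fin d)) (f : Γ × Fin d → Bool),
      P {ω | ∀ e ∈ s, ω e = f e} = ∏ e ∈ s, ENNReal.ofReal (if f e then p else 1 - p)

/-- The event that there is an infinite cluster. -/
def PercEvent (S : Fin d → Γ) : Set (Γ × Fin d → Bool) :=
  {ω | ∃ v, (Cluster S ω v).Infinite}

/-- The critical probability `p_c(Cay(Γ, S))`: the infimum of the set of `p ∈ [0,1]` such that
Bernoulli(`p`) bond percolation almost surely produces an infinite cluster. -/
def pc (S : Fin d → Γ) : ℝ :=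
  sInf {p | p ∈ Icc (0:ℝ) 1 ∧
    ∀ P : Measure (Γ × Fin d → Bool), IsBernoulli S p P → P (PercEvent S) = 1}

/-- The set of edges of `Cay(Γ, S)` with exactly one endpoint in `F`. -/
def edgeBoundary (S : Fin d → Γ) (F : Finset Γ) : Set (Γ × Fin d) :=
  {e | Xor' (e.1 ∈ F) (e.1 * S e.2 ∈ F)}

/-- The edge-isoperimetric constant `ι_E(Cay(Γ, S))`. -/
def iotaE (S : Fin d → Γ) : ℝ :=
  sInf {r | ∃ F : Finset Γ, F.Nonempty ∧ r = ((edgeBoundary S F).ncard : ℝ) / (F.card : ℝ)}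

/-- A configuration in which the finite set `W` is enclosed, inside `Λ`, by closed edges. -/
def EnclosedEvent (S : Fin d → Γ) (Λ W : Finset Γ) : Set (Γ × Fin d → Bool) :=
  {ω | ∃ F : Finset Γ, W ⊆ F ∧ F ⊆ Λ ∧ ∀ e ∈ edgeBoundary S F, ω e = false}

/-- The cylinder of configurations that are open on `A` and closed on `B`. -/
def openClosedCylinder (A B : Finset (Γ × Fin d)) : Set (Γ × Fin d → Bool) :=
  {ω | (∀ e ∈ A, ω e = true) ∧ ∀ e ∈ B, ω e = false}

theorem edgeBoundary_finite (S : Fin d → Γ) (F : Finset Γ) : (edgeBoundary S F).Finite := by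
  refine ((F.finite_toSet.prod (Set.finite_univ (α := Fin d))).union
    ((F.finite_toSet.prod (Set.finite_univ (α := Fin d))).image
      fun x => (x.1 * (S x.2)⁻¹, x.2))).subset ?_
  rintro ⟨g, i⟩ (h | h)
  · exact Or.inl ⟨h.1, mem_univ _⟩
  · exact Or.inr ⟨(g * S i, i), ⟨h.1, mem_univ _⟩, by simp⟩

theorem iotaE_nonneg (S : Fin d → Γ) : 0 ≤ iotaE S := by
  apply Real.sInf_nonneg
  rintro r ⟨F, -, rfl⟩
  positivity

theorem iotaE_mul_card_le (S : Fin d → Γ) (F : Finset Γ) :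
    iotaE S * F.card ≤ (edgeBoundary S F).ncard := by
  rcases F.eq_empty_or_nonempty with rfl | hF
  · simp
  · have hc : (0 : ℝ) < F.card := by exact_mod_cast hF.card_pos
    rw [← le_div_iff₀ hc]
    refine csInf_le ⟨0, ?_⟩ ⟨F, hF, rfl⟩
    rintro r ⟨F, -, rfl⟩
    positivity

theorem exists_endpoint_of_mem_edgeBoundary {S : Fin d → Γ} {W : Finset Γ} {e : Γ × Fin d}
    (he : e ∈ edgeBoundary S W) :
    ∃ u ∉ W, (∀ F : Finset Γ, W ⊆ F → e ∉ edgeBoundary S F → u ∈ F) ∧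
      (e.1 = u ∨ e.1 ∈ W) ∧ (e.1 * S e.2 = u ∨ e.1 * S e.2 ∈ W) := by
  rcases he with ⟨h, h'⟩ | ⟨h, h'⟩
  · refine ⟨_, h', fun F hWF hF => ?_, Or.inr h, Or.inl rfl⟩
    by_contra hn
    exact hF (Or.inl ⟨hWF h, hn⟩)
  · refine ⟨_, h', fun F hWF hF => ?_, Or.inl rfl, Or.inr h⟩
    by_contra hn
    exact hF (Or.inr ⟨hWF h, hn⟩)

theorem IsBernoulli.measure_openClosedCylinder {S : Fin d → Γ} {p : ℝ}
    {P : Measure (Γ × Fin d → Bool)} (hP : IsBernoulli S p P) (hp0 : 0 ≤ p) (hp1 : p ≤ 1)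
    {A B : Finset (Γ × Fin d)} (hAB : Disjoint A B) :
    P (openClosedCylinder A B) = ENNReal.ofReal (p ^ A.card * (1 - p) ^ B.card) := by
  classical
  have hB : ∀ e ∈ B, e ∉ A := fun e he he' => Finset.disjoint_left.1 hAB he' he
  have hset : openClosedCylinder A B = {ω | ∀ e ∈ A ∪ B, ω e = decide (e ∈ A)} := by
    ext ω
    simp only [openClosedCylinder, mem_ofPred_eq, Finset.mem_union]
    constructor
    · rintro ⟨h1, h2⟩ e (he | he)
      · simp [h1 e he, he]
      · simp [h2 e he, hB e he]
    · intro h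
      refine ⟨fun e he => ?_, fun e he => ?_⟩
      · simpa [he] using h e (Or.inl he)
      · simpa [hB e he] using h e (Or.inr he)
  rw [hset, hP.2, Finset.prod_union hAB, ENNReal.ofReal_mul (by positivity),
    ENNReal.ofReal_pow hp0, ENNReal.ofReal_pow (by linarith)]
  congr 1
  · rw [Finset.prod_congr rfl (g := fun _ => ENNReal.ofReal p)]
    · simp
    · intro e he
      simp [he]
  · rw [Finset.prod_congr rfl (g := fun _ => ENNReal.ofReal (1 - p))]
    · simp
    · intro e he
      simp [hB e he]

/-- Exploring the edges one at a time: given that the edges of `A` are open, those of `B` closed,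
and `W` contains the endpoints of `A`, the probability that `W` is enclosed by closed edges decays
exponentially in the size of `W`. -/
theorem IsBernoulli.measure_cylinder_inter_enclosedEvent_le {S : Fin d → Γ} {p t : ℝ}
    {P : Measure (Γ × Fin d → Bool)} (hP : IsBernoulli S p P) (hp0 : 0 ≤ p) (hp1 : p ≤ 1)
    (ht : 0 ≤ t) (hpt : p * Real.exp (-(t * iotaE S)) + (1 - p) * Real.exp t ≤ 1)
    (Λ : Finset Γ) (M : Finset (Γ × Fin d))
    (hM : ∀ W ⊆ Λ, edgeBoundary S W ⊆ M) (n : ℕ) :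
    ∀ (A B : Finset (Γ × Fin d)) (W : Finset Γ), Disjoint A B →
      ((M : Set (Γ × Fin d)) \ (A ∪ B)).ncard < n →
      (∀ e ∈ A, e.1 ∈ W ∧ e.1 * S e.2 ∈ W) →
      P (openClosedCylinder A B ∩ EnclosedEvent S Λ W) ≤
        ENNReal.ofReal (p ^ A.card * (1 - p) ^ B.card *
          Real.exp (t * (B.card - iotaE S * W.card))) := by
  classical
  have hq : 0 ≤ 1 - p := by linarith
  induction n with
  | zero => exact fun A B W _ hn => absurd hn (Nat.not_lt_zero _)
  | succ n ih =>
    intro A B W hAB hn hA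
    by_cases hWΛ : W ⊆ Λ
    swap
    · have : EnclosedEvent S Λ W = ∅ := by
        ext ω
        simp only [EnclosedEvent, mem_ofPred_eq, mem_empty_iff_false, iff_false]
        rintro ⟨F, h1, h2, -⟩
        exact hWΛ (h1.trans h2)
      simp [this]
    have hAW : ∀ e ∈ A, e ∉ edgeBoundary S W := by
      rintro e he (h | h)
      · exact h.2 (hA e he).2
      · exact h.2 (hA e he).1
    by_cases hBW : edgeBoundary S W ⊆ B
    · refine (measure_mono inter_subset_left).trans ?_
      rw [hP.measure_openClosedCylinder hp0 hp1 hAB]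
      apply ENNReal.ofReal_le_ofReal
      refine le_mul_of_one_le_right (by positivity) (Real.one_le_exp (mul_nonneg ht ?_))
      have h1 := iotaE_mul_card_le S W
      have h2 : (edgeBoundary S W).ncard ≤ B.card := by
        rw [← Set.ncard_coe_finset]
        exact Set.ncard_le_ncard hBW B.finite_toSet
      have h3 : ((edgeBoundary S W).ncard : ℝ) ≤ B.card := by exact_mod_cast h2
      linarith
    obtain ⟨e, heW, heB⟩ := Set.not_subset.1 hBW
    have heA : e ∉ A := fun h => hAW e h heW
    have heB' : e ∉ B := heB
    obtain ⟨u, huW, huF, hu1, hu2⟩ := exists_endpoint_of_mem_edgeBoundary heW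
    have hlt : ∀ A' B' : Finset (Γ × Fin d), A ⊆ A' → B ⊆ B' → (e ∈ A' ∨ e ∈ B') →
        ((M : Set (Γ × Fin d)) \ (A' ∪ B')).ncard < n := by
      intro A' B' hA' hB' he
      refine lt_of_lt_of_le (Set.ncard_lt_ncard ?_ (M.finite_toSet.sdiff))
        (Nat.lt_succ_iff.1 hn)
      refine ⟨Set.sdiff_subset_sdiff_right (Set.union_subset_union hA' hB'), fun h => ?_⟩
      exact (h ⟨hM W hWΛ heW, fun h => h.elim heA heB⟩).2 he
    have hopen := ih (insert e A) B (insert u W)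
      (Finset.disjoint_insert_left.2 ⟨heB', hAB⟩)
      (hlt _ _ (Finset.subset_insert _ _) subset_rfl (Or.inl (Finset.mem_insert_self _ _)))
      (by
        intro x hx
        rcases Finset.mem_insert.1 hx with rfl | hx
        · exact ⟨Finset.mem_insert.2 hu1, Finset.mem_insert.2 hu2⟩
        · exact ⟨Finset.mem_insert_of_mem (hA x hx).1, Finset.mem_insert_of_mem (hA x hx).2⟩)
    have hclosed := ih A (insert e B) W
      (Finset.disjoint_insert_right.2 ⟨heA, hAB⟩)
      (hlt _ _ subset_rfl (Finset.subset_insert _ _) (Or.inr (Finset.mem_insert_self _ _))) hA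
    have hsub : openClosedCylinder A B ∩ EnclosedEvent S Λ W ⊆
        (openClosedCylinder (insert e A) B ∩ EnclosedEvent S Λ (insert u W)) ∪
        (openClosedCylinder A (insert e B) ∩ EnclosedEvent S Λ W) := by
      rintro ω ⟨⟨h1, h2⟩, F, hWF, hFΛ, hF⟩
      cases hω : ω e with
      | true =>
        refine Or.inl ⟨⟨?_, h2⟩, F, Finset.insert_subset (huF F hWF fun h => ?_) hWF, hFΛ, hF⟩
        · simpa [hω] using h1
        · simp [hF e h] at hω
      | false => exact Or.inr ⟨⟨h1, by simpa [hω] using h2⟩, F, hWF, hFΛ, hF⟩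
    refine (measure_mono hsub).trans ((measure_union_le _ _).trans
      ((add_le_add hopen hclosed).trans ?_))
    rw [← ENNReal.ofReal_add (by positivity) (by positivity)]
    apply ENNReal.ofReal_le_ofReal
    rw [Finset.card_insert_of_notMem heA, Finset.card_insert_of_notMem heB',
      Finset.card_insert_of_notMem huW]
    push_cast
    have e1 : Real.exp (t * (B.card - iotaE S * (W.card + 1))) =
        Real.exp (t * (B.card - iotaE S * W.card)) * Real.exp (-(t * iotaE S)) := by
      rw [← Real.exp_add]; ring_nf
    have e2 : Real.exp (t * (B.card + 1 - iotaE S * W.card)) =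
        Real.exp (t * (B.card - iotaE S * W.card)) * Real.exp t := by
      rw [← Real.exp_add]; ring_nf
    rw [e1, e2]
    calc _ = p ^ A.card * (1 - p) ^ B.card * Real.exp (t * (B.card - iotaE S * W.card)) *
          (p * Real.exp (-(t * iotaE S)) + (1 - p) * Real.exp t) := by ring
      _ ≤ _ := mul_le_of_le_one_right (by positivity) hpt

theorem IsBernoulli.measure_enclosedEvent_le {S : Fin d → Γ} {p t : ℝ}
    {P : Measure (Γ × Fin d → Bool)} (hP : IsBernoulli S p P) (hp0 : 0 ≤ p) (hp1 : p ≤ 1)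
    (ht : 0 ≤ t) (hpt : p * Real.exp (-(t * iotaE S)) + (1 - p) * Real.exp t ≤ 1)
    (Λ W : Finset Γ) :
    P (EnclosedEvent S Λ W) ≤ ENNReal.ofReal (Real.exp (-(t * iotaE S)) ^ W.card) := by
  have hfin : (⋃ W ∈ Λ.powerset, edgeBoundary S W).Finite :=
    Λ.powerset.finite_toSet.biUnion fun W _ => edgeBoundary_finite S W
  have h := hP.measure_cylinder_inter_enclosedEvent_le hp0 hp1 ht hpt Λ hfin.toFinset
    (fun W hW => by
      rw [Set.Finite.coe_toFinset]
      exact Set.subset_biUnion_of_mem (u := fun W => edgeBoundary S W)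
        (Finset.mem_powerset.2 hW))
    _ ∅ ∅ W (by simp) (Nat.lt_succ_self _) (by simp)
  convert h using 2
  · simp [openClosedCylinder]
  · rw [← Real.exp_nat_mul]
    simp
    ring

theorem compl_percEvent_subset_iUnion_enclosedEvent (S : Fin d → Γ) (W : Finset Γ) :
    (PercEvent S)ᶜ ⊆ ⋃ Λ : Finset Γ, EnclosedEvent S Λ W := by
  intro ω hω
  have hfin : ∀ v, (Cluster S ω v).Finite := fun v =>
    Set.not_infinite.1 fun h => hω ⟨v, h⟩
  have hX : (⋃ v ∈ W, Cluster S ω v).Finite := W.finite_toSet.biUnion fun v _ => hfin v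
  have hstep : ∀ e a b, ω e = true → Joins S e a b →
      a ∈ hX.toFinset → b ∈ hX.toFinset := by
    intro e a b he hj ha
    simp only [Set.Finite.mem_toFinset, mem_iUnion, exists_prop] at ha ⊢
    obtain ⟨v, hv, hva⟩ := ha
    exact ⟨v, hv, Relation.ReflTransGen.tail hva ⟨e, he, hj⟩⟩
  refine mem_iUnion.2 ⟨hX.toFinset, hX.toFinset, fun v hv => ?_, subset_rfl, fun e he => ?_⟩
  · simp only [Set.Finite.mem_toFinset, mem_iUnion, exists_prop]
    exact ⟨v, hv, Relation.ReflTransGen.refl⟩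
  · by_contra hne
    have hopen : ω e = true := by simpa using hne
    rcases he with ⟨h, h'⟩ | ⟨h, h'⟩
    · exact h' (hstep e _ _ hopen (Or.inl ⟨rfl, rfl⟩) h)
    · exact h' (hstep e _ _ hopen (Or.inr ⟨rfl, rfl⟩) h)

theorem directed_enclosedEvent (S : Fin d → Γ) (W : Finset Γ) :
    Directed (· ⊆ ·) fun Λ : Finset Γ => EnclosedEvent S Λ W := by
  exact Monotone.directed_le fun Λ Λ' h ω ⟨F, h1, h2, h3⟩ => ⟨F, h1, h2.trans h, h3⟩

theorem IsBernoulli.measure_percEvent_eq_one [Countable Γ] [Infinite Γ] {S : Fin d → Γ} {p t : ℝ}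
    {P : Measure (Γ × Fin d → Bool)} (hP : IsBernoulli S p P) (hp0 : 0 ≤ p) (hp1 : p ≤ 1)
    (ht : 0 < t) (hι : 0 < iotaE S)
    (hpt : p * Real.exp (-(t * iotaE S)) + (1 - p) * Real.exp t ≤ 1) :
    P (PercEvent S) = 1 := by
  have := hP.1
  have hbound : ∀ k : ℕ, P (PercEvent S)ᶜ ≤ ENNReal.ofReal (Real.exp (-(t * iotaE S)) ^ k) := by
    intro k
    obtain ⟨W, hW⟩ := Infinite.exists_subset_card_eq Γ k
    refine (measure_mono (compl_percEvent_subset_iUnion_enclosedEvent S W)).trans ?_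
    rw [(directed_enclosedEvent S W).measure_iUnion, ← hW]
    exact iSup_le fun Λ => hP.measure_enclosedEvent_le hp0 hp1 ht.le hpt Λ W
  have hlim : Filter.Tendsto (fun k : ℕ => ENNReal.ofReal (Real.exp (-(t * iotaE S)) ^ k))
      Filter.atTop (nhds 0) := by
    rw [← ENNReal.ofReal_zero]
    refine ENNReal.tendsto_ofReal (tendsto_pow_atTop_nhds_zero_of_lt_one (Real.exp_nonneg _) ?_)
    rw [Real.exp_lt_one_iff]
    have := mul_pos ht hι
    linarith
  have hzero : P (PercEvent S)ᶜ = 0 := le_antisymm (ge_of_tendsto' hlim hbound) zero_le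
  refine le_antisymm prob_le_one ?_
  calc (1 : ENNReal) = P univ := measure_univ.symm
    _ = P (PercEvent S ∪ (PercEvent S)ᶜ) := by rw [union_compl_self]
    _ ≤ P (PercEvent S) + P (PercEvent S)ᶜ := measure_union_le _ _
    _ = P (PercEvent S) := by rw [hzero, add_zero]

theorem exists_exp_weight_le_one {p ι : ℝ} (hp1 : p < 1) (hι : 0 < ι)
    (hp : 1 / (ι + 1) < p) :
    ∃ t : ℝ, 0 < t ∧ p * Real.exp (-(t * ι)) + (1 - p) * Real.exp t ≤ 1 := by
  have hp0 : 0 < p := lt_trans (by positivity) hp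
  have hpι : 1 < p * (ι + 1) := (div_lt_iff₀ (by positivity)).1 hp
  set t := (p * (ι + 1) - 1) / ι with ht
  have htι : t * ι = p * (ι + 1) - 1 := by rw [ht]; field_simp
  have ht0 : 0 < t := div_pos (by linarith) hι
  have ht1 : t < 1 := by
    rw [ht, div_lt_one hι]
    nlinarith
  refine ⟨t, ht0, ?_⟩
  have h1 : Real.exp (-(t * ι)) ≤ (1 + t * ι)⁻¹ := by
    rw [Real.exp_neg]
    exact inv_anti₀ (by nlinarith) (by linarith [Real.add_one_le_exp (t * ι)])
  have h2 : Real.exp t ≤ (1 - t)⁻¹ := by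
    rw [← neg_neg t, Real.exp_neg, neg_neg]
    exact inv_anti₀ (by linarith) (by linarith [Real.add_one_le_exp (-t)])
  have hq : 0 < 1 - p := by linarith
  have hs : 0 < 1 + t * ι := by positivity
  have hr : 0 < 1 - t := by linarith
  calc _ ≤ p * (1 + t * ι)⁻¹ + (1 - p) * (1 - t)⁻¹ := by gcongr
    _ = (p * (1 - t) + (1 - p) * (1 + t * ι)) / ((1 + t * ι) * (1 - t)) := by
      field_simp
    _ ≤ 1 := by
      rw [div_le_one (by positivity)]
      nlinarith

theorem countable_of_closure_range_eq_top {S : Fin d → Γ}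
    (hgen : Subgroup.closure (Set.range S) = ⊤) : Countable Γ := by
  have : Countable (FreeGroup (Fin d)) :=
    (Quot.mk_surjective (r := FreeGroup.Red.Step (α := Fin d))).countable
  exact (FreeGroup.lift_surjective_iff_closure_range_eq_top.2 hgen).countable

/-- Benjamini–Schramm: for a Cayley graph `G = Cay(Γ, S)` of an infinite finitely generated
group, `p_c(G) ≤ 1 / (ι_E(G) + 1)`. -/
theorem pc_le_one_div_iotaE_add_one (Γ : Type) [Group Γ] [Infinite Γ] (d : ℕ)
    (S : Fin d → Γ) (hgen : Subgroup.closure (Set.range S) = ⊤) :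
    pc S ≤ 1 / (iotaE S + 1) := by
  have := countable_of_closure_range_eq_top hgen
  have hbdd : BddBelow {p | p ∈ Icc (0:ℝ) 1 ∧
      ∀ P : Measure (Γ × Fin d → Bool), IsBernoulli S p P → P (PercEvent S) = 1} :=
    ⟨0, fun p hp => hp.1.1⟩
  rcases (iotaE_nonneg S).eq_or_lt with hι | hι
  · rw [← hι, zero_add, div_one]
    rw [pc]
    rcases Set.eq_empty_or_nonempty {p | p ∈ Icc (0:ℝ) 1 ∧
      ∀ P : Measure (Γ × Fin d → Bool), IsBernoulli S p P → P (PercEvent S) = 1} with h | ⟨p, hp⟩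
    · rw [h, Real.sInf_empty]
      exact zero_le_one
    · exact (csInf_le hbdd hp).trans hp.1.2
  · have hlt : 1 / (iotaE S + 1) < 1 := by
      rw [div_lt_one (by linarith)]
      linarith
    refine le_of_forall_gt_imp_ge_of_dense fun q hq => ?_
    obtain ⟨p, hp, hpq⟩ := exists_between (lt_min hq hlt)
    have hp1 : p < 1 := hpq.trans_le (min_le_right _ _)
    have hp0 : 0 ≤ p := le_trans (by positivity) hp.le
    obtain ⟨t, ht, hpt⟩ := exists_exp_weight_le_one hp1 hι hp
    exact (csInf_le hbdd ⟨⟨hp0, hp1.le⟩, fun P hP =>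
      hP.measure_percEvent_eq_one hp0 hp1.le ht hι hpt⟩).trans
        (hpq.le.trans (min_le_left _ _))

end
end
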